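/- arXiv:1404.7703 — 2 statements merged into one kernel-verified Lean document; each statement's English description precedes it below -/
import Mathlib

section
/- There exists a universal constant C > 0 such that for every integer k ≥ 2, every real ε > 0, and every connected weighted graph G on n vertices, there exists a subgraph H of G (with the inherited edge weights) such that: (i) H is a ((2k−1)·(1+ε))-spanner of G; (ii) H has at most C·n^{1+1/k} edges; and (iii) w(H) ≤ C · w(MST(G)) · n^{1/k} · (1 + k/(ε^{1+1/k} · log k)). -/
open SimpleGraph

/-- The weight of a walk: the sum of the weights of its edges. -/
noncomputable def walkWeight {V : Type} {G : SimpleGraph V} (w : Sym2 V → NNReal)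
    {u v : V} (p : G.Walk u v) : ENNReal :=
  (p.edges.map (fun e => (w e : ENNReal))).sum

/-- The weighted shortest-path distance: the infimum over all `u`–`v` walks of their
weight (`∞` if no walk exists). -/
noncomputable def wdist {V : Type} (G : SimpleGraph V) (w : Sym2 V → NNReal)
    (u v : V) : ENNReal :=
  ⨅ p : G.Walk u v, walkWeight w p

/-- `H` is a `t`-spanner of `G` (with the inherited weights `w`):
`d_H(u,v) ≤ t · d_G(u,v)` for all vertices `u, v`. -/
def IsTSpanner {V : Type} (G H : SimpleGraph V) (w : Sym2 V → NNReal) (t : ℝ) : Prop :=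
  ∀ u v : V, wdist H w u v ≤ ENNReal.ofReal t * wdist G w u v

/-- The total weight of a graph: the sum of the weights of all its edges. -/
noncomputable def totalWeight {V : Type} [Fintype V] (G : SimpleGraph V)
    (w : Sym2 V → NNReal) : ℝ :=
  ∑ e ∈ G.edgeSet.toFinite.toFinset, (w e : ℝ)

/-- The weight of a minimum spanning tree of a connected graph `G`. -/
noncomputable def mstWeight {V : Type} [Fintype V] (G : SimpleGraph V)
    (w : Sym2 V → NNReal) : ℝ :=
  sInf {x | ∃ T : SimpleGraph V, T ≤ G ∧ T.IsTree ∧ x = totalWeight T w}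

namespace LightSpanner

/-- A sequence of weighted shortcuts between points of the line. For each shortcut `i` there is
a `1`-Lipschitz function that no earlier shortcut stretches, but that separates the endpoints of
`i` by more than `t` times its weight. -/
structure ShortcutSystem (V ι : Type*) [LinearOrder ι] where
  a : ι → V
  b : ι → V
  wt : ι → ℝ
  pos : V → ℝ
  φ : ι → ℝ → ℝ
  t : ℝ
  wt_pos : ∀ i, 0 < wt i
  wt_mono : Monotone wt
  lip : ∀ i x y, |φ i x - φ i y| ≤ |x - y|
  short : ∀ i j, j < i → |φ i (pos (a j)) - φ i (pos (b j))| ≤ wt j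
  long : ∀ i, t * wt i < |φ i (pos (a i)) - φ i (pos (b i))|

/-- Non-backtracking walks with `h` steps. -/
def NBWalk {α : Type*} (adj : α → α → Prop) (h : ℕ) (q : ℕ → α) : Prop :=
  (∀ i < h, adj (q i) (q (i + 1))) ∧ ∀ i, i + 2 ≤ h → q i ≠ q (i + 2)

namespace ShortcutSystem

variable {V ι α : Type*} [LinearOrder ι] (M : ShortcutSystem V ι)

/-- The shortcut `i` joins the clusters `x` and `y`. -/
def Joins (cl : V → α) (i : ι) (x y : α) : Prop :=
  (cl (M.a i) = x ∧ cl (M.b i) = y) ∨ (cl (M.a i) = y ∧ cl (M.b i) = x)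

/-- Some shortcut in `S` joins the clusters `x` and `y`. -/
def Link (S : Finset ι) (cl : V → α) (x y : α) : Prop := ∃ i ∈ S, M.Joins cl i x y

variable {M}

lemma Joins.symm {cl : V → α} {i : ι} {x y : α} (h : M.Joins cl i x y) : M.Joins cl i y x :=
  Or.symm h

lemma Link.symm {S : Finset ι} {cl : V → α} {x y : α} (h : M.Link S cl x y) :
    M.Link S cl y x := by
  obtain ⟨i, hi, h⟩ := h
  exact ⟨i, hi, h.symm⟩

lemma Joins.exists_ends {cl : V → α} {i : ι} {x y : α} (h : M.Joins cl i x y) :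
    ∃ u v, cl u = x ∧ cl v = y ∧
      (∀ f, |M.φ f (M.pos u) - M.φ f (M.pos v)| =
        |M.φ f (M.pos (M.a i)) - M.φ f (M.pos (M.b i))|) := by
  rcases h with ⟨h1, h2⟩ | ⟨h1, h2⟩
  · exact ⟨_, _, h1, h2, fun _ => rfl⟩
  · exact ⟨_, _, h2, h1, fun _ => abs_sub_comm _ _⟩

lemma abs_sub_le_three (a b c d : ℝ) : |a - d| ≤ |a - b| + |b - c| + |c - d| := by
  have h1 := abs_sub_le a b d
  have h2 := abs_sub_le b c d
  linarith

/-- Walking through clusters along shortcuts that precede `f`. -/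
lemma abs_sub_le_of_chain {cl : V → α} {ℓ : ℝ}
    (hℓ : ∀ u v, cl u = cl v → |M.pos u - M.pos v| ≤ ℓ) (q : ℕ → α) (e : ℕ → ι) (f : ι)
    (j n : ℕ) (hj : ∀ l, j ≤ l → l < j + n → M.Joins cl (e l) (q l) (q (l + 1)) ∧ e l < f)
    (u v : V) (hu : cl u = q j) (hv : cl v = q (j + n)) :
    |M.φ f (M.pos u) - M.φ f (M.pos v)| ≤ n * M.wt f + (n + 1) * ℓ := by
  induction n generalizing v with
  | zero =>
    have := (M.lip f (M.pos u) (M.pos v)).trans (hℓ u v (by simp_all))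
    simpa using this
  | succ n ih =>
    obtain ⟨hJ, hlt⟩ := hj (j + n) (by omega) (by omega)
    obtain ⟨x, y, hx, hy, hxy⟩ := hJ.exists_ends
    have h1 := ih (fun l h1 h2 => hj l h1 (by omega)) x hx
    have h2 := M.short f _ hlt
    rw [← hxy] at h2
    have h3 := M.wt_mono hlt.le
    have h4 := (M.lip f (M.pos y) (M.pos v)).trans (hℓ y v (by rw [hy, hv, add_assoc]))
    have h5 := abs_sub_le_three (M.φ f (M.pos u)) (M.φ f (M.pos x)) (M.φ f (M.pos y))
      (M.φ f (M.pos v))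
    push_cast
    linarith

/-- There is no short non-backtracking walk of clusters whose two ends are close. -/
theorem not_nbWalk {S : Finset ι} {cl : V → α} {ℓ : ℝ}
    (hℓ : ∀ u v, cl u = cl v → |M.pos u - M.pos v| ≤ ℓ) (h : ℕ) (q : ℕ → α) (δ : ℝ)
    (h1 : 1 ≤ h) (hδ : 0 ≤ δ) (hq : NBWalk (M.Link S cl) h q)
    (hclose : ∀ f ∈ S, ∃ u v, cl u = q 0 ∧ cl v = q h ∧
      |M.φ f (M.pos u) - M.φ f (M.pos v)| ≤ δ)
    (hb : ∀ f ∈ S, ((h : ℝ) - 1) * M.wt f + (h + 1) * ℓ + δ ≤ M.t * M.wt f) : False := by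
  induction h using Nat.strong_induction_on generalizing q δ with
  | _ h ih =>
  have hex : ∀ i : ℕ, ∃ x : ι, i < h → x ∈ S ∧ M.Joins cl x (q i) (q (i + 1)) := by
    intro i
    by_cases hi : i < h
    · obtain ⟨x, hx⟩ := hq.1 i hi
      exact ⟨x, fun _ => hx⟩
    · obtain ⟨x, hx⟩ := hq.1 0 (by omega)
      exact ⟨x, fun h => absurd h hi⟩
  choose e he using hex
  obtain ⟨m, hm, hmax⟩ := Finset.exists_max_image (Finset.range h) e ⟨0, by simp; omega⟩
  simp only [Finset.mem_range] at hm hmax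
  have hfS := (he m hm).1
  set f := e m with hf
  have hl := M.long f
  have hbf := hb f hfS
  have hwf := M.wt_pos f
  have hℓ0 : 0 ≤ ℓ := by simpa using hℓ (M.a f) (M.a f) rfl
  by_cases huniq : ∀ l < h, l ≠ m → e l ≠ f
  · obtain ⟨u', v', hu', hv', huv⟩ := hclose f hfS
    obtain ⟨u, v, hu, hv, heq⟩ := (he m hm).2.exists_ends
    rw [← hf] at heq
    have c1 := abs_sub_le_of_chain hℓ q e f 0 m
      (fun l _ h2 => ⟨(he l (by omega)).2,
        lt_of_le_of_ne (hmax l (by omega)) (huniq l (by omega) (by omega))⟩) u' u hu'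
      (by rw [hu, zero_add])
    have c2 := abs_sub_le_of_chain hℓ q e f (m + 1) (h - 1 - m)
      (fun l h1 h2 => ⟨(he l (by omega)).2,
        lt_of_le_of_ne (hmax l (by omega)) (huniq l (by omega) (by omega))⟩) v v' hv
      (by rw [hv']; congr 1; omega)
    have c3 := abs_sub_le_three (M.φ f (M.pos u)) (M.φ f (M.pos u')) (M.φ f (M.pos v'))
      (M.φ f (M.pos v))
    rw [abs_sub_comm (M.φ f (M.pos u)) (M.φ f (M.pos u')),
      abs_sub_comm (M.φ f (M.pos v')) (M.φ f (M.pos v)), heq] at c3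
    have hc : ((h - 1 - m : ℕ) : ℝ) = h - 1 - m := by
      rw [Nat.cast_sub (by omega), Nat.cast_sub h1]; simp
    rw [hc] at c2
    linarith
  · push Not at huniq
    obtain ⟨l, hlh, hlm, hle⟩ := huniq
    have hgap : ∃ g, 0 < g ∧ ∃ i, i + g < h ∧ e i = f ∧ e (i + g) = f := by
      rcases lt_or_gt_of_ne hlm with hlt | hlt
      · exact ⟨m - l, by omega, l, by omega, hle, by rw [hf]; congr 1; omega⟩
      · exact ⟨l - m, by omega, m, by omega, hf.symm, by rw [← hle]; congr 1; omega⟩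
    classical
    obtain ⟨hg0, i, hig, hei, heg⟩ := Nat.find_spec hgap
    have hmin := fun g => Nat.find_min hgap (m := g)
    set g := Nat.find hgap with hg
    have hbetween : ∀ l, i + 1 ≤ l → l < i + g → e l < f := by
      intro l h1 h2
      refine lt_of_le_of_ne (hmax l (by omega)) fun hl => ?_
      exact hmin (l - i) (by omega) ⟨by omega, i, by omega, hei, by rw [← hl]; congr 1; omega⟩
    have hJi := (he i (by omega)).2
    have hJg := (he (i + g) hig).2
    rw [hei] at hJi
    rw [heg] at hJg
    have hgh : (g : ℝ) + 1 ≤ h := by exact_mod_cast (by omega : g + 1 ≤ h)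
    have key : q (i + 1) = q (i + g) ∨ q i = q (i + g) := by
      rcases hJi with ⟨p1, p2⟩ | ⟨p1, p2⟩ <;> rcases hJg with ⟨p3, p4⟩ | ⟨p3, p4⟩ <;> grind
    rcases key with hk | hk
    · -- opposite directions: a shorter closed walk
      have hg1 : g ≠ 1 := by
        rintro h1
        rw [h1] at hJg hk
        refine hq.2 i (by omega) ?_
        rcases hJi with ⟨p1, p2⟩ | ⟨p1, p2⟩ <;> rcases hJg with ⟨p3, p4⟩ | ⟨p3, p4⟩ <;> grind
      have hc : ((g - 1 : ℕ) : ℝ) = g - 1 := by rw [Nat.cast_sub hg0]; simp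
      refine ih (g - 1) (by omega) (fun l => q (i + 1 + l)) 0 (by omega) le_rfl
        ⟨fun l hl => hq.1 (i + 1 + l) (by omega), fun l hl => hq.2 (i + 1 + l) (by omega)⟩ ?_ ?_
      · intro f' _
        obtain ⟨u, v, hu, hv, _⟩ := hJi.exists_ends
        refine ⟨v, v, by simpa using hv, ?_, by simp⟩
        rw [hv, hk]; congr 1; omega
      · intro f' hf'
        have := hb f' hf'
        have hw := M.wt_pos f'
        rw [hc]
        nlinarith
    · have hJi' := hJi.exists_ends
      obtain ⟨u, v, hu, hv, heq⟩ := hJi'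
      have c1 := abs_sub_le_of_chain hℓ q e f (i + 1) (g - 1)
        (fun l h1 h2 => ⟨(he l (by omega)).2, hbetween l h1 (by omega)⟩) v u hv
        (by rw [hu, hk]; congr 1; omega)
      have hc : ((g - 1 : ℕ) : ℝ) = g - 1 := by rw [Nat.cast_sub hg0]; simp
      rw [abs_sub_comm, heq, hc] at c1
      nlinarith

end ShortcutSystem

lemma log_sum_ge {α : Type*} (F : Finset α) (f : α → ℝ) (hF : F.Nonempty)
    (hf : ∀ z ∈ F, 0 < f z) :
    Real.log F.card + (∑ z ∈ F, Real.log (f z)) / F.card ≤ Real.log (∑ z ∈ F, f z) := by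
  have hc : (0 : ℝ) < F.card := by exact_mod_cast hF.card_pos
  have h := (strictConcaveOn_log_Ioi.concaveOn).le_map_sum (t := F)
    (w := fun _ => (F.card : ℝ)⁻¹) (p := f) (fun _ _ => by positivity)
    (by simp [hc.ne']) (fun z hz => hf z hz)
  simp only [smul_eq_mul, ← Finset.mul_sum] at h
  have hs : 0 < ∑ z ∈ F, f z := Finset.sum_pos hf hF
  rw [Real.log_mul (by positivity) hs.ne', Real.log_inv] at h
  rw [div_eq_inv_mul]
  linarith

lemma sum_log_erase_ge {α : Type*} [DecidableEq α] (F : Finset α) (f : α → ℝ) (d : ℕ)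
    (hd : 1 ≤ d) (hF : d + 1 ≤ F.card) (hf : ∀ z ∈ F, 0 < f z) :
    ∑ z ∈ F, Real.log (f z) + F.card * Real.log d ≤
      ∑ x ∈ F, Real.log (∑ z ∈ F.erase x, f z) := by
  have hcard : ∀ x ∈ F, ((F.erase x).card : ℝ) = F.card - 1 := by
    intro x hx
    rw [Finset.card_erase_of_mem hx, Nat.cast_sub (by omega)]; simp
  have hF' : (d : ℝ) + 1 ≤ F.card := by exact_mod_cast hF
  have hd' : (1 : ℝ) ≤ d := by exact_mod_cast hd
  have hm : (0 : ℝ) < F.card - 1 := by linarith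
  have key : ∀ x ∈ F, Real.log d + (∑ z ∈ F, Real.log (f z) - Real.log (f x)) / (F.card - 1) ≤
      Real.log (∑ z ∈ F.erase x, f z) := by
    intro x hx
    have hne : (F.erase x).Nonempty := by
      rw [← Finset.card_pos, Finset.card_erase_of_mem hx]; omega
    have := log_sum_ge (F.erase x) f hne (fun z hz => hf z (Finset.mem_of_mem_erase hz))
    rw [hcard x hx, ← Finset.add_sum_erase F _ hx] at *
    have hl : Real.log d ≤ Real.log (F.card - 1) := Real.log_le_log (by linarith) (by linarith)
    simp only [add_sub_cancel_left]
    linarith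
  refine le_trans (le_of_eq ?_) (Finset.sum_le_sum key)
  rw [Finset.sum_add_distrib, ← Finset.sum_div, Finset.sum_sub_distrib]
  simp only [Finset.sum_const, nsmul_eq_mul]
  field_simp
  ring

/-- The entropy gain of one step away from a set of directed edges. -/
lemma sum_log_step_ge {α : Type*} [DecidableEq α] (E : Finset (α × α)) (f g : α → α → ℝ) (d : ℕ)
    (hd : 1 ≤ d)
    (hE : ∀ e ∈ E, d + 1 ≤ (E.filter (fun e' => e'.1 = e.1)).card)
    (hf : ∀ e ∈ E, 0 < f e.1 e.2)
    (hg : ∀ e ∈ E, ∑ e' ∈ E.filter (fun e' => e'.1 = e.1 ∧ e'.2 ≠ e.2), f e'.1 e'.2 ≤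
      g e.2 e.1) :
    ∑ e ∈ E, Real.log (f e.1 e.2) + E.card * Real.log d ≤ ∑ e ∈ E, Real.log (g e.2 e.1) := by
  have hle : ∀ e ∈ E, Real.log (∑ e' ∈ E.filter (fun e' => e'.1 = e.1 ∧ e'.2 ≠ e.2),
      f e'.1 e'.2) ≤ Real.log (g e.2 e.1) := by
    intro e he
    refine Real.log_le_log (Finset.sum_pos (fun x hx => hf x (Finset.mem_filter.1 hx).1) ?_)
      (hg e he)
    have h1 := hE e he
    have h2 : 1 < (E.filter (fun e' => e'.1 = e.1)).card := by omega
    obtain ⟨a, ha, hae⟩ := Finset.exists_mem_ne h2 e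
    simp only [Finset.mem_filter] at ha
    refine ⟨a, Finset.mem_filter.2 ⟨ha.1, ha.2, fun h => hae (Prod.ext ha.2 h)⟩⟩
  refine le_trans ?_ (Finset.sum_le_sum hle)
  have hmaps : ∀ e ∈ E, e.1 ∈ E.image Prod.fst := fun e he => Finset.mem_image_of_mem _ he
  have e1 : (E.card : ℝ) * Real.log d = ∑ e ∈ E, Real.log d := by simp
  rw [e1, ← Finset.sum_add_distrib, ← Finset.sum_fiberwise_of_maps_to hmaps,
    ← Finset.sum_fiberwise_of_maps_to hmaps (fun e => Real.log (∑ e' ∈ E.filter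
      (fun e' => e'.1 = e.1 ∧ e'.2 ≠ e.2), f e'.1 e'.2))]
  refine Finset.sum_le_sum fun y hy => ?_
  obtain ⟨e0, he0, rfl⟩ := Finset.mem_image.1 hy
  have := sum_log_erase_ge (E.filter (fun e' => e'.1 = e0.1)) (fun e => f e.1 e.2) d hd
    (hE e0 he0) (fun z hz => hf z (Finset.mem_filter.1 hz).1)
  rw [Finset.sum_add_distrib]
  simp only [Finset.sum_const, nsmul_eq_mul]
  refine this.trans (le_of_eq (Finset.sum_congr rfl fun x hx => ?_))
  congr 1
  refine Finset.sum_congr ?_ fun _ _ => rfl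
  simp only [Finset.mem_filter] at hx
  ext e
  simp only [Finset.mem_erase, Finset.mem_filter, ne_eq, Prod.ext_iff]
  grind

namespace NBWalk

variable {α : Type*} {adj : α → α → Prop}

lemma cons {n : ℕ} {x : α} {q : ℕ → α} (hq : NBWalk adj n q) (h : adj x (q 0))
    (hx : n = 0 ∨ q 1 ≠ x) : NBWalk adj (n + 1) (fun i => Nat.casesOn i x q) := by
  refine ⟨fun i hi => ?_, fun i hi => ?_⟩
  · cases i with
    | zero => exact h
    | succ i => exact hq.1 i (by omega)
  · cases i with
    | zero => exact (hx.resolve_left (by omega)).symm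
    | succ i => exact hq.2 i (by omega)

/-- Two non-backtracking walks leaving `y` through different vertices form a longer one. -/
lemma join {n : ℕ} {y : α} {q q' : ℕ → α} (hsymm : ∀ x y, adj x y → adj y x)
    (hq : NBWalk adj n q) (hq' : NBWalk adj n q') (h : adj y (q 0)) (h' : adj y (q' 0))
    (hy : n = 0 ∨ q 1 ≠ y) (hy' : n = 0 ∨ q' 1 ≠ y) (hne : q 0 ≠ q' 0) :
    ∃ p : ℕ → α, NBWalk adj (2 * n + 2) p ∧ p 0 = q n ∧ p (2 * n + 2) = q' n := by
  refine ⟨fun i => if i ≤ n then q (n - i) else if i = n + 1 then y else q' (i - n - 2),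
    ⟨fun i hi => ?_, fun i hi => ?_⟩, by simp, ?_⟩
  · rcases lt_trichotomy i n with h1 | h1 | h1
    · simp only [h1.le, if_true, Nat.succ_le_of_lt h1]
      have := hsymm _ _ (hq.1 (n - (i + 1)) (by omega))
      rwa [show n - (i + 1) + 1 = n - i by omega] at this
    · subst h1; simpa using hsymm _ _ h
    · rcases eq_or_lt_of_le (Nat.succ_le_of_lt h1) with h2 | h2
      · subst h2; simpa [show n + 1 + 1 - n - 2 = 0 by omega] using h'
      · have := hq'.1 (i - n - 2) (by omega)
        rw [show i - n - 2 + 1 = i + 1 - n - 2 by omega] at this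
        simpa [show ¬ i ≤ n by omega, show ¬ i + 1 ≤ n by omega, show i ≠ n + 1 by omega,
          show i ≠ n by omega] using this
  · rcases lt_or_ge n (i + 2) with h1 | h1
    · rcases lt_trichotomy n i with h2 | h2 | h2
      · by_cases h3 : i = n + 1
        · subst h3
          have := (hy'.resolve_left (by omega)).symm
          simpa [show n + 1 + 2 - n - 2 = 1 by omega, show ¬ n + 1 + 2 ≤ n by omega] using this
        · have := hq'.2 (i - n - 2) (by omega)
          rw [show i - n - 2 + 2 = i + 2 - n - 2 by omega] at this
          simpa [show ¬ i ≤ n by omega, show ¬ i + 2 ≤ n by omega, h3,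
            show i + 2 ≠ n + 1 by omega] using this
      · subst h2
        simpa using hne
      · have h3 : n = i + 1 := by omega
        subst h3
        simpa using hy.resolve_left (by omega)
    · have := (hq.2 (n - (i + 2)) (by omega)).symm
      rw [show n - (i + 2) + 2 = n - i by omega] at this
      simpa [h1, show i ≤ n by omega] using this
  · simp [show ¬ 2 * n + 2 ≤ n by omega, show 2 * n + 2 - n - 2 = n by omega,
      show 2 * n + 1 ≠ n by omega]

end NBWalk

section Spread

variable {α β : Type*} [DecidableEq α] [DecidableEq β]

/-- The directed edges, alternately reversed. -/
def dirs (E : Finset (α × α)) (i : ℕ) : Finset (α × α) :=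
  if Even i then E else E.image Prod.swap

/-- What is reached from `y` after `i` non-backtracking steps when coming from `x`. -/
def spread (E : Finset (α × α)) (R : α → Finset β) : ℕ → α → α → Finset β
  | 0, _, y => R y
  | i + 1, x, y =>
    ((dirs E i).filter (fun e => e.1 = y ∧ e.2 ≠ x)).biUnion (fun e => spread E R i e.1 e.2)

lemma mem_dirs_succ {E : Finset (α × α)} {i : ℕ} {e : α × α} :
    e ∈ dirs E (i + 1) ↔ e.swap ∈ dirs E i := by
  unfold dirs
  by_cases h : Even i
  · have h' : ¬ Even (i + 1) := by simpa [Nat.even_add_one] using h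
    simp only [h, h', if_true, if_false, Finset.mem_image]
    constructor
    · rintro ⟨a, ha, rfl⟩; simpa using ha
    · intro h; exact ⟨_, h, by simp⟩
  · have h' : Even (i + 1) := by simpa [Nat.even_add_one] using h
    simp only [h, h', if_true, if_false, Finset.mem_image]
    constructor
    · intro h; exact ⟨_, h, rfl⟩
    · rintro ⟨a, ha, h⟩; rwa [← Prod.swap_injective h]

lemma dirs_succ (E : Finset (α × α)) (i : ℕ) : dirs E (i + 1) = (dirs E i).image Prod.swap := by
  ext e
  rw [mem_dirs_succ, Finset.mem_image]
  constructor
  · intro h; exact ⟨_, h, by simp⟩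
  · rintro ⟨a, ha, rfl⟩; simpa using ha

lemma sum_dirs_succ (E : Finset (α × α)) (i : ℕ) (f : α → α → ℝ) :
    ∑ e ∈ dirs E (i + 1), f e.1 e.2 = ∑ e ∈ dirs E i, f e.2 e.1 := by
  rw [dirs_succ, Finset.sum_image (fun _ _ _ _ h => Prod.swap_injective h)]
  rfl

lemma card_dirs (E : Finset (α × α)) (i : ℕ) : (dirs E i).card = E.card := by
  induction i with
  | zero => simp [dirs]
  | succ i ih => rw [dirs_succ, Finset.card_image_of_injective _ Prod.swap_injective, ih]

variable {E : Finset (α × α)} {R : α → Finset β} {adj : α → α → Prop}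

lemma adj_of_mem_dirs (hsymm : ∀ x y, adj x y → adj y x) (hadj : ∀ e ∈ E, adj e.1 e.2) {i : ℕ}
    {e : α × α} (he : e ∈ dirs E i) : adj e.1 e.2 := by
  induction i generalizing e with
  | zero => exact hadj e (by simpa [dirs] using he)
  | succ i ih => exact hsymm _ _ (ih (mem_dirs_succ.1 he))

lemma exists_nbWalk_of_mem_spread (hsymm : ∀ x y, adj x y → adj y x)
    (hadj : ∀ e ∈ E, adj e.1 e.2) (i : ℕ) (x y : α) (p : β) (hp : p ∈ spread E R i x y) :
    ∃ q : ℕ → α, NBWalk adj i q ∧ q 0 = y ∧ (i = 0 ∨ q 1 ≠ x) ∧ p ∈ R (q i) := by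
  induction i generalizing x y with
  | zero => exact ⟨fun _ => y, ⟨by simp, by simp⟩, rfl, Or.inl rfl, hp⟩
  | succ i ih =>
    simp only [spread, Finset.mem_biUnion, Finset.mem_filter] at hp
    obtain ⟨⟨y', z⟩, ⟨he, rfl, hz⟩, hp⟩ := hp
    obtain ⟨q, hq, rfl, hq1, hpq⟩ := ih _ _ hp
    have ha := adj_of_mem_dirs hsymm hadj he
    exact ⟨_, hq.cons ha hq1, rfl, Or.inr hz, hpq⟩

lemma dirs_fiber_card {d : ℕ}
    (hE1 : ∀ e ∈ E, d + 1 ≤ (E.filter (fun e' => e'.1 = e.1)).card)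
    (hE2 : ∀ e ∈ E, d + 1 ≤ (E.filter (fun e' => e'.2 = e.2)).card) (i : ℕ) :
    ∀ e ∈ dirs E i, d + 1 ≤ ((dirs E i).filter (fun e' => e'.1 = e.1)).card := by
  intro e he
  unfold dirs at he ⊢
  split_ifs at he ⊢ with h
  · exact hE1 e he
  · obtain ⟨e', he', rfl⟩ := Finset.mem_image.1 he
    refine (hE2 e' he').trans (le_of_eq ?_)
    rw [Finset.filter_image, Finset.card_image_of_injective _ Prod.swap_injective]
    rfl

/-- If non-backtracking walks of length at most `2 * s` lead to disjoint sets, then the sets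
reached in `i ≤ s` steps are large on average. -/
theorem sum_log_spread_ge {d s : ℕ} (hd : 1 ≤ d)
    (hsymm : ∀ x y, adj x y → adj y x) (hadj : ∀ e ∈ E, adj e.1 e.2)
    (hR : ∀ x, (R x).Nonempty)
    (hE1 : ∀ e ∈ E, d + 1 ≤ (E.filter (fun e' => e'.1 = e.1)).card)
    (hE2 : ∀ e ∈ E, d + 1 ≤ (E.filter (fun e' => e'.2 = e.2)).card)
    (hdisj : ∀ h q, 1 ≤ h → h ≤ 2 * s → NBWalk adj h q → Disjoint (R (q 0)) (R (q h)))
    (i : ℕ) (hi : i ≤ s) :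
    (∀ e ∈ dirs E i, (spread E R i e.1 e.2).Nonempty) ∧
    ∑ e ∈ E, Real.log (R e.2).card + i * (E.card * Real.log d) ≤
      ∑ e ∈ dirs E i, Real.log (spread E R i e.1 e.2).card := by
  induction i with
  | zero => exact ⟨fun e _ => hR _, by simp [dirs, spread]⟩
  | succ i ih =>
    obtain ⟨ihn, ihs⟩ := ih (by omega)
    have hfib := dirs_fiber_card hE1 hE2 i
    constructor
    · intro e he
      rw [mem_dirs_succ] at he
      have h2 : 1 < ((dirs E i).filter (fun e' => e'.1 = e.swap.1)).card := by
        have := hfib _ he; omega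
      obtain ⟨a, ha, hae⟩ := Finset.exists_mem_ne h2 e.swap
      simp only [Finset.mem_filter] at ha
      obtain ⟨p, hp⟩ := ihn a ha.1
      refine ⟨p, ?_⟩
      simp only [spread, Finset.mem_biUnion, Finset.mem_filter]
      exact ⟨a, ⟨ha.1, by simpa using ha.2, fun h => hae (Prod.ext ha.2 (by simpa using h))⟩, hp⟩
    · have hg : ∀ e ∈ dirs E i, ∑ e' ∈ (dirs E i).filter (fun e' => e'.1 = e.1 ∧ e'.2 ≠ e.2),
          ((spread E R i e'.1 e'.2).card : ℝ) ≤ (spread E R (i + 1) e.2 e.1).card := by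
        intro e he
        rw [spread, Finset.card_biUnion]
        · push_cast; rfl
        · intro a ha b hb hab
          simp only [Finset.mem_coe, Finset.mem_filter] at ha hb
          rw [Function.onFun, Finset.disjoint_left]
          intro p hp1 hp2
          obtain ⟨q, hq, hq0, hq1, hpq⟩ := exists_nbWalk_of_mem_spread hsymm hadj i _ _ p hp1
          obtain ⟨q', hq', hq0', hq1', hpq'⟩ := exists_nbWalk_of_mem_spread hsymm hadj i _ _ p hp2
          have ha1 := adj_of_mem_dirs hsymm hadj ha.1
          have hb1 := adj_of_mem_dirs hsymm hadj hb.1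
          rw [ha.2.1] at ha1 hq1
          rw [hb.2.1] at hb1 hq1'
          obtain ⟨r, hr, hr0, hr1⟩ := hq.join hsymm hq' (by rwa [hq0]) (by rwa [hq0']) hq1 hq1'
            (by rw [hq0, hq0']; exact fun h => hab (Prod.ext (ha.2.1.trans hb.2.1.symm) h))
          have := hdisj _ r (by omega) (by omega) hr
          rw [hr0, hr1] at this
          exact Finset.disjoint_left.1 this hpq hpq'
      have h := sum_log_step_ge (dirs E i) (fun x y => ((spread E R i x y).card : ℝ))
        (fun x y => ((spread E R (i + 1) x y).card : ℝ)) d hd hfib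
        (fun e he => by exact_mod_cast (ihn e he).card_pos) hg
      rw [sum_dirs_succ E i (fun x y => Real.log (spread E R (i + 1) x y).card)]
      rw [card_dirs] at h
      push_cast
      linarith

end Spread

/-- Deleting vertices of small degree from a bipartite graph. -/
lemma exists_bipartite_core {α : Type*} [DecidableEq α] (D : ℕ) (A B : Finset α)
    (E : Finset (α × α)) (hA : ∀ e ∈ E, e.1 ∈ A) (hB : ∀ e ∈ E, e.2 ∈ B) :
    ∃ E' ⊆ E, (∀ e ∈ E', D ≤ (E'.filter (fun e' => e'.1 = e.1)).card) ∧
      (∀ e ∈ E', D ≤ (E'.filter (fun e' => e'.2 = e.2)).card) ∧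
      E.card ≤ E'.card + D * (A.card + B.card) := by
  induction hn : A.card + B.card using Nat.strong_induction_on generalizing A B E with
  | _ n ih =>
  by_cases h1 : ∀ e ∈ E, D ≤ (E.filter (fun e' => e'.1 = e.1)).card
  · by_cases h2 : ∀ e ∈ E, D ≤ (E.filter (fun e' => e'.2 = e.2)).card
    · exact ⟨E, Finset.Subset.refl _, h1, h2, Nat.le_add_right _ _⟩
    · push Not at h2
      obtain ⟨e, he, hlt⟩ := h2
      have hc := Finset.card_erase_add_one (hB e he)
      obtain ⟨E', hE', p1, p2, p3⟩ := ih (A.card + (B.erase e.2).card) (by omega) A (B.erase e.2)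
        (E.filter (fun e' => ¬ e'.2 = e.2)) (fun x hx => hA x (Finset.mem_filter.1 hx).1)
        (fun x hx => Finset.mem_erase.2 ⟨(Finset.mem_filter.1 hx).2,
          hB x (Finset.mem_filter.1 hx).1⟩) rfl
      refine ⟨E', hE'.trans (Finset.filter_subset _ _), p1, p2, ?_⟩
      have := Finset.card_filter_add_card_filter_not (s := E) (fun e' => e'.2 = e.2)
      have h3 : n = A.card + (B.erase e.2).card + 1 := by omega
      rw [h3, mul_add, mul_one]
      omega
  · push Not at h1
    obtain ⟨e, he, hlt⟩ := h1
    have hc := Finset.card_erase_add_one (hA e he)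
    obtain ⟨E', hE', p1, p2, p3⟩ := ih ((A.erase e.1).card + B.card) (by omega) (A.erase e.1) B
      (E.filter (fun e' => ¬ e'.1 = e.1))
      (fun x hx => Finset.mem_erase.2 ⟨(Finset.mem_filter.1 hx).2,
        hA x (Finset.mem_filter.1 hx).1⟩) (fun x hx => hB x (Finset.mem_filter.1 hx).1) rfl
    refine ⟨E', hE'.trans (Finset.filter_subset _ _), p1, p2, ?_⟩
    have := Finset.card_filter_add_card_filter_not (s := E) (fun e' => e'.1 = e.1)
    have h3 : n = (A.erase e.1).card + B.card + 1 := by omega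
    rw [h3, mul_add, mul_one]
    omega

/-- Deleting vertices of small degree from a multigraph with edges `i ↦ (f i, g i)`. -/
lemma exists_core {ι α : Type*} [DecidableEq α] (f g : ι → α) (r : ℕ) (A : Finset α)
    (S : Finset ι) (hA : ∀ i ∈ S, f i ∈ A ∧ g i ∈ A) :
    ∃ Y ⊆ A, ∃ S' ⊆ S, (∀ i ∈ S', f i ∈ Y ∧ g i ∈ Y) ∧
      (∀ x ∈ Y, r ≤ (S'.filter (fun i => f i = x ∨ g i = x)).card) ∧
      S.card + r * Y.card ≤ S'.card + r * A.card := by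
  induction hn : A.card using Nat.strong_induction_on generalizing A S with
  | _ n ih =>
  by_cases h1 : ∀ x ∈ A, r ≤ (S.filter (fun i => f i = x ∨ g i = x)).card
  · exact ⟨A, Finset.Subset.refl _, S, Finset.Subset.refl _, hA, h1, by rw [hn]⟩
  · push Not at h1
    obtain ⟨x, hx, hlt⟩ := h1
    have hc := Finset.card_erase_add_one hx
    obtain ⟨Y, hY, S', hS', p1, p2, p3⟩ := ih (A.erase x).card (by omega) (A.erase x)
      (S.filter (fun i => ¬ (f i = x ∨ g i = x))) (fun i hi => by
        obtain ⟨h2, h3⟩ := Finset.mem_filter.1 hi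
        push Not at h3
        exact ⟨Finset.mem_erase.2 ⟨h3.1, (hA i h2).1⟩, Finset.mem_erase.2 ⟨h3.2, (hA i h2).2⟩⟩) rfl
    refine ⟨Y, hY.trans (Finset.erase_subset _ _), S', hS'.trans (Finset.filter_subset _ _), p1, p2,
      ?_⟩
    have := Finset.card_filter_add_card_filter_not (s := S) (fun i => f i = x ∨ g i = x)
    rw [← hn, ← hc, mul_add, mul_one]
    omega

/-- One round of growth of the sets `R x`. -/
theorem exists_growth {α β : Type*} [DecidableEq α] [DecidableEq β] {adj : α → α → Prop}
    [DecidableRel adj] (hsymm : ∀ x y, adj x y → adj y x) (Y : Finset α) (D s : ℕ) (hD : 2 ≤ D)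
    (hnb : ∀ x ∈ Y, 4 * D ≤ (Y.filter (adj x)).card) (R : α → Finset β)
    (hR : ∀ x, (R x).Nonempty)
    (hdisj : ∀ h q, 1 ≤ h → h ≤ 4 * s → NBWalk adj h q → Disjoint (R (q 0)) (R (q h))) :
    ∃ R' : α → Finset β, (∀ x, (R x).card ≤ (R' x).card) ∧
      (∀ x, ∀ p ∈ R' x, p ∈ R x ∨
        ∃ q : ℕ → α, NBWalk adj (2 * s) q ∧ q 0 = x ∧ p ∈ R (q (2 * s))) ∧
      ∑ x ∈ Y, Real.log (R x).card + s * Y.card * Real.log (D - 1 : ℕ) ≤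
        ∑ x ∈ Y, Real.log (R' x).card := by
  choose! N hN hNc using fun x hx => Finset.exists_subset_card_eq (hnb x hx)
  set E0 : Finset (α × α) := (Y.sigma N).image (fun p => (p.2, p.1)) with hE0
  have hmem : ∀ e, e ∈ E0 ↔ e.2 ∈ Y ∧ e.1 ∈ N e.2 := by
    rintro ⟨y, x⟩
    simp only [hE0, Finset.mem_image, Finset.mem_sigma]
    constructor
    · rintro ⟨⟨a, b⟩, h, heq⟩
      obtain ⟨rfl, rfl⟩ := Prod.mk.inj heq
      exact h
    · intro h; exact ⟨⟨x, y⟩, h, rfl⟩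
  have hE0c : E0.card = 4 * D * Y.card := by
    rw [hE0, Finset.card_image_of_injOn, Finset.card_sigma, Finset.sum_congr rfl hNc]
    · simp [mul_comm]
    · rintro ⟨a, b⟩ _ ⟨a', b'⟩ _ h
      obtain ⟨rfl, rfl⟩ := Prod.mk.inj h
      rfl
  have hNY : ∀ x ∈ Y, ∀ y ∈ N x, y ∈ Y ∧ adj x y := fun x hx y hy =>
    Finset.mem_filter.1 (hN x hx hy)
  obtain ⟨E, hE, h1, h2, h3⟩ := exists_bipartite_core D Y Y E0
    (fun e he => (hNY _ ((hmem e).1 he).1 _ ((hmem e).1 he).2).1) (fun e he => ((hmem e).1 he).1)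
  have hadj : ∀ e ∈ E, adj e.1 e.2 := fun e he =>
    hsymm _ _ (hNY _ ((hmem e).1 (hE he)).1 _ ((hmem e).1 (hE he)).2).2
  have hEc : 2 * D * Y.card ≤ E.card := by
    rw [hE0c] at h3
    have : 4 * D * Y.card = 2 * D * Y.card + D * (Y.card + Y.card) := by ring
    omega
  have hs := (sum_log_spread_ge (d := D - 1) (s := 2 * s) (R := R) (by omega) hsymm hadj hR
    (fun e he => by have := h1 e he; omega) (fun e he => by have := h2 e he; omega)
    (fun h q a b => hdisj h q a (by omega)) (2 * s) le_rfl).2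
  have hdirs : dirs E (2 * s) = E := by simp [dirs]
  rw [hdirs] at hs
  have hex : ∀ x, ∃ F : Finset β, (R x).card ≤ F.card ∧ (∀ p ∈ F, p ∈ R x ∨
        ∃ q : ℕ → α, NBWalk adj (2 * s) q ∧ q 0 = x ∧ p ∈ R (q (2 * s))) ∧
      ∀ e ∈ E, e.2 = x → (spread E R (2 * s) e.1 e.2).card ≤ F.card := by
    intro x
    obtain ⟨F, hF, hmax⟩ := Finset.exists_max_image
      (insert (R x) ((E.filter (fun e => e.2 = x)).image (fun e => spread E R (2 * s) e.1 e.2)))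
      Finset.card ⟨_, Finset.mem_insert_self _ _⟩
    refine ⟨F, hmax _ (Finset.mem_insert_self _ _), ?_, ?_⟩
    · intro p hp
      rcases Finset.mem_insert.1 hF with rfl | hF
      · exact Or.inl hp
      · obtain ⟨e, he, rfl⟩ := Finset.mem_image.1 hF
        obtain ⟨q, hq, hq0, -, hpq⟩ := exists_nbWalk_of_mem_spread hsymm hadj _ _ _ p hp
        exact Or.inr ⟨q, hq, hq0.trans (Finset.mem_filter.1 he).2, hpq⟩
    · intro e he hx
      exact hmax _ (Finset.mem_insert_of_mem (Finset.mem_image_of_mem _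
        (Finset.mem_filter.2 ⟨he, hx⟩)))
  choose R' hR1 hR2 hR3 using hex
  refine ⟨R', hR1, hR2, ?_⟩
  have hlog : ∀ x, 0 ≤ Real.log (R' x).card - Real.log (R x).card := fun x =>
    sub_nonneg.2 (Real.log_le_log (by exact_mod_cast (hR x).card_pos) (by exact_mod_cast hR1 x))
  have hup : ∑ e ∈ E, (Real.log (spread E R (2 * s) e.1 e.2).card - Real.log (R e.2).card) ≤
      ∑ x ∈ Y, 4 * D * (Real.log (R' x).card - Real.log (R x).card) := by
    calc _ ≤ ∑ e ∈ E, (Real.log (R' e.2).card - Real.log (R e.2).card) := by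
          refine Finset.sum_le_sum fun e he => sub_le_sub_right ?_ _
          rcases Nat.eq_zero_or_pos (spread E R (2 * s) e.1 e.2).card with h0 | h0
          · rw [h0]; simpa using Real.log_natCast_nonneg _
          · exact Real.log_le_log (by exact_mod_cast h0) (by exact_mod_cast hR3 _ e he rfl)
      _ ≤ ∑ e ∈ E0, (Real.log (R' e.2).card - Real.log (R e.2).card) :=
          Finset.sum_le_sum_of_subset_of_nonneg hE fun e _ _ => hlog _
      _ = ∑ x ∈ Y, 4 * D * (Real.log (R' x).card - Real.log (R x).card) := by
          rw [hE0, Finset.sum_image, Finset.sum_sigma]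
          · refine Finset.sum_congr rfl fun x hx => ?_
            simp [hNc x hx, mul_sub]
          · rintro ⟨a, b⟩ _ ⟨a', b'⟩ _ h
            obtain ⟨rfl, rfl⟩ := Prod.mk.inj h
            rfl
  rw [Finset.sum_sub_distrib, ← Finset.mul_sum, Finset.sum_sub_distrib] at hup
  have hl0 : 0 ≤ Real.log (D - 1 : ℕ) := Real.log_natCast_nonneg _
  have hEc' : (2 * D * Y.card : ℝ) ≤ E.card := by exact_mod_cast hEc
  have hm : (2 * s : ℝ) * (2 * D * Y.card * Real.log (D - 1 : ℕ)) ≤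
      2 * s * (E.card * Real.log (D - 1 : ℕ)) := by gcongr
  have hDpos : (0 : ℝ) < 4 * D := by positivity
  push_cast at hs
  have : 4 * (D : ℝ) * (s * Y.card * Real.log (D - 1 : ℕ)) ≤
      4 * D * (∑ x ∈ Y, Real.log (R' x).card - ∑ x ∈ Y, Real.log (R x).card) := by
    nlinarith
  have := le_of_mul_le_mul_left this hDpos
  linarith

namespace ShortcutSystem

variable {V ι α : Type*} [LinearOrder ι] {M : ShortcutSystem V ι}

lemma not_parallel_of_lt {S : Finset ι} {cl : V → α} {ℓ : ℝ}
    (hℓ : ∀ u v, cl u = cl v → |M.pos u - M.pos v| ≤ ℓ)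
    (hb : ∀ f ∈ S, M.wt f + 3 * ℓ ≤ M.t * M.wt f)
    {i j : ι} (hi : i ∈ S) (hij : j < i) {x y : α}
    (h : M.Joins cl i x y) (h' : M.Joins cl j x y) : False := by
  obtain ⟨u, v, hu, hv, he⟩ := h.exists_ends
  have hℓ0 : 0 ≤ ℓ := by simpa using hℓ u u rfl
  have h1 := abs_sub_le_of_chain hℓ (fun l => if l = 0 then x else y) (fun _ => j) i 0 1
    (fun l _ h2 => by
      obtain rfl : l = 0 := by omega
      exact ⟨by simpa using h', hij⟩) u v (by simpa using hu) (by simpa using hv)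
  rw [he] at h1
  have h3 := M.long i
  have h4 := hb i hi
  push_cast at h1
  linarith

lemma eq_of_joins {S : Finset ι} {cl : V → α} {ℓ : ℝ}
    (hℓ : ∀ u v, cl u = cl v → |M.pos u - M.pos v| ≤ ℓ)
    (hb : ∀ f ∈ S, M.wt f + 3 * ℓ ≤ M.t * M.wt f)
    {i j : ι} (hi : i ∈ S) (hj : j ∈ S) {x y : α}
    (h : M.Joins cl i x y) (h' : M.Joins cl j x y) : i = j := by
  rcases lt_trichotomy i j with h1 | h1 | h1
  · exact (not_parallel_of_lt hℓ hb hj h1 h' h).elim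
  · exact h1
  · exact (not_parallel_of_lt hℓ hb hi h1 h h').elim

lemma card_incident_le [DecidableEq α] {S : Finset ι} {cl : V → α} {ℓ : ℝ}
    (hℓ : ∀ u v, cl u = cl v → |M.pos u - M.pos v| ≤ ℓ)
    (hb : ∀ f ∈ S, M.wt f + 3 * ℓ ≤ M.t * M.wt f)
    {Y : Finset α}
    (hY : ∀ i ∈ S, cl (M.a i) ∈ Y ∧ cl (M.b i) ∈ Y) (x : α) [DecidablePred (M.Link S cl x)] :
    (S.filter (fun i => cl (M.a i) = x ∨ cl (M.b i) = x)).card ≤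
      (Y.filter (M.Link S cl x)).card := by
  have hJ : ∀ i, cl (M.a i) = x ∨ cl (M.b i) = x →
      M.Joins cl i x (if cl (M.a i) = x then cl (M.b i) else cl (M.a i)) := by
    intro i hi
    split_ifs with h
    · exact Or.inl ⟨h, rfl⟩
    · exact Or.inr ⟨rfl, hi.resolve_left h⟩
  refine Finset.card_le_card_of_injOn
    (fun i => if cl (M.a i) = x then cl (M.b i) else cl (M.a i)) ?_ ?_
  · intro i hi
    simp only [Finset.coe_filter, Set.mem_ofPred_eq] at hi ⊢
    refine ⟨?_, i, hi.1, hJ i hi.2⟩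
    split_ifs
    · exact (hY i hi.1).2
    · exact (hY i hi.1).1
  · intro i hi j hj hij
    simp only [Finset.coe_filter, Set.mem_ofPred_eq] at hi hj hij
    have h1 := hJ i hi.2
    rw [hij] at h1
    exact eq_of_joins hℓ hb hi.1 hj.1 h1 (hJ j hj.2)

lemma closed_nbWalk_false {S : Finset ι} {cl : V → α} {ℓ : ℝ} {k : ℕ}
    (hℓ : ∀ u v, cl u = cl v → |M.pos u - M.pos v| ≤ ℓ)
    (hb : ∀ f ∈ S, (2 * (k : ℝ) - 1) * M.wt f + (2 * k + 1) * ℓ ≤ M.t * M.wt f)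
    (h : ℕ) (q : ℕ → α) (h1 : 1 ≤ h) (h2 : h ≤ 2 * k) (hq : NBWalk (M.Link S cl) h q)
    (hc : q 0 = q h) : False := by
  obtain ⟨i, hi, hJ⟩ := hq.1 0 (by omega)
  obtain ⟨u, v, hu, hv, he⟩ := hJ.exists_ends
  have hℓ0 : 0 ≤ ℓ := by simpa using hℓ u u rfl
  refine not_nbWalk hℓ h q 0 h1 le_rfl hq
    (fun f _ => ⟨u, u, hu, by rw [hu, hc], by simp⟩) fun f hf => ?_
  have h3 := hb f hf
  have h4 := M.wt_pos f
  have h5 : (h : ℝ) ≤ 2 * k := by exact_mod_cast h2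
  nlinarith [mul_le_mul_of_nonneg_right h5 h4.le, mul_le_mul_of_nonneg_right h5 hℓ0]

/-- The Moore bound for the graph of clusters. -/
theorem card_le_moore {S : Finset ι} {cl : V → α} {ℓ : ℝ} {k : ℕ} (hk : 2 ≤ k)
    (hℓ : ∀ u v, cl u = cl v → |M.pos u - M.pos v| ≤ ℓ)
    (hb : ∀ f ∈ S, (2 * (k : ℝ) - 1) * M.wt f + (2 * k + 1) * ℓ ≤ M.t * M.wt f)
    {Y : Finset α} (hY : ∀ i ∈ S, cl (M.a i) ∈ Y ∧ cl (M.b i) ∈ Y) :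
    (S.card : ℝ) ≤ 3 * Y.card * (Y.card : ℝ) ^ (1 / (k : ℝ)) := by
  classical
  set N := Y.card with hN
  set x := (N : ℝ) ^ (1 / (k : ℝ)) with hx
  rcases S.eq_empty_or_nonempty with rfl | ⟨i0, hi0⟩
  · simp only [Finset.card_empty, CharP.cast_eq_zero]; positivity
  have hN1 : 1 ≤ N := Finset.card_pos.2 ⟨_, (hY i0 hi0).1⟩
  have hx1 : 1 ≤ x := Real.one_le_rpow (by exact_mod_cast hN1) (by positivity)
  have hk' : (2 : ℝ) ≤ k := by exact_mod_cast hk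
  have hℓ0 : 0 ≤ ℓ := by simpa using hℓ (M.a i0) (M.a i0) rfl
  have hb3 : ∀ f ∈ S, M.wt f + 3 * ℓ ≤ M.t * M.wt f := by
    intro f hf
    have := hb f hf
    have := M.wt_pos f
    nlinarith
  by_contra! hlt
  set d := ⌊x⌋₊ + 1 with hd
  obtain ⟨Z, hZ, S', hS', p1, p2, p3⟩ :=
    exists_core (fun i => cl (M.a i)) (fun i => cl (M.b i)) (d + 1) Y S hY
  have hfl : (⌊x⌋₊ : ℝ) ≤ x := Nat.floor_le (by linarith)
  have hS'ne : S'.Nonempty := by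
    rw [Finset.nonempty_iff_ne_empty]
    rintro rfl
    have h1 : S.card ≤ (d + 1) * N := by
      rw [← hN, Finset.card_empty] at p3; omega
    have h2 : (S.card : ℝ) ≤ (⌊x⌋₊ + 2) * N := by
      refine (Nat.cast_le.2 h1).trans (le_of_eq ?_)
      rw [hd]; push_cast; ring
    have h3 : (1 : ℝ) ≤ N := by exact_mod_cast hN1
    nlinarith
  have hb3' : ∀ f ∈ S', M.wt f + 3 * ℓ ≤ M.t * M.wt f := fun f hf => hb3 f (hS' hf)
  have hdeg : ∀ z ∈ Z, d + 1 ≤ (Z.filter (M.Link S' cl z)).card := fun z hz =>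
    (p2 z hz).trans (card_incident_le hℓ hb3' p1 z)
  set E := (Z ×ˢ Z).filter (fun e => M.Link S' cl e.1 e.2) with hE
  have hadj : ∀ e ∈ E, M.Link S' cl e.1 e.2 := fun e he => (Finset.mem_filter.1 he).2
  have hEZ : ∀ e ∈ E, e.1 ∈ Z ∧ e.2 ∈ Z := fun e he =>
    Finset.mem_product.1 (Finset.mem_filter.1 he).1
  have hsymm : ∀ x y, M.Link S' cl x y → M.Link S' cl y x := fun _ _ h => h.symm
  have hb' : ∀ f ∈ S', (2 * (k : ℝ) - 1) * M.wt f + (2 * k + 1) * ℓ ≤ M.t * M.wt f :=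
    fun f hf => hb f (hS' hf)
  have hmain := (sum_log_spread_ge (E := E) (R := fun x => ({x} : Finset α)) (d := d) (s := k)
    (by omega) hsymm hadj (fun _ => Finset.singleton_nonempty _)
    (fun e he => (hdeg e.1 (hEZ e he).1).trans (by
      refine Finset.card_le_card_of_injOn (fun z => (e.1, z)) ?_ (fun _ _ _ _ h => by simpa using h)
      intro z hz
      simp only [Finset.coe_filter, Set.mem_ofPred_eq] at hz ⊢
      exact ⟨Finset.mem_filter.2 ⟨Finset.mem_product.2 ⟨(hEZ e he).1, hz.1⟩, hz.2⟩, trivial⟩))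
    (fun e he => (hdeg e.2 (hEZ e he).2).trans (by
      refine Finset.card_le_card_of_injOn (fun z => (z, e.2)) ?_ (fun _ _ _ _ h => by simpa using h)
      intro z hz
      simp only [Finset.coe_filter, Set.mem_ofPred_eq] at hz ⊢
      exact ⟨Finset.mem_filter.2 ⟨Finset.mem_product.2 ⟨hz.1, (hEZ e he).2⟩, hsymm _ _ hz.2⟩,
        trivial⟩))
    (fun h q h1 h2 hq => by
      rw [Finset.disjoint_singleton]
      exact fun hc => closed_nbWalk_false hℓ hb' h q h1 h2 hq hc) k le_rfl).2
  have hle : ∑ e ∈ dirs E k,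
      Real.log (spread E (fun x => ({x} : Finset α)) k e.1 e.2).card ≤ E.card * Real.log N := by
    rw [← card_dirs E k, ← nsmul_eq_mul]
    refine Finset.sum_le_card_nsmul _ _ _ fun e he => ?_
    have hsub : spread E (fun x => ({x} : Finset α)) k e.1 e.2 ⊆ Y := by
      intro p hp
      obtain ⟨q, hq, hq0, hq1, hpq⟩ := exists_nbWalk_of_mem_spread hsymm hadj k _ _ p hp
      rw [Finset.mem_singleton.1 hpq]
      obtain ⟨i, hi, hJ⟩ := hq.1 (k - 1) (by omega)
      rw [show k - 1 + 1 = k by omega] at hJ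
      rcases hJ with ⟨-, h⟩ | ⟨h, -⟩
      · rw [← h]; exact (hY i (hS' hi)).2
      · rw [← h]; exact (hY i (hS' hi)).1
    rcases Nat.eq_zero_or_pos (spread E (fun x => ({x} : Finset α)) k e.1 e.2).card with h0 | h0
    · rw [h0]; simpa using Real.log_natCast_nonneg _
    · exact Real.log_le_log (by exact_mod_cast h0) (by exact_mod_cast Finset.card_le_card hsub)
  have hEpos : 0 < (E.card : ℝ) := by
    obtain ⟨i, hi⟩ := hS'ne
    have hmem : (cl (M.a i), cl (M.b i)) ∈ E :=
      Finset.mem_filter.2 ⟨Finset.mem_product.2 (p1 i hi), i, hi, Or.inl ⟨rfl, rfl⟩⟩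
    exact_mod_cast Finset.card_pos.2 ⟨_, hmem⟩
  have hlogd : Real.log x < Real.log d := by
    refine Real.log_lt_log (by linarith) ?_
    rw [hd]; exact_mod_cast Nat.lt_floor_add_one x
  have hlogx : k * Real.log x = Real.log N := by
    rw [hx, Real.log_rpow (by exact_mod_cast hN1)]
    field_simp
  have h0 : ∑ e ∈ E, Real.log (({e.2} : Finset α)).card = 0 := by simp
  simp only [h0, zero_add] at hmain
  have := hmain.trans hle
  rw [← hlogx] at this
  nlinarith [mul_lt_mul_of_pos_left hlogd (mul_pos hEpos (by linarith : (0 : ℝ) < k))]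

end ShortcutSystem

lemma sum_range_mul_eq (f : ℕ → ℝ) (m Q : ℕ) :
    ∑ z ∈ Finset.range (m * Q), f z =
      ∑ o ∈ Finset.range Q, ∑ x ∈ Finset.range m, f (x * Q + o) := by
  induction m with
  | zero => simp
  | succ m ih =>
    rw [Nat.succ_mul, Finset.sum_range_add, ih, ← Finset.sum_add_distrib]
    exact Finset.sum_congr rfl fun o _ => (Finset.sum_range_succ _ _).symm

namespace ShortcutSystem

variable {V ι : Type*} [LinearOrder ι] (M : ShortcutSystem V ι)

/-- The index of a vertex on the grid of mesh `σ`. -/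
noncomputable def idx (σ : ℝ) (v : V) : ℕ := ⌊M.pos v / σ⌋₊

variable {M}

lemma idx_bounds {σ : ℝ} (hσ : 0 < σ) (hpos : ∀ v, 0 ≤ M.pos v) {Q c : ℕ} (hQ : 0 < Q) (v : V)
    (h : M.idx σ v / Q = c) : c * (Q * σ) ≤ M.pos v ∧ M.pos v ≤ (c + 1) * (Q * σ) := by
  have h0 : 0 ≤ M.pos v / σ := div_nonneg (hpos v) hσ.le
  have h1 := Nat.floor_le h0
  have h2 := Nat.lt_floor_add_one (M.pos v / σ)
  rw [le_div_iff₀ hσ] at h1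
  rw [div_lt_iff₀ hσ] at h2
  change (M.idx σ v : ℝ) * σ ≤ _ at h1
  change _ < ((M.idx σ v : ℝ) + 1) * σ at h2
  have h3 : c * Q ≤ M.idx σ v := by rw [← h]; exact Nat.div_mul_le_self _ _
  have h4 : M.idx σ v + 1 ≤ (c + 1) * Q := by
    have := Nat.lt_div_mul_add (a := M.idx σ v) hQ
    rw [h] at this
    rw [add_mul, one_mul]; omega
  have h3' : (c : ℝ) * Q ≤ M.idx σ v := by exact_mod_cast h3
  have h4' : (M.idx σ v : ℝ) + 1 ≤ (c + 1) * Q := by exact_mod_cast h4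
  constructor
  · nlinarith
  · nlinarith

lemma abs_pos_sub_le {σ : ℝ} (hσ : 0 < σ) (hpos : ∀ v, 0 ≤ M.pos v) {Q : ℕ} (hQ : 0 < Q) (u v : V)
    (h : M.idx σ u / Q = M.idx σ v / Q) : |M.pos u - M.pos v| ≤ Q * σ := by
  obtain ⟨h1, h2⟩ := idx_bounds hσ hpos hQ u h
  obtain ⟨h3, h4⟩ := idx_bounds hσ hpos hQ v rfl
  rw [abs_le]
  constructor <;> linarith

lemma abs_grid_sub_le {σ : ℝ} (hσ : 0 < σ) (hpos : ∀ v, 0 ≤ M.pos v) {Q c o : ℕ} (ho : o < Q)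
    (v : V) (h : M.idx σ v / Q = c) : |((c * Q + o : ℕ) : ℝ) * σ - M.pos v| ≤ Q * σ := by
  obtain ⟨h1, h2⟩ := idx_bounds hσ hpos (by omega) v h
  have h3 : (o : ℝ) ≤ Q := by exact_mod_cast ho.le
  have h4 : (0 : ℝ) ≤ o := by positivity
  have h5 := mul_le_mul_of_nonneg_right h3 hσ.le
  have h6 := mul_nonneg h4 hσ.le
  push_cast
  rw [abs_le]
  constructor <;> linarith

/-- The common setting for the analysis of one weight scale `[Q * w₀, ρ * Q * w₀)`: the clusters
are intervals of the grid of mesh `ε * w₀ / 2`. -/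
structure Scale (M : ShortcutSystem V ι) (S : Finset ι) (k : ℕ) (ε w₀ : ℝ) (ρ Q m : ℕ) :
    Prop where
  two_le_k : 2 ≤ k
  eps_pos : 0 < ε
  w_pos : 0 < w₀
  t_eq : M.t = (2 * k - 1) * (1 + ε)
  two_le_ρ : 2 ≤ ρ
  Q_pos : 0 < Q
  le_wt : ∀ i ∈ S, Q * w₀ ≤ M.wt i
  wt_lt : ∀ i ∈ S, M.wt i < ρ * Q * w₀
  pos_nonneg : ∀ v, 0 ≤ M.pos v
  idx_lt : ∀ v, M.idx (ε * w₀ / 2) v < m * (ρ * Q)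

namespace Scale

variable {S : Finset ι} {k : ℕ} {ε w₀ : ℝ} {ρ Q m : ℕ}

lemma σ_pos (h : Scale M S k ε w₀ ρ Q m) : 0 < ε * w₀ / 2 := by
  have := h.eps_pos
  have := h.w_pos
  positivity

lemma moore_budget (h : Scale M S k ε w₀ ρ Q m) (f : ι) (hf : f ∈ S) :
    (2 * (k : ℝ) - 1) * M.wt f + (2 * k + 1) * (Q * (ε * w₀ / 2)) ≤ M.t * M.wt f := by
  rw [h.t_eq]
  have h1 := h.le_wt f hf
  have h2 : (2 : ℝ) ≤ k := by exact_mod_cast h.two_le_k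
  have h3 := h.eps_pos
  have h4 := mul_le_mul_of_nonneg_left h1 (by positivity : 0 ≤ (2 * (k : ℝ) + 1) * (ε / 2))
  have h5 := M.wt_pos f
  have h6 : 0 ≤ (k - 3 / 2 : ℝ) * (ε * M.wt f) := by
    apply mul_nonneg (by linarith); positivity
  nlinarith

lemma card_le_small (h : Scale M S k ε w₀ ρ Q m) {S' : Finset ι} (hS' : S' ⊆ S) {Y : Finset ℕ}
    (hY : ∀ i ∈ S', M.idx (ε * w₀ / 2) (M.a i) / (ρ * Q) ∈ Y ∧
      M.idx (ε * w₀ / 2) (M.b i) / (ρ * Q) ∈ Y) (hYm : Y.card ≤ m) :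
    (S'.card : ℝ) ≤ 3 * (ρ * Y.card) * ((ρ * m : ℕ) : ℝ) ^ (1 / (k : ℝ)) := by
  have hρ := h.two_le_ρ
  set Z := Y.biUnion (fun x => Finset.Ico (x * ρ) (x * ρ + ρ)) with hZ
  have hZc : Z.card ≤ ρ * Y.card := by
    refine Finset.card_biUnion_le.trans (le_of_eq ?_)
    simp [mul_comm]
  have hmem : ∀ v, M.idx (ε * w₀ / 2) v / (ρ * Q) ∈ Y → M.idx (ε * w₀ / 2) v / Q ∈ Z := by
    intro v hv
    refine Finset.mem_biUnion.2 ⟨_, hv, ?_⟩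
    rw [mul_comm ρ Q, ← Nat.div_div_eq_div_mul, Finset.mem_Ico]
    exact ⟨Nat.div_mul_le_self _ _, Nat.lt_div_mul_add (by omega)⟩
  have := card_le_moore (Y := Z) h.two_le_k (abs_pos_sub_le h.σ_pos h.pos_nonneg h.Q_pos)
    (fun f hf => h.moore_budget f (hS' hf)) (fun i hi => ⟨hmem _ (hY i hi).1, hmem _ (hY i hi).2⟩)
  refine this.trans ?_
  have h1 : (Z.card : ℝ) ≤ ρ * Y.card := by exact_mod_cast hZc
  have h2 : (Z.card : ℝ) ≤ (ρ * m : ℕ) := by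
    exact_mod_cast hZc.trans (Nat.mul_le_mul_left _ hYm)
  gcongr

lemma cluster_mem (h : Scale M S k ε w₀ ρ Q m) (v : V) :
    M.idx (ε * w₀ / 2) v / (ρ * Q) ∈ Finset.range m := by
  rw [Finset.mem_range, Nat.div_lt_iff_lt_mul
    (Nat.mul_pos (by have := h.two_le_ρ; omega) h.Q_pos)]
  exact h.idx_lt v

/-- The Moore bound at one scale. -/
lemma card_le (h : Scale M S k ε w₀ ρ Q m) :
    (S.card : ℝ) ≤ 3 * (ρ * m) * ((ρ * m : ℕ) : ℝ) ^ (1 / (k : ℝ)) := by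
  simpa using h.card_le_small (Finset.Subset.refl S) (Y := Finset.range m)
    (fun i _ => ⟨h.cluster_mem _, h.cluster_mem _⟩) (by simp)

lemma walk_dist (h : Scale M S k ε w₀ ρ Q m) {S' : Finset ι} (hS' : S' ⊆ S) {o : ℕ}
    (ho : o < ρ * Q) (f : ι) (hf : ρ * Q * w₀ ≤ M.wt f) (q : ℕ → ℕ) (n : ℕ)
    (hq : ∀ i < n, M.Link S' (fun v => M.idx (ε * w₀ / 2) v / (ρ * Q)) (q i) (q (i + 1))) :
    |M.φ f ((q 0 * (ρ * Q) + o : ℕ) * (ε * w₀ / 2)) -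
      M.φ f ((q n * (ρ * Q) + o : ℕ) * (ε * w₀ / 2))| ≤ n * ((1 + ε) * (ρ * Q * w₀)) := by
  induction n with
  | zero => simp
  | succ n ih =>
    have h1 := ih fun i hi => hq i (by omega)
    obtain ⟨e, he, hJ⟩ := hq n (by omega)
    obtain ⟨u, v, hu, hv, heq⟩ := hJ.exists_ends
    have hwe := h.wt_lt e (hS' he)
    have hef : e < f := by
      by_contra! hle
      have := M.wt_mono hle
      linarith
    have h2 := M.short f e hef
    rw [← heq] at h2
    have h3 := (M.lip f _ _).trans (abs_grid_sub_le h.σ_pos h.pos_nonneg ho u hu)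
    have h4 := (M.lip f _ _).trans (abs_grid_sub_le h.σ_pos h.pos_nonneg ho v hv)
    rw [abs_sub_comm] at h4
    have h5 := abs_sub_le_three
      (M.φ f ((q n * (ρ * Q) + o : ℕ) * (ε * w₀ / 2))) (M.φ f (M.pos u)) (M.φ f (M.pos v))
      (M.φ f ((q (n + 1) * (ρ * Q) + o : ℕ) * (ε * w₀ / 2)))
    have h6 := abs_sub_le (M.φ f ((q 0 * (ρ * Q) + o : ℕ) * (ε * w₀ / 2)))
      (M.φ f ((q n * (ρ * Q) + o : ℕ) * (ε * w₀ / 2)))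
      (M.φ f ((q (n + 1) * (ρ * Q) + o : ℕ) * (ε * w₀ / 2)))
    rw [Nat.cast_mul ρ Q] at h3 h4
    push_cast at *
    linarith

lemma disjoint_of_nbWalk (h : Scale M S k ε w₀ ρ Q m) {s : ℕ} (hs : 1 ≤ s)
    (hsρ : 10 * s * ρ + 1 ≤ 2 * k) {R : ℕ → Finset ℕ}
    (hclose : ∀ z, ∀ p ∈ R z, ∀ f, Q * w₀ ≤ M.wt f →
      |M.φ f (z * (ε * w₀ / 2)) - M.φ f (p * (ε * w₀ / 2))| ≤ 4 * s * ((1 + ε) * (Q * w₀)))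
    {S' : Finset ι} (hS' : S' ⊆ S) {o : ℕ} (ho : o < ρ * Q) (n : ℕ) (q : ℕ → ℕ) (hn : 1 ≤ n)
    (hn4 : n ≤ 4 * s)
    (hq : NBWalk (M.Link S' (fun v => M.idx (ε * w₀ / 2) v / (ρ * Q))) n q) :
    Disjoint (R (q 0 * (ρ * Q) + o)) (R (q n * (ρ * Q) + o)) := by
  rw [Finset.disjoint_left]
  intro p hp1 hp2
  have hρ := h.two_le_ρ
  have hw := h.w_pos
  have hε := h.eps_pos
  have hQ := h.Q_pos
  obtain ⟨e, he, hJ⟩ := hq.1 0 (by omega)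
  obtain ⟨u, -, hu, -, -⟩ := hJ.exists_ends
  obtain ⟨e', he', hJ'⟩ := hq.1 (n - 1) (by omega)
  obtain ⟨-, v, -, hv, -⟩ := hJ'.exists_ends
  rw [show n - 1 + 1 = n by omega] at hv
  refine not_nbWalk (abs_pos_sub_le h.σ_pos h.pos_nonneg (Q := ρ * Q) (by positivity)) n q
    (2 * ((ρ * Q : ℕ) * (ε * w₀ / 2)) + 8 * s * ((1 + ε) * (Q * w₀))) hn (by positivity) hq ?_ ?_
  · intro f hf
    refine ⟨u, v, hu, hv, ?_⟩
    have h1 := hclose _ p hp1 f (h.le_wt f (hS' hf))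
    have h2 := hclose _ p hp2 f (h.le_wt f (hS' hf))
    have h3 := (M.lip f _ _).trans (abs_grid_sub_le h.σ_pos h.pos_nonneg ho u hu)
    have h4 := (M.lip f _ _).trans (abs_grid_sub_le h.σ_pos h.pos_nonneg ho v hv)
    rw [abs_sub_comm] at h2 h3
    have h5 := abs_sub_le_three (M.φ f (M.pos u))
      (M.φ f ((q 0 * (ρ * Q) + o : ℕ) * (ε * w₀ / 2))) (M.φ f (p * (ε * w₀ / 2))) (M.φ f (M.pos v))
    have h6 := abs_sub_le (M.φ f (p * (ε * w₀ / 2)))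
      (M.φ f ((q n * (ρ * Q) + o : ℕ) * (ε * w₀ / 2))) (M.φ f (M.pos v))
    linarith
  · intro f hf
    rw [h.t_eq]
    have h1 := h.le_wt f (hS' hf)
    have h2 := M.wt_pos f
    have h3 : (n : ℝ) ≤ 4 * s := by exact_mod_cast hn4
    have h4 : (10 * s * ρ : ℝ) + 1 ≤ 2 * k := by exact_mod_cast hsρ
    have h5 : (1 : ℝ) ≤ s := by exact_mod_cast hs
    have h6 : (2 : ℝ) ≤ ρ := by exact_mod_cast hρ
    push_cast
    set x := M.wt f
    set y := (Q : ℝ) * w₀ with hy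
    have hy0 : 0 < y := by positivity
    have e1 : (ρ * Q * (ε * w₀ / 2) : ℝ) = ρ * ε / 2 * y := by rw [hy]; ring
    rw [e1]
    have i1 : ((n : ℝ) - 1) * x ≤ (4 * s - 1) * x := by gcongr
    have i2 : ((n : ℝ) + 1) * (ρ * ε / 2 * y) ≤ (4 * s + 1) * (ρ * ε / 2 * x) := by gcongr
    have i3 : 2 * (ρ * ε / 2 * y) ≤ 2 * (ρ * ε / 2 * x) := by gcongr
    have i4 : 8 * s * ((1 + ε) * y) ≤ 8 * s * ((1 + ε) * x) := by gcongr
    have i5 : (10 * s * ρ : ℝ) * ((1 + ε) * x) ≤ (2 * k - 1) * ((1 + ε) * x) := by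
      apply mul_le_mul_of_nonneg_right <;> [linarith; positivity]
    have i6 : (2 * s : ℝ) ≤ s * ρ := by nlinarith
    have i7 : (ρ : ℝ) ≤ s * ρ := by nlinarith
    have i8 := mul_le_mul_of_nonneg_right i6 (by positivity : 0 ≤ x)
    have i9 := mul_le_mul_of_nonneg_right i6 (by positivity : 0 ≤ ε * x)
    have i10 := mul_le_mul_of_nonneg_right i7 (by positivity : 0 ≤ ε * x)
    nlinarith [mul_pos (by positivity : (0 : ℝ) < s) h2, mul_pos hε h2]

/-- Either a scale has few shortcuts, or the sets `R z` grow. -/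
theorem exists_bucket_growth (h : Scale M S k ε w₀ ρ Q m) {s D : ℕ} (hs : 1 ≤ s) (hD : 2 ≤ D)
    (hsρ : 10 * s * ρ + 1 ≤ 2 * k) (R : ℕ → Finset ℕ) (hR : ∀ z, (R z).Nonempty)
    (hRP : ∀ z < m * (ρ * Q), R z ⊆ Finset.range (m * (ρ * Q)))
    (hclose : ∀ z, ∀ p ∈ R z, ∀ f, Q * w₀ ≤ M.wt f →
      |M.φ f (z * (ε * w₀ / 2)) - M.φ f (p * (ε * w₀ / 2))| ≤ 4 * s * ((1 + ε) * (Q * w₀))) :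
    ∃ R' : ℕ → Finset ℕ, (∀ z, (R' z).Nonempty) ∧
      (∀ z < m * (ρ * Q), R' z ⊆ Finset.range (m * (ρ * Q))) ∧
      (∀ z, ∀ p ∈ R' z, ∀ f, (ρ * Q : ℕ) * w₀ ≤ M.wt f →
        |M.φ f (z * (ε * w₀ / 2)) - M.φ f (p * (ε * w₀ / 2))| ≤
          4 * s * ((1 + ε) * ((ρ * Q : ℕ) * w₀))) ∧
      ∑ z ∈ Finset.range (m * (ρ * Q)), Real.log (R z).card ≤
        ∑ z ∈ Finset.range (m * (ρ * Q)), Real.log (R' z).card ∧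
      (S.card ≤ 8 * D * m ∨
        Q * s * S.card * Real.log (D - 1 : ℕ) ≤ 6 * ((ρ * m : ℕ) : ℝ) ^ (1 / (k : ℝ)) *
          (∑ z ∈ Finset.range (m * (ρ * Q)), Real.log (R' z).card -
            ∑ z ∈ Finset.range (m * (ρ * Q)), Real.log (R z).card)) := by
  classical
  have hρ := h.two_le_ρ
  have hw := h.w_pos
  have hε := h.eps_pos
  have hQ := h.Q_pos
  have hρ' : (2 : ℝ) ≤ ρ := by exact_mod_cast hρ
  have hQ0 : 0 < ρ * Q := by positivity
  have hQw : (Q : ℝ) * w₀ ≤ (ρ * Q : ℕ) * w₀ := by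
    push_cast; nlinarith [mul_pos (Nat.cast_pos (α := ℝ).2 hQ) hw]
  have hold : ∀ z, ∀ p ∈ R z, ∀ f, (ρ * Q : ℕ) * w₀ ≤ M.wt f →
        |M.φ f (z * (ε * w₀ / 2)) - M.φ f (p * (ε * w₀ / 2))| ≤
          4 * s * ((1 + ε) * ((ρ * Q : ℕ) * w₀)) := fun z p hp f hf =>
    (hclose z p hp f (hQw.trans hf)).trans (by gcongr)
  by_cases hgood : S.card ≤ 8 * D * m
  · exact ⟨R, hR, hRP, hold, le_rfl, Or.inl hgood⟩
  set cl : V → ℕ := fun v => M.idx (ε * w₀ / 2) v / (ρ * Q) with hcl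
  obtain ⟨Y, hY, S', hS', p1, p2, p3⟩ := exists_core (fun i => cl (M.a i)) (fun i => cl (M.b i))
    (4 * D) (Finset.range m) S fun i _ => ⟨h.cluster_mem _, h.cluster_mem _⟩
  rw [Finset.card_range] at p3
  have hYm : Y.card ≤ m := by simpa using Finset.card_le_card hY
  have hS2 : S.card ≤ 2 * S'.card := by
    have : 8 * D * m = 2 * (4 * D * m) := by ring
    omega
  have hb3 : ∀ f ∈ S', M.wt f + 3 * ((ρ * Q : ℕ) * (ε * w₀ / 2)) ≤ M.t * M.wt f := by
    intro f hf
    rw [h.t_eq]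
    have h1 := h.le_wt f (hS' hf)
    have h4 : (10 * s * ρ : ℝ) + 1 ≤ 2 * k := by exact_mod_cast hsρ
    have h5 : (1 : ℝ) ≤ s := by exact_mod_cast hs
    have h6 : (10 * ρ : ℝ) ≤ 2 * k - 1 := by nlinarith
    have h7 := M.wt_pos f
    have h8 := mul_le_mul_of_nonneg_right h6 (by positivity : 0 ≤ (1 + ε) * M.wt f)
    have h9 := mul_le_mul_of_nonneg_left h1 (by positivity : 0 ≤ (3 / 2 : ℝ) * (ρ * ε))
    have h10 : (0 : ℝ) ≤ ρ * (ε * M.wt f) := by positivity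
    push_cast
    nlinarith [mul_le_mul_of_nonneg_right hρ' h7.le]
  have hnb : ∀ x ∈ Y, 4 * D ≤ (Y.filter (M.Link S' cl x)).card := fun x hx =>
    (p2 x hx).trans (card_incident_le (abs_pos_sub_le h.σ_pos h.pos_nonneg hQ0) hb3 p1 x)
  have hgrow := fun o (ho : o < ρ * Q) => exists_growth (adj := M.Link S' cl)
    (fun _ _ h => h.symm) Y D s hD hnb (fun x => R (x * (ρ * Q) + o)) (fun _ => hR _)
    (fun n q h1 h2 hq => h.disjoint_of_nbWalk hs hsρ hclose hS' ho n q h1 h2 hq)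
  choose! G hG1 hG2 hG3 using hgrow
  have hz : ∀ z, z / (ρ * Q) * (ρ * Q) + z % (ρ * Q) = z := fun z => Nat.div_add_mod' _ _
  have hcard : ∀ z, (R z).card ≤ (G (z % (ρ * Q)) (z / (ρ * Q))).card := fun z => by
    have := hG1 _ (Nat.mod_lt z hQ0) (z / (ρ * Q))
    rwa [hz] at this
  have hmem : ∀ z, ∀ p ∈ G (z % (ρ * Q)) (z / (ρ * Q)), p ∈ R z ∨
      ∃ q : ℕ → ℕ, NBWalk (M.Link S' cl) (2 * s) q ∧ q 0 = z / (ρ * Q) ∧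
        p ∈ R (q (2 * s) * (ρ * Q) + z % (ρ * Q)) := fun z p hp => by
    have := hG2 _ (Nat.mod_lt z hQ0) (z / (ρ * Q)) p hp
    rwa [hz] at this
  have hlog : ∀ z, Real.log (R z).card ≤ Real.log (G (z % (ρ * Q)) (z / (ρ * Q))).card :=
    fun z => Real.log_le_log (by exact_mod_cast (hR z).card_pos) (by exact_mod_cast hcard z)
  refine ⟨fun z => G (z % (ρ * Q)) (z / (ρ * Q)), fun z => ?_, fun z hzP p hp => ?_,
    fun z p hp f hf => ?_, Finset.sum_le_sum fun z _ => hlog z, Or.inr ?_⟩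
  · rw [← Finset.card_pos]
    exact (hR z).card_pos.trans_le (hcard z)
  · rcases hmem z p hp with hp | ⟨q, hq, -, hp⟩
    · exact hRP z hzP hp
    · refine hRP _ ?_ hp
      obtain ⟨e, -, hJ⟩ := hq.1 (2 * s - 1) (by omega)
      obtain ⟨-, v, -, hv, -⟩ := hJ.exists_ends
      rw [show 2 * s - 1 + 1 = 2 * s by omega] at hv
      have h1 := Finset.mem_range.1 (h.cluster_mem v)
      change cl v < m at h1
      rw [hv] at h1
      have h2 := Nat.mod_lt z hQ0
      calc q (2 * s) * (ρ * Q) + z % (ρ * Q) < (q (2 * s) + 1) * (ρ * Q) := by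
            rw [add_mul, one_mul]; omega
        _ ≤ m * (ρ * Q) := Nat.mul_le_mul_right _ h1
  · rcases hmem z p hp with hp | ⟨q, hq, hq0, hp⟩
    · exact hold z p hp f hf
    · have h1 := hclose _ p hp f (hQw.trans hf)
      have h2 := h.walk_dist hS' (Nat.mod_lt z hQ0) f (by push_cast at hf; exact hf) q (2 * s) hq.1
      rw [hq0, hz] at h2
      refine (abs_sub_le _ _ _).trans ((add_le_add h2 h1).trans ?_)
      push_cast
      have h3 : 0 ≤ s * ((1 + ε) * (Q * w₀)) * (ρ - 2) :=
        mul_nonneg (by positivity) (by linarith)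
      nlinarith
  · rw [sum_range_mul_eq _ m (ρ * Q), sum_range_mul_eq _ m (ρ * Q), ← Finset.sum_sub_distrib]
    have h1 : ∀ o ∈ Finset.range (ρ * Q), s * Y.card * Real.log (D - 1 : ℕ) ≤
        ∑ x ∈ Finset.range m, Real.log (G ((x * (ρ * Q) + o) % (ρ * Q))
          ((x * (ρ * Q) + o) / (ρ * Q))).card -
        ∑ x ∈ Finset.range m, Real.log (R (x * (ρ * Q) + o)).card := by
      intro o ho
      have h2 := hG3 o (Finset.mem_range.1 ho)
      rw [← Finset.sum_sub_distrib]
      refine le_trans ?_ (Finset.sum_le_sum_of_subset_of_nonneg hY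
        fun x _ _ => sub_nonneg.2 (hlog _))
      rw [Finset.sum_sub_distrib]
      have h3 : ∀ x, (x * (ρ * Q) + o) % (ρ * Q) = o ∧ (x * (ρ * Q) + o) / (ρ * Q) = x := by
        intro x
        have := Finset.mem_range.1 ho
        constructor
        · rw [Nat.mul_add_mod_self_right, Nat.mod_eq_of_lt this]
        · rw [Nat.add_div_of_dvd_right (Dvd.intro_left _ rfl), Nat.mul_div_cancel _ hQ0,
            Nat.div_eq_of_lt this, add_zero]
      simp only [h3]
      linarith
    have h2 := Finset.card_nsmul_le_sum _ _ _ h1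
    rw [Finset.card_range, nsmul_eq_mul] at h2
    have h3 := h.card_le_small hS' p1 hYm
    set Δ := ((ρ * m : ℕ) : ℝ) ^ (1 / (k : ℝ)) with hΔ
    have hΔ0 : 0 ≤ Δ := by positivity
    refine le_trans ?_ (mul_le_mul_of_nonneg_left h2 (by positivity))
    have h4 : (S.card : ℝ) ≤ 2 * S'.card := by exact_mod_cast hS2
    have h5 : (S.card : ℝ) ≤ 6 * (ρ * Y.card) * Δ := by linarith
    have h6 : 0 ≤ Real.log (D - 1 : ℕ) := Real.log_natCast_nonneg _
    have h7 := mul_le_mul_of_nonneg_left h5 (by positivity : 0 ≤ Q * s * Real.log (D - 1 : ℕ))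
    refine le_trans (le_of_eq ?_) (h7.trans (le_of_eq ?_))
    · ring
    · push_cast; ring

end Scale
end ShortcutSystem

lemma mul_log_one_add_le {x y : ℝ} (hx : 0 < x) (hxy : x ≤ y) :
    x * Real.log (1 + y) ≤ y * Real.log (1 + x) := by
  have hy : 0 < y := hx.trans_le hxy
  have h := rpow_one_add_le_one_add_mul_self (s := y) (p := x / y) (by linarith)
    (by positivity) ((div_le_one hy).2 hxy)
  rw [div_mul_cancel₀ _ hy.ne'] at h
  have h2 := Real.log_le_log (by positivity) h
  rw [Real.log_rpow (by linarith), div_mul_eq_mul_div, div_le_iff₀ hy] at h2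
  linarith

lemma geom_sum_rpow_le {ρ k : ℕ} (hρ : 2 ≤ ρ) (hk : 0 < k) (n : ℕ) :
    ∑ b ∈ Finset.range n, ((ρ : ℝ) ^ (-(1 / (k : ℝ)))) ^ b ≤ 1 + k / Real.log ρ := by
  have hρ' : (1 : ℝ) < ρ := by exact_mod_cast hρ
  have hlog : 0 < Real.log ρ := Real.log_pos hρ'
  have hk' : (0 : ℝ) < k := by exact_mod_cast hk
  set u := Real.log ρ / k with hu
  have hu0 : 0 < u := by positivity
  set x := (ρ : ℝ) ^ (-(1 / (k : ℝ))) with hx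
  have hx0 : 0 < x := by positivity
  have hxe : x = Real.exp (-u) := by
    rw [hx, Real.rpow_def_of_pos (by linarith), hu]; congr 1; ring
  have hx1 : x * (1 + u) ≤ 1 := by
    have h1 := Real.add_one_le_exp u
    have h2 : x * Real.exp u = 1 := by rw [hxe, ← Real.exp_add]; simp
    nlinarith
  have hx2 : x < 1 := by nlinarith
  rw [geom_sum_eq hx2.ne, show (1 : ℝ) + k / Real.log ρ = (1 + u) / u by
    rw [hu]; field_simp; ring, ← neg_div_neg_eq, div_le_div_iff₀ (by linarith) hu0]
  have := pow_pos hx0 n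
  nlinarith

namespace ShortcutSystem

variable {V ι : Type*} [LinearOrder ι] {M : ShortcutSystem V ι}

lemma rpow_scale {ρ k B b m : ℕ} (hρ : 2 ≤ ρ) (hb : b ≤ B) :
    ((ρ * (ρ ^ (B - b) * m) : ℕ) : ℝ) ^ (1 / (k : ℝ)) =
      ((m * ρ ^ (B + 1) : ℕ) : ℝ) ^ (1 / (k : ℝ)) * ((ρ : ℝ) ^ (-(1 / (k : ℝ)))) ^ b := by
  have hρ' : (0 : ℝ) < ρ := by exact_mod_cast (by omega : 0 < ρ)
  have h1 : ((m * ρ ^ (B + 1) : ℕ) : ℝ) = ((ρ * (ρ ^ (B - b) * m) : ℕ) : ℝ) * (ρ : ℝ) ^ b := by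
    have : B + 1 = (B - b) + 1 + b := by omega
    rw [this]; push_cast; ring
  rw [h1, Real.mul_rpow (by positivity) (by positivity), ← Real.rpow_natCast, ← Real.rpow_natCast,
    ← Real.rpow_mul hρ'.le, ← Real.rpow_mul hρ'.le, mul_assoc, ← Real.rpow_add hρ']
  rw [show (b : ℝ) * (1 / (k : ℝ)) + -(1 / (k : ℝ)) * b = 0 by ring, Real.rpow_zero, mul_one]

variable {k : ℕ} {ε w₀ : ℝ} {ρ B m : ℕ} {Sb : ℕ → Finset ι}

lemma scale_mul {b : ℕ} (hb : b ≤ B) : ρ ^ (B - b) * m * (ρ * ρ ^ b) = m * ρ ^ (B + 1) := by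
  have : B + 1 = (B - b) + 1 + b := by omega
  rw [this]; ring

/-- Summing the Moore bound over all scales. -/
theorem sum_card_le_moore (hρ : 2 ≤ ρ) (hk : 2 ≤ k)
    (h : ∀ b ≤ B, Scale M (Sb b) k ε w₀ ρ (ρ ^ b) (ρ ^ (B - b) * m)) :
    ∑ b ∈ Finset.range (B + 1), (ρ : ℝ) ^ (b + 1) * (Sb b).card ≤
      (m * ρ ^ (B + 1) : ℕ) * ((m * ρ ^ (B + 1) : ℕ) : ℝ) ^ (1 / (k : ℝ)) *
        (3 * ρ * (1 + k / Real.log ρ)) := by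
  have h1 : ∀ b ∈ Finset.range (B + 1), (ρ : ℝ) ^ (b + 1) * (Sb b).card ≤
      (m * ρ ^ (B + 1) : ℕ) * ((m * ρ ^ (B + 1) : ℕ) : ℝ) ^ (1 / (k : ℝ)) * (3 * ρ) *
        ((ρ : ℝ) ^ (-(1 / (k : ℝ)))) ^ b := by
    intro b hb
    have hb' : b ≤ B := Nat.lt_succ_iff.1 (Finset.mem_range.1 hb)
    have h2 := (h b hb').card_le
    rw [rpow_scale hρ hb'] at h2
    have h3 : ((m * ρ ^ (B + 1) : ℕ) : ℝ) = (ρ ^ (B - b) * m : ℕ) * (ρ * ρ ^ b : ℝ) := by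
      rw [← scale_mul hb']; push_cast; ring
    have h4 := mul_le_mul_of_nonneg_left h2 (by positivity : (0 : ℝ) ≤ ρ ^ (b + 1))
    refine h4.trans (le_of_eq ?_)
    set Δ := ((m * ρ ^ (B + 1) : ℕ) : ℝ) ^ (1 / (k : ℝ))
    rw [h3]; ring
  refine (Finset.sum_le_sum h1).trans ?_
  rw [← Finset.mul_sum]
  have h2 := mul_le_mul_of_nonneg_left (geom_sum_rpow_le hρ (by omega : 0 < k) (B + 1))
    (by positivity : 0 ≤ (m * ρ ^ (B + 1) : ℕ) *
      ((m * ρ ^ (B + 1) : ℕ) : ℝ) ^ (1 / (k : ℝ)) * (3 * ρ))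
  exact h2.trans (le_of_eq (by ring))

/-- Summing over all scales, where scales with many shortcuts are paid for by the growth of the
sets `R z`. -/
theorem sum_card_le_growth (hρ : 2 ≤ ρ) (hm : 0 < m) {s : ℕ} (hs : 1 ≤ s)
    (hsρ : 10 * s * ρ + 1 ≤ 2 * k)
    (h : ∀ b ≤ B, Scale M (Sb b) k ε w₀ ρ (ρ ^ b) (ρ ^ (B - b) * m)) :
    ∑ b ∈ Finset.range (B + 1), (ρ : ℝ) ^ (b + 1) * (Sb b).card ≤
      (m * ρ ^ (B + 1) : ℕ) * ((m * ρ ^ (B + 1) : ℕ) : ℝ) ^ (1 / (k : ℝ)) *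
        (32 * (1 + k / Real.log ρ) + 6 * ρ * k / s) := by
  set P := m * ρ ^ (B + 1) with hP
  have hk : 2 ≤ k := (h 0 (Nat.zero_le _)).two_le_k
  have hε := (h 0 (Nat.zero_le _)).eps_pos
  have hw := (h 0 (Nat.zero_le _)).w_pos
  have hk' : (0 : ℝ) < k := by positivity
  have hP1 : 1 ≤ P := Nat.mul_pos hm (by positivity)
  have hP1' : (1 : ℝ) ≤ P := by exact_mod_cast hP1
  set Δ := (P : ℝ) ^ (1 / (k : ℝ)) with hΔ
  have hΔ1 : 1 ≤ Δ := Real.one_le_rpow hP1' (by positivity)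
  set L := Real.log (1 + Δ) with hL
  have hL0 : 0 < L := Real.log_pos (by linarith)
  have hs0 : (0 : ℝ) < s := by exact_mod_cast hs
  set x := (ρ : ℝ) ^ (-(1 / (k : ℝ))) with hx
  have main : ∀ b ≤ B + 1, ∃ R : ℕ → Finset ℕ, (∀ z, (R z).Nonempty) ∧
      (∀ z < P, R z ⊆ Finset.range P) ∧
      (∀ z, ∀ p ∈ R z, ∀ f, (ρ ^ b : ℕ) * w₀ ≤ M.wt f →
        |M.φ f (z * (ε * w₀ / 2)) - M.φ f (p * (ε * w₀ / 2))| ≤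
          4 * s * ((1 + ε) * ((ρ ^ b : ℕ) * w₀))) ∧
      ∑ c ∈ Finset.range b, (ρ : ℝ) ^ (c + 1) * (Sb c).card ≤
        32 * P * Δ * ∑ c ∈ Finset.range b, x ^ c +
          6 * ρ * Δ / (s * L) * ∑ z ∈ Finset.range P, Real.log (R z).card := by
    intro b
    induction b with
    | zero =>
      intro _
      refine ⟨fun z => {z}, fun _ => Finset.singleton_nonempty _, fun z hz => ?_, ?_, by simp⟩
      · simpa using hz
      · intro z p hp f _
        rw [Finset.mem_singleton.1 hp, sub_self, abs_zero]
        positivity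
    | succ b ih =>
      intro hb
      have hb' : b ≤ B := by omega
      obtain ⟨R, hR, hRP, hc, hsum⟩ := ih (by omega)
      have hS := h b hb'
      have hΔb := rpow_scale (k := k) (m := m) hρ hb'
      rw [← hP, ← hΔ, ← hx] at hΔb
      set Δb := ((ρ * (ρ ^ (B - b) * m) : ℕ) : ℝ) ^ (1 / (k : ℝ)) with hΔbd
      have hΔb1 : 1 ≤ Δb := Real.one_le_rpow
        (by exact_mod_cast Nat.mul_pos (by omega) (Nat.mul_pos (by positivity) hm)) (by positivity)
      have hx1 : x ≤ 1 := Real.rpow_le_one_of_one_le_of_nonpos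
        (by exact_mod_cast (by omega : 1 ≤ ρ)) (by simp)
      have hx0 : 0 ≤ x := by positivity
      have hΔbΔ : Δb ≤ Δ := by
        rw [hΔb]; exact mul_le_of_le_one_right (by linarith) (pow_le_one₀ hx0 hx1)
      have hmul := scale_mul (ρ := ρ) (m := m) hb'
      rw [← hP] at hmul
      obtain ⟨R', hR', hRP', hc', hmono, hgain⟩ := hS.exists_bucket_growth (D := ⌈Δb⌉₊ + 2) hs
        (by omega) hsρ R hR (by rw [hmul]; exact hRP) hc
      rw [hmul] at hRP' hmono hgain
      rw [← pow_succ'] at hc'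
      refine ⟨R', hR', hRP', hc', ?_⟩
      rw [Finset.sum_range_succ, Finset.sum_range_succ (fun c => x ^ c)]
      set G := ∑ z ∈ Finset.range P, Real.log (R z).card
      set G' := ∑ z ∈ Finset.range P, Real.log (R' z).card
      have hcoef : 0 ≤ 6 * ρ * Δ / (s * L) := by positivity
      have hPr : (P : ℝ) = (ρ ^ (B - b) * m : ℕ) * (ρ : ℝ) ^ (b + 1) := by
        rw [← hmul]; push_cast; ring
      have hstep : (ρ : ℝ) ^ (b + 1) * (Sb b).card ≤ 32 * P * Δ * x ^ b +
          6 * ρ * Δ / (s * L) * (G' - G) := by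
        have hceil := Nat.ceil_lt_add_one (show 0 ≤ Δb by linarith)
        have hceil' := Nat.le_ceil Δb
        rcases hgain with hgood | hbad
        · have h1 : ((Sb b).card : ℝ) ≤ 8 * (⌈Δb⌉₊ + 2) * (ρ ^ (B - b) * m : ℕ) := by
            exact_mod_cast hgood
          have h2 : 8 * ((⌈Δb⌉₊ : ℝ) + 2) ≤ 32 * Δb := by linarith
          have h3 : ((Sb b).card : ℝ) ≤ 32 * Δb * (ρ ^ (B - b) * m : ℕ) :=
            h1.trans (mul_le_mul_of_nonneg_right h2 (by positivity))
          have h4 := mul_le_mul_of_nonneg_left h3 (by positivity : (0 : ℝ) ≤ (ρ : ℝ) ^ (b + 1))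
          have h5 := mul_nonneg hcoef (sub_nonneg.2 hmono)
          have h6 : (ρ : ℝ) ^ (b + 1) * (32 * Δb * (ρ ^ (B - b) * m : ℕ)) = 32 * P * Δ * x ^ b := by
            rw [hPr, hΔb]; ring
          linarith
        · have h1 : Real.log (1 + Δb) ≤ Real.log ((⌈Δb⌉₊ + 2 - 1 : ℕ) : ℝ) := by
            refine Real.log_le_log (by linarith) ?_
            rw [show ⌈Δb⌉₊ + 2 - 1 = ⌈Δb⌉₊ + 1 by omega]; push_cast; linarith
          have h2 : (ρ : ℝ) ^ b * s * (Sb b).card * Real.log (1 + Δb) ≤ 6 * Δb * (G' - G) := by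
            refine le_trans ?_ hbad
            rw [Nat.cast_pow]
            exact mul_le_mul_of_nonneg_left h1 (by positivity)
          have h3 := mul_log_one_add_le (by linarith : 0 < Δb) hΔbΔ
          have h4 : Δb * ((ρ : ℝ) ^ b * s * (Sb b).card * L) ≤ Δb * (6 * Δ * (G' - G)) := by
            calc Δb * ((ρ : ℝ) ^ b * s * (Sb b).card * L)
                = ((ρ : ℝ) ^ b * s * (Sb b).card) * (Δb * L) := by ring
              _ ≤ ((ρ : ℝ) ^ b * s * (Sb b).card) * (Δ * Real.log (1 + Δb)) := by gcongr
              _ = Δ * ((ρ : ℝ) ^ b * s * (Sb b).card * Real.log (1 + Δb)) := by ring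
              _ ≤ Δ * (6 * Δb * (G' - G)) := by gcongr
              _ = _ := by ring
          have h5 := le_of_mul_le_mul_left h4 (by linarith)
          have h6 : (ρ : ℝ) ^ (b + 1) * (Sb b).card ≤ 6 * ρ * Δ / (s * L) * (G' - G) := by
            rw [div_mul_eq_mul_div, le_div_iff₀ (by positivity)]
            have := mul_le_mul_of_nonneg_left h5 (by positivity : (0 : ℝ) ≤ ρ)
            refine le_trans (le_of_eq ?_) (this.trans (le_of_eq ?_)) <;> ring
          have h7 : 0 ≤ 32 * P * Δ * x ^ b := by positivity
          linarith
      rw [mul_add, mul_sub] at *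
      linarith
  obtain ⟨R, hR, hRP, -, hsum⟩ := main (B + 1) le_rfl
  refine hsum.trans ?_
  have hlogP : Real.log P ≤ k * L := by
    have : Real.log P = k * Real.log Δ := by
      rw [hΔ, Real.log_rpow (by linarith)]; field_simp
    rw [this]
    exact mul_le_mul_of_nonneg_left (Real.log_le_log (by linarith) (by linarith)) hk'.le
  have hR2 : ∑ z ∈ Finset.range P, Real.log (R z).card ≤ P * (k * L) := by
    have := Finset.sum_le_card_nsmul (Finset.range P) (fun z => Real.log (R z).card) (k * L)
      (fun z hz => (Real.log_le_log (by exact_mod_cast (hR z).card_pos) (by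
        have := Finset.card_le_card (hRP z (Finset.mem_range.1 hz))
        rw [Finset.card_range] at this
        exact_mod_cast this)).trans hlogP)
    simpa using this
  have h1 := mul_le_mul_of_nonneg_left hR2 (by positivity : 0 ≤ 6 * ρ * Δ / (s * L))
  have h2 := mul_le_mul_of_nonneg_left (geom_sum_rpow_le hρ (by omega : 0 < k) (B + 1))
    (by positivity : 0 ≤ 32 * P * Δ)
  refine (add_le_add h2 h1).trans (le_of_eq ?_)
  field_simp

end ShortcutSystem

lemma exists_scale_params {k : ℕ} (hk : 81 ≤ k) : ∃ ρ s : ℕ, 2 ≤ ρ ∧ 1 ≤ s ∧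
    10 * s * ρ + 1 ≤ 2 * k ∧
    32 * (1 + k / Real.log ρ) + 6 * ρ * k / s ≤ 1100 * (k / Real.logb 2 k) := by
  set ρ := Nat.sqrt (Nat.sqrt k) with hρd
  have hρ : 3 ≤ ρ := Nat.le_sqrt'.2 (Nat.le_sqrt'.2 (by omega))
  have h4 : ρ ^ 4 ≤ k := by
    have h1 := Nat.sqrt_le' (Nat.sqrt k)
    have h2 := Nat.sqrt_le' k
    calc ρ ^ 4 = (ρ ^ 2) ^ 2 := by ring
      _ ≤ (Nat.sqrt k) ^ 2 := Nat.pow_le_pow_left h1 2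
      _ ≤ k := h2
  have h8 : k ≤ ρ ^ 8 := by
    have h1 : Nat.sqrt k < (ρ + 1) ^ 2 := Nat.lt_succ_sqrt' _
    have h2 : k < (Nat.sqrt k + 1) ^ 2 := Nat.lt_succ_sqrt' _
    have h3 : (Nat.sqrt k + 1) ^ 2 ≤ ((ρ + 1) ^ 2) ^ 2 := Nat.pow_le_pow_left h1 2
    have h5 : ρ + 1 ≤ ρ ^ 2 := by nlinarith
    have h6 : ((ρ + 1) ^ 2) ^ 2 ≤ ((ρ ^ 2) ^ 2) ^ 2 :=
      Nat.pow_le_pow_left (Nat.pow_le_pow_left h5 2) 2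
    have h7 : ((ρ ^ 2) ^ 2) ^ 2 = ρ ^ 8 := by ring
    omega
  have h10 : 10 * ρ ≤ k := by
    have : 27 * ρ ≤ ρ ^ 4 := by
      have : 3 ^ 3 ≤ ρ ^ 3 := Nat.pow_le_pow_left hρ 3
      calc 27 * ρ ≤ ρ ^ 3 * ρ := Nat.mul_le_mul_right _ (by omega)
        _ = ρ ^ 4 := by ring
    omega
  set s := k / (10 * ρ) with hsd
  have hs : 1 ≤ s := Nat.div_pos h10 (by omega)
  have hs1 : s * (10 * ρ) ≤ k := Nat.div_mul_le_self _ _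
  have hs2 : k < s * (10 * ρ) + 10 * ρ := Nat.lt_div_mul_add (by omega)
  have hs3 : k ≤ 20 * ρ * s := by nlinarith
  refine ⟨ρ, s, by omega, hs, by nlinarith, ?_⟩
  have hk' : (81 : ℝ) ≤ k := by exact_mod_cast hk
  have hρ' : (3 : ℝ) ≤ ρ := by exact_mod_cast hρ
  have hs' : (1 : ℝ) ≤ s := by exact_mod_cast hs
  set l := Real.log k with hl
  have hl0 : 0 < l := Real.log_pos (by linarith)
  have hlρ : 0 < Real.log ρ := Real.log_pos (by linarith)
  have hl8 : l ≤ 8 * Real.log ρ := by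
    have := Real.log_le_log (by linarith : (0 : ℝ) < k)
      (by exact_mod_cast h8 : (k : ℝ) ≤ (ρ : ℝ) ^ 8)
    rwa [Real.log_pow] at this
  have hlk : l ≤ k := (Real.log_le_sub_one_of_pos (by linarith)).trans (by linarith)
  have hsq : (ρ : ℝ) ^ 2 * l ≤ 2 * k := by
    have h1 : (ρ : ℝ) ^ 2 ≤ √k := by
      refine Real.le_sqrt_of_sq_le ?_
      calc ((ρ : ℝ) ^ 2) ^ 2 = (ρ : ℝ) ^ 4 := by ring
        _ ≤ (k : ℝ) := by exact_mod_cast h4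
    have h2 : l ≤ 2 * √k := by
      have h3 : l = 2 * Real.log (√k) := by
        rw [Real.log_sqrt (by linarith)]; ring
      have h4 := Real.log_le_sub_one_of_pos (Real.sqrt_pos.2 (by linarith : (0 : ℝ) < k))
      linarith
    have h3 := Real.mul_self_sqrt (by linarith : (0 : ℝ) ≤ k)
    have h4 : 0 ≤ √(k : ℝ) := Real.sqrt_nonneg _
    calc (ρ : ℝ) ^ 2 * l ≤ √k * (2 * √k) := by gcongr
      _ = 2 * k := by linarith
  have e1 : (k : ℝ) / Real.log ρ ≤ 8 * (k / l) := by
    rw [mul_div_assoc', div_le_div_iff₀ hlρ hl0]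
    nlinarith
  have e2 : 6 * ρ * k / s ≤ 240 * (k / l) := by
    have h1 : (k : ℝ) ≤ 20 * ρ * s := by exact_mod_cast hs3
    have h2 : 6 * ρ * k / s ≤ 120 * (ρ : ℝ) ^ 2 := by
      rw [div_le_iff₀ (by linarith)]
      nlinarith
    refine h2.trans ?_
    rw [mul_div_assoc', le_div_iff₀ hl0]
    linarith
  have e3 : 1 ≤ (k : ℝ) / l := (one_le_div hl0).2 hlk
  have e4 : (k : ℝ) / l ≤ 2 * (k / Real.logb 2 k) := by
    have h2 : (1 / 2 : ℝ) ≤ Real.log 2 := by linarith [Real.log_two_gt_d9]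
    rw [Real.logb, div_div_eq_mul_div]
    rw [mul_div_assoc', div_le_div_iff_of_pos_right hl0]
    nlinarith
  linarith

lemma small_scale_params {k : ℕ} (hk : 2 ≤ k) (hk81 : k < 81) :
    3 * (2 : ℕ) * (1 + k / Real.log (2 : ℕ)) ≤ 1100 * (k / Real.logb 2 k) := by
  have hk' : (2 : ℝ) ≤ k := by exact_mod_cast hk
  have hl0 : 0 < Real.log k := Real.log_pos (by linarith)
  have h2 : (1 / 2 : ℝ) ≤ Real.log 2 := by linarith [Real.log_two_gt_d9]
  have h1 : Real.log k ≤ 7 * Real.log 2 := by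
    have := Real.log_le_log (by linarith : (0 : ℝ) < k)
      (by exact_mod_cast (by omega : k ≤ 2 ^ 7) : (k : ℝ) ≤ (2 : ℝ) ^ 7)
    rwa [Real.log_pow] at this
  have e1 : (k : ℝ) / Real.log 2 ≤ 2 * k := by
    rw [div_le_iff₀ (by linarith)]; nlinarith
  have e2 : (k : ℝ) / 7 ≤ k / Real.logb 2 k := by
    rw [Real.logb, div_div_eq_mul_div, div_le_div_iff₀ (by norm_num) hl0]
    nlinarith
  push_cast
  linarith

lemma sum_biUnion_le_sum_sum {α β : Type*} [DecidableEq β] (s : Finset α) (t : α → Finset β)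
    {f : β → ℝ} (hf : ∀ b, 0 ≤ f b) : ∑ b ∈ s.biUnion t, f b ≤ ∑ a ∈ s, ∑ b ∈ t a, f b := by
  classical
  induction s using Finset.induction with
  | empty => simp
  | insert a s ha ih =>
    rw [Finset.biUnion_insert, Finset.sum_insert ha]
    have h := Finset.sum_union_inter (s₁ := t a) (s₂ := s.biUnion t) (f := f)
    have h0 : 0 ≤ ∑ b ∈ t a ∩ s.biUnion t, f b := Finset.sum_nonneg fun b _ => hf b
    linarith

namespace ShortcutSystem

variable {V ι : Type*} [LinearOrder ι] [Fintype ι] {M : ShortcutSystem V ι}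

/-- Distributing the heavy shortcuts among scales. -/
lemma exists_scales {k ρ : ℕ} {ε W w₀ : ℝ} (hk : 2 ≤ k) (hε : 0 < ε) (hW : 0 < W) (hw₀ : 0 < w₀)
    (ht : M.t = (2 * k - 1) * (1 + ε)) (hpos : ∀ v, 0 ≤ M.pos v) (hposW : ∀ v, M.pos v ≤ 2 * W)
    (hρ : 2 ≤ ρ) (hρk : ρ + 1 ≤ 2 * k) (hne : ∃ i, w₀ ≤ M.wt i) :
    ∃ (B m : ℕ) (Sb : ℕ → Finset ι), 0 < m ∧
      (∀ b ≤ B, Scale M (Sb b) k ε w₀ ρ (ρ ^ b) (ρ ^ (B - b) * m)) ∧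
      ∑ i with w₀ ≤ M.wt i, M.wt i ≤
        w₀ * ∑ b ∈ Finset.range (B + 1), (ρ : ℝ) ^ (b + 1) * (Sb b).card ∧
      w₀ * (m * ρ ^ (B + 1) : ℕ) ≤ 6 * W / ε := by
  classical
  have hρ' : (1 : ℝ) < ρ := by exact_mod_cast hρ
  have hρk' : (ρ : ℝ) + 1 ≤ 2 * k := by exact_mod_cast hρk
  obtain ⟨i0, hi0⟩ := hne
  obtain ⟨f, -, hf⟩ := Finset.exists_max_image Finset.univ M.wt ⟨i0, Finset.mem_univ _⟩
  have hpow := fun (y : ℝ) (hy : 1 ≤ y) => exists_nat_pow_near hy hρ'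
  obtain ⟨B, hB1, hB2⟩ := hpow (M.wt f / w₀)
    ((one_le_div hw₀).2 (hi0.trans (hf i0 (Finset.mem_univ _))))
  rw [le_div_iff₀ hw₀] at hB1
  rw [div_lt_iff₀ hw₀] at hB2
  set σ := ε * w₀ / 2 with hσ
  have hσ0 : 0 < σ := by positivity
  have hlong : M.t * M.wt f < 2 * W := by
    refine (M.long f).trans_le ((M.lip f _ _).trans ?_)
    rw [abs_le]
    constructor <;> linarith [hpos (M.a f), hpos (M.b f), hposW (M.a f), hposW (M.b f)]
  have hBσ : (ρ : ℝ) ^ (B + 1) * σ ≤ W := by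
    have h1 : (2 * (k : ℝ) - 1) * (ε * (ρ ^ B * w₀)) ≤ M.t * M.wt f := by
      rw [ht, mul_assoc]
      refine mul_le_mul_of_nonneg_left ?_ (by linarith)
      have := M.wt_pos f
      nlinarith
    have h2 : (ρ : ℝ) * (ε * (ρ ^ B * w₀)) ≤ (2 * (k : ℝ) - 1) * (ε * (ρ ^ B * w₀)) :=
      mul_le_mul_of_nonneg_right (by linarith) (by positivity)
    have h3 : (ρ : ℝ) ^ (B + 1) * σ = ρ * (ε * (ρ ^ B * w₀)) / 2 := by rw [hσ]; ring
    linarith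
  set c := (ρ : ℝ) ^ (B + 1) * σ with hc
  have hc0 : 0 < c := by positivity
  set m := ⌊2 * W / c⌋₊ + 1 with hm
  have hm1 : 2 * W < m * c := by
    have := Nat.lt_floor_add_one (2 * W / c)
    rw [div_lt_iff₀ hc0] at this
    rw [hm]; push_cast; exact this
  have hm2 : m * c ≤ 3 * W := by
    have := Nat.floor_le (by positivity : 0 ≤ 2 * W / c)
    rw [le_div_iff₀ hc0] at this
    rw [hm]; push_cast; linarith
  set Sb : ℕ → Finset ι := fun b =>
    Finset.univ.filter (fun i => ρ ^ b * w₀ ≤ M.wt i ∧ M.wt i < ρ ^ (b + 1) * w₀) with hSb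
  refine ⟨B, m, Sb, by omega, fun b hb => ?_, ?_, ?_⟩
  · refine ⟨hk, hε, hw₀, ht, hρ, by positivity, fun i hi => ?_, fun i hi => ?_, hpos, fun v => ?_⟩
    · have := (Finset.mem_filter.1 hi).2.1
      push_cast; exact this
    · have := (Finset.mem_filter.1 hi).2.2
      rw [pow_succ'] at this
      push_cast; exact this
    · rw [scale_mul hb]
      refine (Nat.floor_lt (div_nonneg (hpos v) hσ0.le)).2 ?_
      rw [div_lt_iff₀ hσ0]
      push_cast
      calc M.pos v ≤ 2 * W := hposW v
        _ < m * c := hm1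
        _ = _ := by rw [hc]; ring
  · have hsub : Finset.univ.filter (fun i => w₀ ≤ M.wt i) ⊆ (Finset.range (B + 1)).biUnion Sb := by
      intro i hi
      have hi' := (Finset.mem_filter.1 hi).2
      obtain ⟨b, hb1, hb2⟩ := hpow (M.wt i / w₀) ((one_le_div hw₀).2 hi')
      rw [le_div_iff₀ hw₀] at hb1
      rw [div_lt_iff₀ hw₀] at hb2
      refine Finset.mem_biUnion.2 ⟨b, Finset.mem_range.2 ?_,
        Finset.mem_filter.2 ⟨Finset.mem_univ _, hb1, hb2⟩⟩
      have h1 := (hb1.trans (hf i (Finset.mem_univ _))).trans_lt hB2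
      exact (pow_lt_pow_iff_right₀ hρ').1 (lt_of_mul_lt_mul_right h1 hw₀.le)
    calc ∑ i with w₀ ≤ M.wt i, M.wt i ≤ ∑ i ∈ (Finset.range (B + 1)).biUnion Sb, M.wt i :=
          Finset.sum_le_sum_of_subset_of_nonneg hsub fun i _ _ => (M.wt_pos i).le
      _ ≤ ∑ b ∈ Finset.range (B + 1), ∑ i ∈ Sb b, M.wt i :=
          sum_biUnion_le_sum_sum _ _ fun i => (M.wt_pos i).le
      _ ≤ ∑ b ∈ Finset.range (B + 1), w₀ * ((ρ : ℝ) ^ (b + 1) * (Sb b).card) := by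
          refine Finset.sum_le_sum fun b _ => ?_
          refine (Finset.sum_le_card_nsmul _ _ _ fun i hi =>
            (Finset.mem_filter.1 hi).2.2.le).trans (le_of_eq ?_)
          rw [nsmul_eq_mul]; ring
      _ = _ := (Finset.mul_sum _ _ _).symm
  · rw [le_div_iff₀ hε]
    have : w₀ * (m * ρ ^ (B + 1) : ℕ) * ε = 2 * (m * c) := by rw [hc, hσ]; push_cast; ring
    linarith

theorem card_le [Fintype V] {k : ℕ} {ε : ℝ} (hk : 2 ≤ k) (hε : 0 < ε)
    (ht : M.t = (2 * k - 1) * (1 + ε)) :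
    (Fintype.card ι : ℝ) ≤ 3 * Fintype.card V * (Fintype.card V : ℝ) ^ (1 / (k : ℝ)) := by
  refine card_le_moore (M := M) (S := Finset.univ) (cl := id) (ℓ := 0) (Y := Finset.univ) hk
    (fun u v h => by simp_all) (fun f _ => ?_) (by simp)
  have h1 := M.wt_pos f
  have h2 : (2 : ℝ) ≤ k := by exact_mod_cast hk
  have : 0 ≤ (2 * (k : ℝ) - 1) * (ε * M.wt f) := mul_nonneg (by linarith) (by positivity)
  rw [ht]
  linarith

/-- The total weight of a system of shortcuts. -/
theorem sum_wt_le [Fintype V] {k : ℕ} {ε W : ℝ} (hk : 2 ≤ k) (hε : 0 < ε) (hW : 0 < W)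
    (ht : M.t = (2 * k - 1) * (1 + ε)) (hpos : ∀ v, 0 ≤ M.pos v)
    (hposW : ∀ v, M.pos v ≤ 2 * W) :
    ∑ i, M.wt i ≤ 39600 * W * (Fintype.card V : ℝ) ^ (1 / (k : ℝ)) *
      (1 + k / (ε ^ (1 + 1 / (k : ℝ)) * Real.logb 2 k)) := by
  have hk' : (2 : ℝ) ≤ k := by exact_mod_cast hk
  have hlogb : 0 < Real.logb 2 k := Real.logb_pos (by norm_num) (by linarith)
  rcases isEmpty_or_nonempty ι with hι | ⟨⟨i0⟩⟩
  · rw [Finset.univ_eq_empty, Finset.sum_empty]; positivity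
  have : Nonempty V := ⟨M.a i0⟩
  set n : ℝ := (Fintype.card V : ℝ) with hn
  have hn1 : 1 ≤ n := by rw [hn]; exact_mod_cast Fintype.card_pos
  set X := (k : ℝ) / Real.logb 2 k with hX
  have hX0 : 0 ≤ X := by positivity
  set w₀ := W / n with hw₀
  have hw₀0 : 0 < w₀ := by positivity
  have hlight : ∑ i with ¬ w₀ ≤ M.wt i, M.wt i ≤ 3 * W * n ^ (1 / (k : ℝ)) := by
    have h1 := Finset.sum_le_card_nsmul (Finset.univ.filter (fun i => ¬ w₀ ≤ M.wt i)) M.wt w₀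
      fun i hi => (not_le.1 (Finset.mem_filter.1 hi).2).le
    rw [nsmul_eq_mul] at h1
    have h2 : ((Finset.univ.filter (fun i => ¬ w₀ ≤ M.wt i)).card : ℝ) ≤ Fintype.card ι := by
      exact_mod_cast Finset.card_le_univ _
    have h3 := h2.trans (card_le hk hε ht)
    calc _ ≤ _ := h1
      _ ≤ 3 * n * n ^ (1 / (k : ℝ)) * w₀ := mul_le_mul_of_nonneg_right h3 hw₀0.le
      _ = _ := by rw [hw₀]; field_simp
  have hheavy : ∑ i with w₀ ≤ M.wt i, M.wt i ≤
      39600 * W * n ^ (1 / (k : ℝ)) * (X / ε ^ (1 + 1 / (k : ℝ))) := by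
    by_cases hne : ∃ i, w₀ ≤ M.wt i
    · have key : ∃ P : ℕ, w₀ * P ≤ 6 * W / ε ∧ ∑ i with w₀ ≤ M.wt i, M.wt i ≤
          w₀ * (P * (P : ℝ) ^ (1 / (k : ℝ)) * (1100 * X)) := by
        rcases lt_or_ge k 81 with hk81 | hk81
        · obtain ⟨B, m, Sb, -, hS, hsum, hP⟩ := exists_scales hk hε hW hw₀0 ht hpos hposW le_rfl
            (by omega) hne
          refine ⟨_, hP, hsum.trans (mul_le_mul_of_nonneg_left ?_ hw₀0.le)⟩
          exact (sum_card_le_moore le_rfl hk hS).trans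
            (mul_le_mul_of_nonneg_left (small_scale_params hk hk81) (by positivity))
        · obtain ⟨ρ, s, hρ, hs, hsρ, hX⟩ := exists_scale_params hk81
          obtain ⟨B, m, Sb, hm, hS, hsum, hP⟩ := exists_scales hk hε hW hw₀0 ht hpos hposW hρ
            (by nlinarith) hne
          refine ⟨_, hP, hsum.trans (mul_le_mul_of_nonneg_left ?_ hw₀0.le)⟩
          exact (sum_card_le_growth hρ hm hs hsρ hS).trans
            (mul_le_mul_of_nonneg_left hX (by positivity))
      obtain ⟨P, hP, hsum⟩ := key
      have hP2 : (P : ℝ) ≤ 6 * (n / ε) := by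
        have : (P : ℝ) = w₀ * P * (n / W) := by rw [hw₀]; field_simp
        rw [this]
        refine (mul_le_mul_of_nonneg_right hP (by positivity)).trans (le_of_eq ?_)
        field_simp
      have hk1 : 1 / (k : ℝ) ≤ 1 := by rw [div_le_one (by linarith)]; linarith
      have hP3 : (P : ℝ) ^ (1 / (k : ℝ)) ≤ 6 * (n ^ (1 / (k : ℝ)) / ε ^ (1 / (k : ℝ))) := by
        calc (P : ℝ) ^ (1 / (k : ℝ)) ≤ (6 * (n / ε)) ^ (1 / (k : ℝ)) := by gcongr
          _ = 6 ^ (1 / (k : ℝ)) * (n ^ (1 / (k : ℝ)) / ε ^ (1 / (k : ℝ))) := by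
            rw [Real.mul_rpow (by norm_num) (by positivity),
              Real.div_rpow (by linarith) hε.le]
          _ ≤ 6 ^ (1 : ℝ) * (n ^ (1 / (k : ℝ)) / ε ^ (1 / (k : ℝ))) := by
            gcongr
            norm_num
          _ = _ := by rw [Real.rpow_one]
      calc _ ≤ _ := hsum
        _ = (w₀ * P) * (P : ℝ) ^ (1 / (k : ℝ)) * (1100 * X) := by ring
        _ ≤ (6 * W / ε) * (6 * (n ^ (1 / (k : ℝ)) / ε ^ (1 / (k : ℝ)))) * (1100 * X) := by gcongr
        _ = _ := by
          rw [Real.rpow_add hε, Real.rpow_one]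
          field_simp
          ring
    · rw [Finset.filter_false_of_mem (fun i _ h => hne ⟨i, h⟩), Finset.sum_empty]
      positivity
  rw [← Finset.sum_filter_add_sum_filter_not Finset.univ (fun i => w₀ ≤ M.wt i)]
  have e : (k : ℝ) / (ε ^ (1 + 1 / (k : ℝ)) * Real.logb 2 k) = X / ε ^ (1 + 1 / (k : ℝ)) := by
    rw [hX, div_div, mul_comm]
  rw [e]
  have : 0 ≤ W * n ^ (1 / (k : ℝ)) := by positivity
  linarith

end ShortcutSystem

section Distance

variable {V : Type} {G H : SimpleGraph V} {w : Sym2 V → NNReal} {u v x : V}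

@[simp] lemma walkWeight_nil : walkWeight w (Walk.nil : G.Walk u u) = 0 := rfl

@[simp] lemma walkWeight_cons (h : G.Adj u v) (p : G.Walk v x) :
    walkWeight w (Walk.cons h p) = w s(u, v) + walkWeight w p := by
  simp [walkWeight]

lemma walkWeight_append (p : G.Walk u v) (q : G.Walk v x) :
    walkWeight w (p.append q) = walkWeight w p + walkWeight w q := by
  simp [walkWeight, Walk.edges_append]

lemma walkWeight_reverse (p : G.Walk u v) : walkWeight w p.reverse = walkWeight w p := by
  simp [walkWeight, Walk.edges_reverse, List.sum_reverse]

lemma wdist_le (p : G.Walk u v) : wdist G w u v ≤ walkWeight w p := iInf_le _ p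

@[simp] lemma wdist_self : wdist G w u u = 0 :=
  le_antisymm ((wdist_le Walk.nil).trans_eq walkWeight_nil) zero_le

lemma wdist_comm : wdist G w u v = wdist G w v u := by
  have h : ∀ a b : V, wdist G w a b ≤ wdist G w b a := fun a b =>
    le_iInf fun p => (wdist_le p.reverse).trans_eq (walkWeight_reverse p)
  exact le_antisymm (h _ _) (h _ _)

lemma wdist_triangle : wdist G w u x ≤ wdist G w u v + wdist G w v x := by
  rw [wdist, wdist, wdist, ENNReal.iInf_add]
  refine le_iInf fun p => ?_
  rw [ENNReal.add_iInf]
  exact le_iInf fun q => (iInf_le _ (p.append q)).trans_eq (walkWeight_append p q)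

lemma wdist_le_of_adj (h : G.Adj u v) : wdist G w u v ≤ w s(u, v) :=
  (wdist_le h.toWalk).trans_eq (by simp [Adj.toWalk])

lemma wdist_le_mul_walkWeight {c : ENNReal}
    (h : ∀ u v, G.Adj u v → wdist H w u v ≤ c * w s(u, v)) (p : G.Walk u v) :
    wdist H w u v ≤ c * walkWeight w p := by
  induction p with
  | nil => simp
  | cons hadj p ih =>
    rw [walkWeight_cons, mul_add]
    exact wdist_triangle.trans (add_le_add (h _ _ hadj) ih)

lemma isTSpanner_of_adj {t : ℝ} (ht : 0 < t)
    (h : ∀ u v, G.Adj u v → wdist H w u v ≤ ENNReal.ofReal t * w s(u, v)) :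
    IsTSpanner G H w t := fun u v => by
  rw [wdist.eq_def G, ENNReal.mul_iInf_of_ne (by simpa using ht) ENNReal.ofReal_ne_top]
  exact le_iInf fun p => wdist_le_mul_walkWeight h p

lemma wdist_anti (h : G ≤ H) : wdist H w u v ≤ wdist G w u v :=
  le_iInf fun p => by
    simpa using wdist_le_mul_walkWeight (c := 1)
      (fun u v hadj => by simpa using wdist_le_of_adj (h hadj)) p

lemma wdist_ne_top (h : G.Connected) : wdist G w u v ≠ ⊤ := by
  obtain ⟨p⟩ := h u v
  refine ne_top_of_le_ne_top ?_ (wdist_le p)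
  induction p with
  | nil => simp
  | cons hadj p ih => simpa using ih

/-- The distance as a real number. -/
noncomputable def rdist (G : SimpleGraph V) (w : Sym2 V → NNReal) (u v : V) : ℝ :=
  (wdist G w u v).toReal

lemma rdist_comm : rdist G w u v = rdist G w v u := by rw [rdist, rdist, wdist_comm]

lemma rdist_triangle (h : G.Connected) : rdist G w u x ≤ rdist G w u v + rdist G w v x := by
  rw [rdist, rdist, rdist, ← ENNReal.toReal_add (wdist_ne_top h) (wdist_ne_top h)]
  exact ENNReal.toReal_mono (ENNReal.add_ne_top.2 ⟨wdist_ne_top h, wdist_ne_top h⟩) wdist_triangle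

lemma rdist_le_of_adj (h : G.Adj u v) : rdist G w u v ≤ w s(u, v) :=
  ENNReal.toReal_le_coe_of_le_coe (wdist_le_of_adj h)

lemma rdist_anti (hG : G.Connected) (h : G ≤ H) : rdist H w u v ≤ rdist G w u v :=
  ENNReal.toReal_mono (wdist_ne_top hG) (wdist_anti h)

lemma abs_rdist_sub_le (h : G.Connected) : |rdist G w x u - rdist G w x v| ≤ rdist G w u v := by
  have h1 := rdist_triangle (w := w) (u := x) (v := u) (x := v) h
  have h2 := rdist_triangle (w := w) (u := x) (v := v) (x := u) h
  rw [rdist_comm (u := v) (v := u)] at h2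
  rw [abs_le]
  constructor <;> linarith

/-- A connected graph can be laid out on a segment of twice its weight without contracting
distances. -/
lemma exists_line_embedding [Fintype V] (hG : G.Connected) :
    ∃ f : V → ℝ, (∀ v, 0 ≤ f v) ∧ (∀ v, f v ≤ 2 * totalWeight G w) ∧
      ∀ u v, rdist G w u v ≤ |f u - f v| := by
  classical
  have key : ∀ m < Fintype.card V, ∃ (A : Finset V) (S : Finset (Sym2 V)) (f : V → ℝ),
      A.card = m + 1 ∧ (∀ e ∈ S, e ∈ G.edgeSet ∧ ∀ z ∈ e, z ∈ A) ∧ (∀ v ∈ A, 0 ≤ f v) ∧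
      (∀ v ∈ A, f v ≤ 2 * ∑ e ∈ S, (w e : ℝ)) ∧
      ∀ u ∈ A, ∀ v ∈ A, rdist G w u v ≤ |f u - f v| := by
    intro m
    induction m with
    | zero =>
      intro _
      obtain ⟨r⟩ := hG.nonempty
      exact ⟨{r}, ∅, fun _ => 0, by simp, by simp, by simp, by simp, by simp [rdist]⟩
    | succ m ih =>
      intro hm
      obtain ⟨A, S, f, hA, hS, h0, h1, h2⟩ := ih (by omega)
      obtain ⟨a, ha⟩ : A.Nonempty := Finset.card_pos.1 (by omega)
      obtain ⟨b, -, hb⟩ : ∃ b ∈ Finset.univ, b ∉ A :=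
        Finset.exists_mem_notMem_of_card_lt_card (by rw [Finset.card_univ]; omega)
      obtain ⟨p⟩ := hG a b
      obtain ⟨d, -, hy, hx⟩ := p.exists_boundary_dart (A : Set V) ha hb
      obtain ⟨⟨y, x⟩, hadj⟩ := d
      change y ∈ (A : Set V) at hy
      change x ∉ (A : Set V) at hx
      rw [Finset.mem_coe] at hy hx
      set c : ℝ := (w s(y, x) : ℝ) with hc
      have hc0 : 0 ≤ c := NNReal.coe_nonneg _
      have hyx : rdist G w y x ≤ c := rdist_le_of_adj hadj
      have hnS : s(y, x) ∉ S := fun h => hx ((hS _ h).2 x (Sym2.mem_mk_right y x))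
      set g : V → ℝ := fun z => if z = x then f y + c else if f z ≤ f y then f z else f z + 2 * c
        with hg
      have gx : g x = f y + c := by simp [hg]
      have gz : ∀ z ∈ A, (f z ≤ f y ∧ g z = f z) ∨ (f y < f z ∧ g z = f z + 2 * c) := by
        intro z hz
        have hzx : z ≠ x := fun h => hx (h ▸ hz)
        rcases le_or_gt (f z) (f y) with h | h
        · exact Or.inl ⟨h, by simp [hg, hzx, h]⟩
        · exact Or.inr ⟨h, by simp [hg, hzx, not_le.2 h]⟩
      have hzx : ∀ z ∈ A, rdist G w z x ≤ |g z - g x| := by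
        intro z hz
        have h3 := rdist_triangle (w := w) (u := z) (v := y) (x := x) hG
        have h4 := h2 z hz y hy
        rw [gx]
        rcases gz z hz with ⟨h5, h6⟩ | ⟨h5, h6⟩ <;> rw [h6]
        · rw [abs_of_nonpos (by linarith)] at h4 ⊢
          linarith
        · rw [abs_of_pos (by linarith)] at h4 ⊢
          linarith
      refine ⟨insert x A, insert s(y, x) S, g, ?_, ?_, ?_, ?_, ?_⟩
      · rw [Finset.card_insert_of_notMem hx, hA]
      · intro e he
        rcases Finset.mem_insert.1 he with rfl | he
        · refine ⟨hadj, fun z hz => ?_⟩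
          rcases Sym2.mem_iff.1 hz with rfl | rfl <;> simp [hy]
        · exact ⟨(hS e he).1, fun z hz => Finset.mem_insert_of_mem ((hS e he).2 z hz)⟩
      · intro z hz
        rcases Finset.mem_insert.1 hz with rfl | hz
        · rw [gx]; linarith [h0 y hy]
        · rcases gz z hz with ⟨-, h⟩ | ⟨-, h⟩ <;> rw [h] <;> linarith [h0 z hz]
      · intro z hz
        rw [Finset.sum_insert hnS, ← hc]
        rcases Finset.mem_insert.1 hz with rfl | hz
        · rw [gx]; linarith [h1 y hy]
        · rcases gz z hz with ⟨-, h⟩ | ⟨-, h⟩ <;> rw [h] <;> linarith [h1 z hz]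
      · intro z hzi z' hzi'
        rcases Finset.mem_insert.1 hzi with hz | hz <;>
          rcases Finset.mem_insert.1 hzi' with hz' | hz'
        · simp [hz, hz', rdist]
        · rw [hz, rdist_comm, abs_sub_comm]; exact hzx z' hz'
        · rw [hz']; exact hzx z hz
        · refine (h2 z hz z' hz').trans ?_
          rcases gz z hz with ⟨h3, h4⟩ | ⟨h3, h4⟩ <;> rcases gz z' hz' with ⟨h5, h6⟩ | ⟨h5, h6⟩ <;>
            rw [h4, h6]
          · rw [abs_of_nonpos (by linarith), abs_of_nonpos (by linarith)]; linarith
          · rw [abs_of_nonneg (by linarith), abs_of_nonneg (by linarith)]; linarith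
          · exact le_of_eq (congrArg _ (by ring))
  have := hG.nonempty
  obtain ⟨A, S, f, hA, hS, h0, h1, h2⟩ := key (Fintype.card V - 1)
    (Nat.sub_lt Fintype.card_pos one_pos)
  have hA' : A = Finset.univ := by
    rw [← Finset.card_eq_iff_eq_univ, hA]
    exact Nat.sub_add_cancel Fintype.card_pos
  subst hA'
  refine ⟨f, fun v => h0 v (Finset.mem_univ v), fun v => (h1 v (Finset.mem_univ v)).trans ?_,
    fun u v => h2 u (Finset.mem_univ u) v (Finset.mem_univ v)⟩
  refine mul_le_mul_of_nonneg_left ?_ zero_le_two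
  exact Finset.sum_le_sum_of_subset_of_nonneg (fun e he => by simpa using (hS e he).1)
    fun e _ _ => NNReal.coe_nonneg _

end Distance

/-- Greedy selection: each element is kept or discarded according to the earlier kept ones. -/
lemma exists_greedy {α : Type*} [LinearOrder α] [Finite α] (R : Set α → α → Prop) :
    ∃ S : Set α, ∀ e, e ∈ S ↔ R {f ∈ S | f < e} e := by
  have wf : WellFounded ((· < ·) : α → α → Prop) := wellFounded_lt
  let sel : α → Prop := wf.fix fun e ih => R {f | ∃ h : f < e, ih f h} e
  refine ⟨{e | sel e}, fun e => ?_⟩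
  have h : sel e = R {f | ∃ _ : f < e, sel f} e := wf.fix_eq _ e
  have h2 : {f | ∃ _ : f < e, sel f} = {f ∈ {e | sel e} | f < e} := by
    ext f; simp [and_comm]
  rw [Set.mem_ofPred_eq, h, h2]

/-- A function that is `1`-Lipschitz for the distances on the line extends to the line. -/
lemma exists_lipschitz_extension {V : Type*} {f g : V → ℝ} (h : ∀ u v, |g u - g v| ≤ |f u - f v|) :
    ∃ φ : ℝ → ℝ, (∀ x y, |φ x - φ y| ≤ |x - y|) ∧ ∀ v, φ (f v) = g v := by
  have hfac : Function.FactorsThrough g f := fun u v huv => by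
    have := h u v
    rw [huv, sub_self, abs_zero] at this
    exact sub_eq_zero.1 (abs_nonpos_iff.1 this)
  have hlip : LipschitzOnWith 1 (Function.extend f g 0) (Set.range f) := by
    refine LipschitzOnWith.of_dist_le_mul ?_
    rintro _ ⟨u, rfl⟩ _ ⟨v, rfl⟩
    rw [hfac.extend_apply, hfac.extend_apply, Real.dist_eq, Real.dist_eq, NNReal.coe_one, one_mul]
    exact h u v
  obtain ⟨φ, h1, h2⟩ := hlip.extend_real
  refine ⟨φ, fun x y => ?_, fun v => ?_⟩
  · simpa [Real.dist_eq] using h1.dist_le_mul x y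
  · rw [← h2 ⟨v, rfl⟩, hfac.extend_apply]

variable {V : Type} [Fintype V]

lemma exists_isMinSpanningTree {G : SimpleGraph V} (w : Sym2 V → NNReal) (hG : G.Connected) :
    ∃ T ≤ G, T.IsTree ∧ mstWeight G w = totalWeight T w := by
  obtain ⟨T₀, h1, h2⟩ := hG.exists_isTree_le
  have hfin : {x | ∃ T : SimpleGraph V, T ≤ G ∧ T.IsTree ∧ x = totalWeight T w}.Finite :=
    (Set.finite_range fun T : SimpleGraph V => totalWeight T w).subset
      fun x ⟨T, _, _, h⟩ => ⟨T, h.symm⟩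
  obtain ⟨T, h3, h4, h5⟩ := Set.Nonempty.csInf_mem (by exact ⟨_, T₀, h1, h2, rfl⟩) hfin
  exact ⟨T, h3, h4, h5⟩

lemma exists_sorted_edges (G : SimpleGraph V) (w : Sym2 V → NNReal) :
    ∃ (N : ℕ) (a b : Fin N → V), Monotone (fun i => w s(a i, b i)) ∧
      (∀ i, G.Adj (a i) (b i)) ∧ ∀ e ∈ G.edgeSet, ∃ i, e = s(a i, b i) := by
  obtain ⟨N, ⟨σ⟩⟩ := Finite.exists_equiv_fin G.edgeSet
  set τ := Tuple.sort (fun i => w (σ.symm i)) with hτ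
  have hmono := Tuple.monotone_sort (fun i => w (σ.symm i))
  have hex : ∀ i, ∃ ab : V × V, s(ab.1, ab.2) = (σ.symm (τ i)).1 := fun i =>
    ⟨Quot.out (σ.symm (τ i)).1, Quot.out_eq _⟩
  choose ab hab using hex
  refine ⟨N, fun i => (ab i).1, fun i => (ab i).2, ?_, fun i => ?_, fun e he => ?_⟩
  · simp only [hab]
    exact hmono
  · rw [← mem_edgeSet, hab]
    exact (σ.symm (τ i)).2
  · refine ⟨τ.symm (σ ⟨e, he⟩), ?_⟩
    rw [hab]
    simp

/-- The edges kept by the greedy algorithm form a system of shortcuts, and turn a connected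
subgraph into a spanner. -/
lemma exists_shortcutSystem {G T : SimpleGraph V} {w : Sym2 V → NNReal} {t : ℝ} (ht : 1 ≤ t)
    (hT : T.Connected) (hw : ∀ e ∈ G.edgeSet, 0 < w e) :
    ∃ (ι : Type) (_ : LinearOrder ι) (_ : Fintype ι) (M : ShortcutSystem V ι), M.t = t ∧
      (∀ v, 0 ≤ M.pos v) ∧ (∀ v, M.pos v ≤ 2 * totalWeight T w) ∧
      (∀ i, M.wt i = w s(M.a i, M.b i)) ∧ (∀ i, G.Adj (M.a i) (M.b i)) ∧
      IsTSpanner G (T ⊔ fromEdgeSet (Set.range fun i => s(M.a i, M.b i))) w t := by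
  classical
  obtain ⟨N, a, b, hmono, hadj, hsurj⟩ := exists_sorted_edges G w
  set K : Set (Fin N) → SimpleGraph V := fun P => T ⊔ fromEdgeSet ((fun i => s(a i, b i)) '' P)
    with hK
  have hKc : ∀ P, (K P).Connected := fun P => hT.mono le_sup_left
  have hKadj : ∀ P, ∀ i ∈ P, (K P).Adj (a i) (b i) := fun P i hi =>
    Or.inr ((fromEdgeSet_adj _).2 ⟨⟨i, hi, rfl⟩, (hadj i).ne⟩)
  have hKmono : ∀ P Q, P ⊆ Q → K P ≤ K Q := fun P Q h =>
    sup_le_sup_left (fromEdgeSet_mono (Set.image_mono h)) _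
  obtain ⟨S, hS⟩ := exists_greedy fun (P : Set (Fin N)) i =>
    t * w s(a i, b i) < rdist (K P) w (a i) (b i)
  obtain ⟨pos, hpos, hposW, hline⟩ := exists_line_embedding (w := w) hT
  have hφ := fun i : S => exists_lipschitz_extension (f := pos)
    (g := fun v => rdist (K {j ∈ S | j < i.1}) w (a i) v) fun u v =>
      (abs_rdist_sub_le (hKc _)).trans ((rdist_anti hT le_sup_left).trans (hline u v))
  choose φ hlip hφ using hφ
  refine ⟨S, inferInstance, Fintype.ofFinite S,
    { a := fun i => a i
      b := fun i => b i
      wt := fun i => w s(a i, b i)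
      pos := pos
      φ := φ
      t := t
      wt_pos := fun i => NNReal.coe_pos.2 (hw _ (hadj i))
      wt_mono := fun i j hij => NNReal.coe_le_coe.2 (hmono hij)
      lip := hlip
      short := fun i j hij => ?_
      long := fun i => ?_ }, rfl, hpos, hposW, fun _ => rfl, fun i => hadj i, ?_⟩
  · rw [hφ, hφ]
    exact (abs_rdist_sub_le (hKc _)).trans (rdist_le_of_adj (hKadj _ _ ⟨j.2, hij⟩))
  · rw [hφ, hφ]
    have h0 : rdist (K {j ∈ S | j < i.1}) w (a i) (a i) = 0 := by simp [rdist]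
    rw [h0, zero_sub, abs_neg]
    exact ((hS i).1 i.2).trans_le (le_abs_self _)
  · have hrange : Set.range (fun i : S => s(a i, b i)) = (fun i => s(a i, b i)) '' S :=
      (Set.image_eq_range (fun i => s(a i, b i)) S).symm
    change IsTSpanner G (T ⊔ fromEdgeSet (Set.range fun i : S => s(a i, b i))) w t
    rw [hrange]
    have hdist : ∀ i, rdist (K S) w (a i) (b i) ≤ t * w s(a i, b i) := fun i => by
      by_cases hi : i ∈ S
      · exact (rdist_le_of_adj (hKadj _ _ hi)).trans
          (le_mul_of_one_le_left (NNReal.coe_nonneg _) ht)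
      · exact (rdist_anti (hKc _) (hKmono _ _ fun j hj => hj.1)).trans
          (not_lt.1 fun h => hi ((hS i).2 h))
    refine isTSpanner_of_adj (by linarith) fun u v huv => ?_
    obtain ⟨i, hi⟩ := hsurj s(u, v) huv
    have hle : rdist (K S) w u v ≤ t * w s(u, v) := by
      rcases Sym2.eq_iff.1 hi with ⟨rfl, rfl⟩ | ⟨rfl, rfl⟩
      · exact hdist i
      · rw [rdist_comm, hi]; exact hdist i
    rw [← ENNReal.ofReal_coe_nnreal, ← ENNReal.ofReal_mul (by linarith)]
    exact (ENNReal.le_ofReal_iff_toReal_le (wdist_ne_top (hKc S)) (by positivity)).2 hle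

end LightSpanner

/-- **Light spanners.** There is a universal constant `C > 0` such that for every integer
`k ≥ 2`, every `ε > 0` and every connected weighted graph `G` on `n` vertices, there is a
subgraph `H` of `G` that is a `(2k-1)(1+ε)`-spanner of `G`, has at most `C·n^{1+1/k}` edges,
and has weight at most `C · w(MST(G)) · n^{1/k} · (1 + k/(ε^{1+1/k}·log k))`. -/
theorem light_spanner_greedy :
    ∃ C : ℝ, 0 < C ∧
      ∀ (k : ℕ), 2 ≤ k → ∀ (ε : ℝ), 0 < ε →
        ∀ (V : Type) [Fintype V] (G : SimpleGraph V) (w : Sym2 V → NNReal),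
          G.Connected → (∀ e ∈ G.edgeSet, 0 < w e) →
          ∃ H : SimpleGraph V, H ≤ G ∧
            IsTSpanner G H w ((2 * (k : ℝ) - 1) * (1 + ε)) ∧
            (Nat.card H.edgeSet : ℝ) ≤
              C * (Fintype.card V : ℝ) ^ ((1 : ℝ) + 1 / (k : ℝ)) ∧
            totalWeight H w ≤
              C * mstWeight G w * (Fintype.card V : ℝ) ^ ((1 : ℝ) / (k : ℝ)) *
                (1 + (k : ℝ) / (ε ^ ((1 : ℝ) + 1 / (k : ℝ)) * Real.logb 2 (k : ℝ))) := by
  classical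
  refine ⟨39601, by norm_num, fun k hk ε hε V _ G w hG hw => ?_⟩
  obtain ⟨T, hTG, hT, hW⟩ := LightSpanner.exists_isMinSpanningTree w hG
  have hk' : (2 : ℝ) ≤ k := by exact_mod_cast hk
  obtain ⟨ι, _, _, M, ht, hpos, hposW, hwt, hadj, hspan⟩ :=
    LightSpanner.exists_shortcutSystem (t := (2 * (k : ℝ) - 1) * (1 + ε)) (by nlinarith)
      hT.connected hw
  have := hG.nonempty
  set n : ℝ := (Fintype.card V : ℝ) with hn
  have hn1 : 1 ≤ n := by rw [hn]; exact_mod_cast Fintype.card_pos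
  have hnk : 1 ≤ n ^ (1 / (k : ℝ)) := Real.one_le_rpow hn1 (by positivity)
  have hlogb : 0 < Real.logb 2 k := Real.logb_pos (by norm_num) (by linarith)
  set e : ι → Sym2 V := fun i => s(M.a i, M.b i) with he
  have hsub : (T ⊔ fromEdgeSet (Set.range e)).edgeSet ⊆ T.edgeSet ∪ Set.range e := by
    rw [edgeSet_sup, edgeSet_fromEdgeSet]
    exact Set.union_subset_union_right _ Set.sdiff_subset
  refine ⟨T ⊔ fromEdgeSet (Set.range e), sup_le hTG ?_, hspan, ?_, ?_⟩
  · rw [← edgeSet_subset_edgeSet, edgeSet_fromEdgeSet]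
    rintro _ ⟨⟨i, rfl⟩, -⟩
    exact hadj i
  · have h1 : Nat.card (T ⊔ fromEdgeSet (Set.range e)).edgeSet ≤
        Fintype.card V + Fintype.card ι := by
      have h2 : T.edgeSet.ncard ≤ Fintype.card V := by
        have := hT.card_edgeFinset
        rw [← coe_edgeFinset T, Set.ncard_coe_finset]
        omega
      have h3 : (Set.range e).ncard ≤ Fintype.card ι := by
        rw [← Set.image_univ, ← Nat.card_eq_fintype_card, ← Set.ncard_univ]
        exact Set.ncard_image_le
      exact (Set.ncard_le_ncard hsub).trans ((Set.ncard_union_le _ _).trans (add_le_add h2 h3))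
    have h2 : ((Nat.card (T ⊔ fromEdgeSet (Set.range e)).edgeSet : ℕ) : ℝ) ≤
        n + Fintype.card ι := by rw [hn]; exact_mod_cast h1
    have h3 := LightSpanner.ShortcutSystem.card_le hk hε ht
    rw [Real.rpow_add (by linarith), Real.rpow_one]
    nlinarith
  · set W := totalWeight T w with hWd
    have hW0 : 0 ≤ W := Finset.sum_nonneg fun e _ => NNReal.coe_nonneg _
    set Y := 1 + (k : ℝ) / (ε ^ ((1 : ℝ) + 1 / (k : ℝ)) * Real.logb 2 (k : ℝ)) with hY
    have hY1 : 1 ≤ Y := le_add_of_nonneg_right (by positivity)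
    have hsum : ∑ i, M.wt i ≤ 39600 * W * n ^ (1 / (k : ℝ)) * Y := by
      rcases isEmpty_or_nonempty ι with hι | ⟨⟨i⟩⟩
      · rw [Finset.univ_eq_empty, Finset.sum_empty]; positivity
      · refine LightSpanner.ShortcutSystem.sum_wt_le hk hε ?_ ht hpos hposW
        have h1 : 0 < M.t * M.wt i := mul_pos (by rw [ht]; nlinarith) (M.wt_pos i)
        have h2 := (h1.trans (M.long i)).trans_le (M.lip i _ _)
        refine lt_of_le_of_ne hW0 fun h => ?_
        have h3 : ∀ v, M.pos v = 0 := fun v => le_antisymm (by linarith [hposW v]) (hpos v)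
        simp [h3] at h2
    have hH : totalWeight (T ⊔ fromEdgeSet (Set.range e)) w ≤ W + ∑ i, M.wt i := by
      have h1 : (T ⊔ fromEdgeSet (Set.range e)).edgeSet.toFinite.toFinset ⊆
          T.edgeSet.toFinite.toFinset ∪ Finset.univ.image e := fun x hx => by
        simpa using hsub (by simpa using hx)
      have h2 := Finset.sum_union_inter (s₁ := T.edgeSet.toFinite.toFinset)
        (s₂ := Finset.univ.image e) (f := fun x => (w x : ℝ))
      have h3 : 0 ≤ ∑ x ∈ T.edgeSet.toFinite.toFinset ∩ Finset.univ.image e, (w x : ℝ) :=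
        Finset.sum_nonneg fun x _ => NNReal.coe_nonneg _
      have h4 : ∑ x ∈ Finset.univ.image e, (w x : ℝ) ≤ ∑ i, (w (e i) : ℝ) :=
        Finset.sum_image_le_of_nonneg fun x _ => NNReal.coe_nonneg _
      have h5 : ∑ i, M.wt i = ∑ i, (w (e i) : ℝ) := Finset.sum_congr rfl fun i _ => hwt i
      have h6 : totalWeight (T ⊔ fromEdgeSet (Set.range e)) w ≤
          ∑ x ∈ T.edgeSet.toFinite.toFinset ∪ Finset.univ.image e, (w x : ℝ) :=
        Finset.sum_le_sum_of_subset_of_nonneg h1 fun x _ _ => NNReal.coe_nonneg _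
      have h7 : W = ∑ x ∈ T.edgeSet.toFinite.toFinset, (w x : ℝ) := rfl
      linarith
    rw [hW]
    have : W * 1 ≤ W * (n ^ (1 / (k : ℝ)) * Y) :=
      mul_le_mul_of_nonneg_left (one_le_mul_of_one_le_of_one_le hnk hY1) hW0
    linarith
end

section
/- There exists a universal constant C > 0 such that every connected weighted graph G on n ≥ 16 vertices admits a subgraph H that is a (C·log n)-spanner of G and satisfies w(H) ≤ C · (log n / log log n) · w(MST(G)). -/
open SimpleGraph

/-- In the multigraph with edge set `A` and endpoint maps `s, d`, there is a walk from `p` to `q`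
of total weight at most `ℓ`. -/
inductive Reach {P E : Type*} (s d : E → P) (w : E → ℝ) (A : Set E) : ℝ → P → P → Prop
  | refl {ℓ : ℝ} {p : P} (hl : 0 ≤ ℓ) : Reach s d w A ℓ p p
  | fwd {ℓ ℓ' : ℝ} {e : E} {q : P} (he : e ∈ A) (h : Reach s d w A ℓ (d e) q)
      (hl : w e + ℓ ≤ ℓ') : Reach s d w A ℓ' (s e) q
  | bwd {ℓ ℓ' : ℝ} {e : E} {q : P} (he : e ∈ A) (h : Reach s d w A ℓ (s e) q)
      (hl : w e + ℓ ≤ ℓ') : Reach s d w A ℓ' (d e) q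

namespace Reach

variable {P E : Type*} {s d : E → P} {w : E → ℝ} {A A' : Set E} {ℓ ℓ' : ℝ} {p q r : P}

theorem mono_len (h : Reach s d w A ℓ p q) (hl : ℓ ≤ ℓ') : Reach s d w A ℓ' p q := by
  cases h with
  | refl h0 => exact .refl (h0.trans hl)
  | fwd he h h1 => exact .fwd he h (h1.trans hl)
  | bwd he h h1 => exact .bwd he h (h1.trans hl)

theorem mono_set (h : Reach s d w A ℓ p q) (hA : A ⊆ A') : Reach s d w A' ℓ p q := by
  induction h with
  | refl h0 => exact .refl h0
  | fwd he _ h1 ih => exact .fwd (hA he) ih h1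
  | bwd he _ h1 ih => exact .bwd (hA he) ih h1

theorem trans (h : Reach s d w A ℓ p q) (h' : Reach s d w A ℓ' q r) :
    Reach s d w A (ℓ + ℓ') p r := by
  induction h with
  | refl h0 => exact h'.mono_len (by linarith)
  | fwd he _ h1 ih => exact .fwd he (ih h') (by linarith)
  | bwd he _ h1 ih => exact .bwd he (ih h') (by linarith)

theorem edge {e : E} (he : e ∈ A) : Reach s d w A (w e) (s e) (d e) :=
  .fwd he (.refl le_rfl) (by simp)

theorem edge_symm {e : E} (he : e ∈ A) : Reach s d w A (w e) (d e) (s e) :=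
  .bwd he (.refl le_rfl) (by simp)

theorem symm (h : Reach s d w A ℓ p q) : Reach s d w A ℓ q p := by
  induction h with
  | refl h0 => exact .refl h0
  | fwd he _ h1 ih => exact (ih.trans (edge_symm he)).mono_len (by linarith)
  | bwd he _ h1 ih => exact (ih.trans (edge he)).mono_len (by linarith)

theorem nonneg (hw : ∀ e, 0 ≤ w e) (h : Reach s d w A ℓ p q) : 0 ≤ ℓ := by
  induction h with
  | refl h0 => exact h0
  | @fwd _ _ e _ _ _ h1 ih => linarith [hw e]
  | @bwd _ _ e _ _ _ h1 ih => linarith [hw e]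

/-- A walk either avoids the edge `f`, or splits into an initial and a final part avoiding `f`
that end and start at the two endpoints of `f`. -/
theorem split (hw : ∀ e, 0 ≤ w e) (f : E) (h : Reach s d w A ℓ p q) :
    Reach s d w (A \ {f}) ℓ p q ∨ ∃ ℓ₁ ℓ₂, ℓ₁ + w f + ℓ₂ ≤ ℓ ∧
      ((Reach s d w (A \ {f}) ℓ₁ p (s f) ∧ Reach s d w (A \ {f}) ℓ₂ (d f) q) ∨
        (Reach s d w (A \ {f}) ℓ₁ p (d f) ∧ Reach s d w (A \ {f}) ℓ₂ (s f) q)) := by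
  induction h with
  | refl h0 => exact .inl (.refl h0)
  | @fwd ℓ ℓ' e q he h h1 ih =>
    by_cases hef : e = f
    · subst hef
      rcases ih with ih | ⟨ℓ₁, ℓ₂, hl, ⟨h2, h3⟩ | ⟨h2, h3⟩⟩
      · exact .inr ⟨0, ℓ, by linarith, .inl ⟨.refl le_rfl, ih⟩⟩
      · exact .inr ⟨0, ℓ₂, by linarith [h2.nonneg hw, hw e], .inl ⟨.refl le_rfl, h3⟩⟩
      · exact .inl (h3.mono_len (by linarith [h2.nonneg hw, hw e]))
    · rcases ih with ih | ⟨ℓ₁, ℓ₂, hl, ⟨h2, h3⟩ | ⟨h2, h3⟩⟩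
      · exact .inl (.fwd ⟨he, hef⟩ ih h1)
      · exact .inr ⟨w e + ℓ₁, ℓ₂, by linarith, .inl ⟨.fwd ⟨he, hef⟩ h2 le_rfl, h3⟩⟩
      · exact .inr ⟨w e + ℓ₁, ℓ₂, by linarith, .inr ⟨.fwd ⟨he, hef⟩ h2 le_rfl, h3⟩⟩
  | @bwd ℓ ℓ' e q he h h1 ih =>
    by_cases hef : e = f
    · subst hef
      rcases ih with ih | ⟨ℓ₁, ℓ₂, hl, ⟨h2, h3⟩ | ⟨h2, h3⟩⟩
      · exact .inr ⟨0, ℓ, by linarith, .inr ⟨.refl le_rfl, ih⟩⟩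
      · exact .inl (h3.mono_len (by linarith [h2.nonneg hw, hw e]))
      · exact .inr ⟨0, ℓ₂, by linarith [h2.nonneg hw, hw e], .inr ⟨.refl le_rfl, h3⟩⟩
    · rcases ih with ih | ⟨ℓ₁, ℓ₂, hl, ⟨h2, h3⟩ | ⟨h2, h3⟩⟩
      · exact .inl (.bwd ⟨he, hef⟩ ih h1)
      · exact .inr ⟨w e + ℓ₁, ℓ₂, by linarith, .inl ⟨.bwd ⟨he, hef⟩ h2 le_rfl, h3⟩⟩
      · exact .inr ⟨w e + ℓ₁, ℓ₂, by linarith, .inr ⟨.bwd ⟨he, hef⟩ h2 le_rfl, h3⟩⟩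

/-- If two distinct nodes are joined by a walk, then some edge `e` of the walk can be removed so
that both nodes are still joined to the endpoints of `e`. -/
theorem exists_cut (hw : ∀ e, 1 ≤ w e) (h : Reach s d w A ℓ p q) (hpq : p ≠ q) :
    ∃ e ∈ A, (Reach s d w (A \ {e}) ℓ p (s e) ∧ Reach s d w (A \ {e}) ℓ (d e) q) ∨
      (Reach s d w (A \ {e}) ℓ p (d e) ∧ Reach s d w (A \ {e}) ℓ (s e) q) := by
  have hw0 : ∀ e, 0 ≤ w e := fun e => zero_le_one.trans (hw e)
  obtain ⟨n, hn⟩ := exists_nat_gt ℓ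
  induction n generalizing ℓ with
  | zero => exact absurd hn (by simpa using h.nonneg hw0)
  | succ n ih =>
    push_cast at hn
    have shorter : ∀ ℓ₂, ℓ₂ + 1 ≤ ℓ → Reach s d w A ℓ₂ p q →
        ∃ e ∈ A, (Reach s d w (A \ {e}) ℓ p (s e) ∧ Reach s d w (A \ {e}) ℓ (d e) q) ∨
          (Reach s d w (A \ {e}) ℓ p (d e) ∧ Reach s d w (A \ {e}) ℓ (s e) q) := by
      intro ℓ₂ hl h2
      obtain ⟨e, he, h3⟩ := ih h2 (by linarith)
      exact ⟨e, he, h3.imp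
        (fun h => ⟨h.1.mono_len (by linarith), h.2.mono_len (by linarith)⟩)
        (fun h => ⟨h.1.mono_len (by linarith), h.2.mono_len (by linarith)⟩)⟩
    cases h with
    | refl h0 => exact absurd rfl hpq
    | @fwd ℓ₀ _ e _ he h h1 =>
      have h0 := h.nonneg hw0
      have he0 := hw e
      rcases h.split hw0 e with h2 | ⟨ℓ₁, ℓ₂, hl, ⟨h2, h3⟩ | ⟨h2, h3⟩⟩
      · exact ⟨e, he, .inl ⟨.refl (by linarith), h2.mono_len (by linarith)⟩⟩
      · exact ⟨e, he, .inl ⟨.refl (by linarith), h3.mono_len (by linarith [h2.nonneg hw0])⟩⟩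
      · exact shorter ℓ₂ (by linarith [h2.nonneg hw0]) (h3.mono_set Set.sdiff_subset)
    | @bwd ℓ₀ _ e _ he h h1 =>
      have h0 := h.nonneg hw0
      have he0 := hw e
      rcases h.split hw0 e with h2 | ⟨ℓ₁, ℓ₂, hl, ⟨h2, h3⟩ | ⟨h2, h3⟩⟩
      · exact ⟨e, he, .inr ⟨.refl (by linarith), h2.mono_len (by linarith)⟩⟩
      · exact shorter ℓ₂ (by linarith [h2.nonneg hw0]) (h3.mono_set Set.sdiff_subset)
      · exact ⟨e, he, .inr ⟨.refl (by linarith), h3.mono_len (by linarith [h2.nonneg hw0])⟩⟩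

end Reach

/-- A sequence with `2 ≤ b 1` bounded by `(2 h) ^ h` must at some step before `2 h` grow by at most
a logarithmic factor. -/
theorem exists_slow_growth (b : ℕ → ℕ) (h : ℕ) (hh : 1 ≤ h) (hb1 : 2 ≤ b 1)
    (hb : b (2 * h) ≤ (2 * h) ^ h) :
    ∃ r, 1 ≤ r ∧ r < 2 * h ∧ (b (r + 1) : ℝ) ≤ 4 * (b r * Real.log (b r)) := by
  by_contra! hcon
  have hlog2 : (1 / 2 : ℝ) ≤ Real.log 2 := by linarith [Real.log_two_gt_d9]
  have hstep : ∀ r, 1 ≤ r → r < 2 * h → 2 ^ r ≤ b r → 2 * r * b r < b (r + 1) := by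
    intro r hr hlt h1
    have h2 := hcon r hr hlt
    have h4 : Real.log ((2 : ℝ) ^ r) ≤ Real.log (b r) :=
      Real.log_le_log (by positivity) (by exact_mod_cast h1)
    rw [Real.log_pow] at h4
    have hr0 : (0 : ℝ) ≤ r := by positivity
    have h3 : (r : ℝ) / 2 ≤ Real.log (b r) := by nlinarith
    have hb0 : (0 : ℝ) ≤ b r := by positivity
    have h5 : (2 * r * b r : ℝ) < b (r + 1) := by nlinarith
    exact_mod_cast h5
  have hpow : ∀ r, 1 ≤ r → r ≤ 2 * h → 2 ^ r ≤ b r := by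
    intro r hr
    induction r, hr using Nat.le_induction with
    | base => exact fun _ => by simpa using hb1
    | succ r hr ih =>
      intro hle
      have h1 := ih (by omega)
      have h2 := hstep r hr (by omega) h1
      rw [pow_succ]
      nlinarith
  have hgrow : ∀ i, i ≤ h → (2 * h) ^ i * b h ≤ b (h + i) := by
    intro i
    induction i with
    | zero => intro _; simp
    | succ i ih =>
      intro hi
      have h1 := hstep (h + i) (by omega) (by omega) (hpow _ (by omega) (by omega))
      have h2 := ih (by omega)
      calc (2 * h) ^ (i + 1) * b h = 2 * h * ((2 * h) ^ i * b h) := by ring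
        _ ≤ 2 * (h + i) * b (h + i) := by gcongr; omega
        _ ≤ b (h + (i + 1)) := h1.le
  have h1 := hgrow h le_rfl
  rw [← two_mul] at h1
  have h2 := hpow h hh (by omega)
  have h3 : 2 ≤ b h := le_trans (by simpa using Nat.pow_le_pow_right (n := 2) (by norm_num) hh) h2
  have h4 : 0 < (2 * h) ^ h := by positivity
  nlinarith

section Clustering

variable {P E : Type*} {s d : E → P}

/-- Given a family of edges without short cycles, all of whose members have an endpoint at hop
distance at most `r` from `v`, the number of members is at most the size of the ball of radius
`r + 1` around `v`. -/
theorem card_le_card_ball [DecidableEq P] (F F' : Finset E) (hF' : F' ⊆ F) (v : P) (r : ℕ)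
    (ball : ℕ → Finset P) (hball : ∀ i x, x ∈ ball i ↔ Reach s d (fun _ => 1) F i v x)
    (hcyc : ∀ e ∈ F, ¬ Reach s d (fun _ => 1) (F \ {e} : Set E) (2 * r + 1) (s e) (d e))
    (hr : ∀ e ∈ F', s e ∈ ball r ∨ d e ∈ ball r) :
    F'.card ≤ (ball (r + 1)).card := by
  classical
  have hw : ∀ e : E, (0 : ℝ) ≤ (fun _ => 1 : E → ℝ) e := fun _ => zero_le_one
  have hmono : ∀ {i j x}, i ≤ j → x ∈ ball i → x ∈ ball j := by
    intro i j x hij hx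
    rw [hball] at hx ⊢
    exact hx.mono_len (by exact_mod_cast hij)
  -- every edge has a first endpoint at some level and its other endpoint at the next level
  have key : ∀ e ∈ F', ∃ i ≤ r, ∃ x y, ((x = s e ∧ y = d e) ∨ (x = d e ∧ y = s e)) ∧ x ∈ ball i ∧
      y ∉ ball i ∧ y ∈ ball (i + 1) := by
    intro e he
    have heF : e ∈ F := hF' he
    have hex : ∃ i, s e ∈ ball i ∨ d e ∈ ball i := ⟨r, hr e he⟩
    let i := Nat.find hex
    have hi : s e ∈ ball i ∨ d e ∈ ball i := Nat.find_spec hex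
    have hir : i ≤ r := Nat.find_min' hex (hr e he)
    have hmin : ∀ j < i, s e ∉ ball j ∧ d e ∉ ball j := fun j hj =>
      not_or.mp (Nat.find_min hex hj)
    have hirR : (i : ℝ) ≤ r := by exact_mod_cast hir
    have avoid : ∀ x ∈ ball i, Reach s d (fun _ => 1) (F \ {e} : Set E) i v x := by
      intro x hx
      rcases ((hball i x).1 hx).split hw e with h | ⟨ℓ₁, ℓ₂, hl, ⟨h1, h2⟩ | ⟨h1, h2⟩⟩
      · exact h
      all_goals
        exfalso
        have h10 := h1.nonneg hw
        have h20 := h2.nonneg hw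
        have hi1 : 1 ≤ i := by
          have : (1 : ℝ) ≤ i := by linarith
          exact_mod_cast this
        have h3 := hmin (i - 1) (by omega)
        have h4 := (h1.mono_set Set.sdiff_subset).mono_len
          (ℓ' := ((i - 1 : ℕ) : ℝ)) (by push_cast [hi1]; linarith)
        rw [← hball] at h4
        tauto
    have notboth : ¬ (s e ∈ ball i ∧ d e ∈ ball i) := by
      rintro ⟨h1, h2⟩
      exact hcyc e heF (((avoid _ h1).symm.trans (avoid _ h2)).mono_len (by linarith))
    rcases hi with h | h
    · refine ⟨i, hir, s e, d e, .inl ⟨rfl, rfl⟩, h, fun h' => notboth ⟨h, h'⟩, ?_⟩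
      rw [hball] at h ⊢
      exact (h.trans (Reach.edge (Finset.mem_coe.2 heF))).mono_len (by push_cast; linarith)
    · refine ⟨i, hir, d e, s e, .inr ⟨rfl, rfl⟩, h, fun h' => notboth ⟨h', h⟩, ?_⟩
      rw [hball] at h ⊢
      exact (h.trans (Reach.edge_symm (Finset.mem_coe.2 heF))).mono_len (by push_cast; linarith)
  have : Nonempty P := ⟨v⟩
  choose! i hir x y hxy hx hy hy' using key
  refine Finset.card_le_card_of_injOn y (fun e he => ?_) ?_
  · exact hmono (by have := hir e he; omega) (hy' e he)
  · intro e he e' he' hyy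
    by_contra hne
    have hii : i e = i e' := by
      by_contra hii
      rcases lt_or_gt_of_ne hii with h | h
      · exact hy e' he' (hyy ▸ hmono (by omega) (hy' e he))
      · exact hy e he (hyy ▸ hmono (by omega) (hy' e' he'))
    have hirR : (i e : ℝ) ≤ r := by exact_mod_cast hir e he
    have heF : e ∈ F := hF' he
    have he'F : e' ∈ F := hF' he'
    have avoid : ∀ z ∈ ball (i e), Reach s d (fun _ => 1) (F \ {e} : Set E) (i e) v z := by
      intro z hz
      rcases ((hball _ z).1 hz).split hw e with h | ⟨ℓ₁, ℓ₂, hl, ⟨h1, h2⟩ | ⟨h1, h2⟩⟩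
      · exact h
      all_goals
        exfalso
        have h20 := h2.nonneg hw
        have h3 := h1.mono_set (Set.sdiff_subset : (F \ {e} : Set E) ⊆ F)
        have h4 : Reach s d (fun _ => 1) (F : Set E) (i e) v (s e) := by
          first
          | exact h3.mono_len (by linarith)
          | exact (h3.trans (Reach.edge_symm (Finset.mem_coe.2 heF))).mono_len (by linarith)
        have h5 : Reach s d (fun _ => 1) (F : Set E) (i e) v (d e) := by
          first
          | exact h3.mono_len (by linarith)
          | exact (h3.trans (Reach.edge (Finset.mem_coe.2 heF))).mono_len (by linarith)
        rw [← hball] at h4 h5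
        rcases hxy e he with ⟨-, h6⟩ | ⟨-, h6⟩
        · exact hy e he (h6 ▸ h5)
        · exact hy e he (h6 ▸ h4)
    have hmem : e' ∈ (F \ {e} : Set E) := ⟨he'F, fun h => hne h.symm⟩
    have hlast : Reach s d (fun _ => 1) (F \ {e} : Set E) 1 (x e') (y e') := by
      rcases hxy e' he' with ⟨h6, h7⟩ | ⟨h6, h7⟩
      · rw [h6, h7]; exact Reach.edge hmem
      · rw [h6, h7]; exact Reach.edge_symm hmem
    have hcl : Reach s d (fun _ => 1) (F \ {e} : Set E) (2 * r + 1) (x e) (y e) :=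
      hyy ▸ (((avoid _ (hx e he)).symm.trans (avoid _ (hii ▸ hx e' he'))).trans hlast).mono_len
        (by linarith)
    rcases hxy e he with ⟨h6, h7⟩ | ⟨h6, h7⟩
    · exact hcyc e heF (h6 ▸ h7 ▸ hcl)
    · exact hcyc e heF (h6 ▸ h7 ▸ hcl.symm)

/-- A finite family of edges without cycles of at most `4 h + 1` hops admits a clustering of the
nodes into clusters of hop diameter at most `4 h` whose entropy controls the number of edges. -/
theorem exists_clustering [Fintype P] [DecidableEq P] [DecidableEq E] (h : ℕ) (hh : 1 ≤ h)
    (hP : Fintype.card P ≤ (2 * h) ^ h) (F : Finset E)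
    (hcyc : ∀ e ∈ F, ¬ Reach s d (fun _ => 1) (F \ {e} : Set E) (4 * h) (s e) (d e)) :
    ∃ cl : P → Finset P, (∀ x, x ∈ cl x) ∧ (∀ x, ∀ y ∈ cl x, cl y = cl x) ∧
      (∀ x, ∀ y ∈ cl x, Reach s d (fun _ => 1) F (4 * h) x y) ∧
      (F.card : ℝ) ≤ 4 * ∑ x, Real.log (cl x).card := by
  classical
  induction hn : F.card using Nat.strong_induction_on generalizing F with
  | _ n ih =>
  subst hn
  rcases F.eq_empty_or_nonempty with rfl | ⟨e₀, he₀⟩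
  · refine ⟨fun x => {x}, by simp, by simp, ?_, by simp⟩
    intro x y hy
    rw [Finset.mem_singleton] at hy
    exact hy ▸ .refl (by positivity)
  set v := s e₀ with hv
  let ball : ℕ → Finset P := fun i =>
    Finset.univ.filter fun x => Reach s d (fun _ => 1) (F : Set E) i v x
  have hball : ∀ i x, x ∈ ball i ↔ Reach s d (fun _ => 1) (F : Set E) i v x := by
    intro i x; simp [ball]
  have hvd : v ≠ d e₀ := fun hvd => hcyc e₀ he₀ (by rw [← hvd]; exact .refl (by positivity))
  have hb1 : 2 ≤ (ball 1).card := by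
    rw [← Finset.card_pair hvd]
    refine Finset.card_le_card fun x hx => ?_
    rw [hball]
    rcases Finset.mem_insert.1 hx with rfl | hx
    · exact .refl (by simp)
    · rw [Finset.mem_singleton.1 hx]
      exact (Reach.edge (Finset.mem_coe.2 he₀)).mono_len (by simp)
  obtain ⟨r, hr1, hr2, hr⟩ := exists_slow_growth (fun i => (ball i).card) h hh hb1
    ((Finset.card_le_univ _).trans hP)
  have hr2R : (r : ℝ) + 1 ≤ 2 * h := by exact_mod_cast hr2
  let I := F.filter fun e => s e ∈ ball r ∨ d e ∈ ball r
  have hI : I.card ≤ (ball (r + 1)).card :=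
    card_le_card_ball F I (Finset.filter_subset _ _) v r ball hball
      (fun e he hre => hcyc e he (hre.mono_len (by linarith)))
      (fun e he => (Finset.mem_filter.1 he).2)
  have hvr : v ∈ ball r := (hball _ _).2 (.refl (by positivity))
  have he₀I : e₀ ∈ I := Finset.mem_filter.2 ⟨he₀, .inl hvr⟩
  have hsub : F \ I ⊆ F := Finset.sdiff_subset
  have hlt : (F \ I).card < F.card := Finset.card_lt_card
    ⟨hsub, fun hc => (Finset.mem_sdiff.1 (hc he₀)).2 he₀I⟩
  obtain ⟨cl, h1, h2, h3, h4⟩ := ih _ hlt (F \ I) (fun e he hre => hcyc e (hsub he)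
    (hre.mono_set (Set.sdiff_subset_sdiff_left (by exact_mod_cast hsub)))) rfl
  have hiso : ∀ x y, Reach s d (fun _ => 1) ((F \ I : Finset E) : Set E) (4 * h) x y → x ≠ y →
      x ∉ ball r := by
    intro x y hxy hne hx
    cases hxy with
    | refl h0 => exact hne rfl
    | fwd he _ _ =>
      have := Finset.mem_sdiff.1 (Finset.mem_coe.1 he)
      exact this.2 (Finset.mem_filter.2 ⟨this.1, .inl hx⟩)
    | bwd he _ _ =>
      have := Finset.mem_sdiff.1 (Finset.mem_coe.1 he)
      exact this.2 (Finset.mem_filter.2 ⟨this.1, .inr hx⟩)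
  have hout : ∀ x, x ∉ ball r → ∀ y ∈ cl x, y ∉ ball r := by
    intro x hx y hy hyb
    by_cases hxy : y = x
    · exact hx (hxy ▸ hyb)
    · exact hiso y x (h3 x y hy).symm hxy hyb
  refine ⟨fun x => if x ∈ ball r then ball r else cl x, ?_, ?_, ?_, ?_⟩
  · intro x
    by_cases hx : x ∈ ball r <;> simp [hx, h1]
  · intro x y hy
    by_cases hx : x ∈ ball r
    · simp only [hx, if_true] at hy ⊢
      simp [hy]
    · simp only [hx, if_false] at hy ⊢
      simp [hout x hx y hy, h2 x y hy]
  · intro x y hy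
    by_cases hx : x ∈ ball r
    · simp only [hx, if_true] at hy
      exact (((hball _ _).1 hx).symm.trans ((hball _ _).1 hy)).mono_len (by linarith)
    · simp only [hx, if_false] at hy
      exact (h3 x y hy).mono_set (by exact_mod_cast hsub)
  · have hsingle : ∀ x ∈ ball r, Real.log (cl x).card = 0 := by
      intro x hx
      have : cl x = {x} := by
        refine Finset.eq_singleton_iff_unique_mem.2 ⟨h1 x, fun y hy => ?_⟩
        by_contra hne
        exact hiso x y (h3 x y hy) (Ne.symm hne) hx
      simp [this]
    have hsum : ∑ x, Real.log ((if x ∈ ball r then ball r else cl x).card) =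
        (ball r).card * Real.log (ball r).card + ∑ x, Real.log (cl x).card := by
      have e1 : ∀ x, Real.log ((if x ∈ ball r then ball r else cl x).card) =
          (if x ∈ ball r then Real.log (ball r).card else 0) + Real.log (cl x).card := by
        intro x
        by_cases hx : x ∈ ball r
        · simp [hx, hsingle x hx]
        · simp [hx]
      simp_rw [e1]
      rw [Finset.sum_add_distrib, ← Finset.sum_filter]
      simp
    rw [hsum]
    have hcard : F.card = (F \ I).card + I.card := by
      rw [Finset.card_sdiff_add_card_eq_card (Finset.filter_subset _ _)]
    have hI' : (I.card : ℝ) ≤ (ball (r + 1)).card := by exact_mod_cast hI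
    rw [hcard]
    push_cast
    linarith

end Clustering

/-- Replacing a positive function by its sums over the clusters of a partition increases the sum of
its logarithms at least by the sum of the logarithms of the cluster sizes. -/
theorem sum_log_add_sum_log_card_le {Q : Type*} [Fintype Q] [DecidableEq Q] (cl : Q → Finset Q)
    (hself : ∀ u, u ∈ cl u) (hcl : ∀ u, ∀ v ∈ cl u, cl v = cl u) (c : Q → ℝ) (hc : ∀ u, 0 < c u) :
    ∑ u, Real.log (c u) + ∑ u, Real.log (cl u).card ≤ ∑ u, Real.log (∑ v ∈ cl u, c v) := by
  have hsymm : ∀ u v, v ∈ cl u ↔ u ∈ cl v := fun u v =>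
    ⟨fun h => by rw [hcl u v h]; exact hself u, fun h => by rw [hcl v u h]; exact hself v⟩
  have hpos : ∀ u, 0 < ∑ v ∈ cl u, c v := fun u =>
    Finset.sum_pos (fun v _ => hc v) ⟨u, hself u⟩
  have hcard : ∀ u, (0 : ℝ) < (cl u).card := fun u => by
    exact_mod_cast Finset.card_pos.2 ⟨u, hself u⟩
  have hpt : ∀ u, Real.log (c u) + Real.log (cl u).card - Real.log (∑ v ∈ cl u, c v) ≤
      c u * (cl u).card / (∑ v ∈ cl u, c v) - 1 := by
    intro u
    rw [← Real.log_mul (hc u).ne' (hcard u).ne', ← Real.log_div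
      (mul_pos (hc u) (hcard u)).ne' (hpos u).ne']
    exact Real.log_le_sub_one_of_pos (div_pos (mul_pos (hc u) (hcard u)) (hpos u))
  have hone : ∑ u, c u * (cl u).card / (∑ v ∈ cl u, c v) = ∑ _u : Q, (1 : ℝ) := by
    calc ∑ u, c u * (cl u).card / (∑ v ∈ cl u, c v)
        = ∑ u, ∑ v, if v ∈ cl u then c u / (∑ x ∈ cl u, c x) else 0 := by
          refine Finset.sum_congr rfl fun u _ => ?_
          rw [← Finset.sum_filter, Finset.sum_const, nsmul_eq_mul]
          simp
          ring
      _ = ∑ v, ∑ u, if u ∈ cl v then c u / (∑ x ∈ cl v, c x) else 0 := by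
          rw [Finset.sum_comm]
          refine Finset.sum_congr rfl fun v _ => Finset.sum_congr rfl fun u _ => ?_
          by_cases h : v ∈ cl u
          · rw [if_pos h, if_pos ((hsymm u v).1 h), hcl u v h]
          · rw [if_neg h, if_neg (mt (hsymm u v).2 h)]
      _ = ∑ _v : Q, (1 : ℝ) := by
          refine Finset.sum_congr rfl fun v _ => ?_
          rw [← Finset.sum_filter]
          simp only [Finset.filter_mem_eq_inter, Finset.univ_inter]
          rw [← Finset.sum_div, div_self (hpos v).ne']
  have := Finset.sum_le_sum fun u (_ : u ∈ Finset.univ) => hpt u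
  simp only [Finset.sum_sub_distrib, Finset.sum_add_distrib] at this
  linarith

/-- Nodes of a multigraph are laid out on the real line by `a`; two points of the line are related
if they are joined by moving along the line and along edges in `A`, for a total length of at
most `ℓ`. -/
def LineReach {V E : Type*} (s d : E → V) (w : E → ℝ) (a : V → ℝ) (A : Set E) (ℓ α β : ℝ) : Prop :=
  |α - β| ≤ ℓ ∨ ∃ x y ℓ', Reach s d w A ℓ' x y ∧ |α - a x| + ℓ' + |a y - β| ≤ ℓ

namespace LineReach

variable {V E : Type*} {s d : E → V} {w : E → ℝ} {a : V → ℝ} {A A' : Set E}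
  {ℓ ℓ' α β γ : ℝ}

theorem mono_len (h : LineReach s d w a A ℓ α β) (hl : ℓ ≤ ℓ') :
    LineReach s d w a A ℓ' α β := by
  rcases h with h | ⟨x, y, k, h, hk⟩
  · exact .inl (h.trans hl)
  · exact .inr ⟨x, y, k, h, hk.trans hl⟩

theorem mono_set (h : LineReach s d w a A ℓ α β) (hA : A ⊆ A') :
    LineReach s d w a A' ℓ α β := by
  rcases h with h | ⟨x, y, k, h, hk⟩
  · exact .inl h
  · exact .inr ⟨x, y, k, h.mono_set hA, hk⟩

theorem symm (h : LineReach s d w a A ℓ α β) : LineReach s d w a A ℓ β α := by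
  rcases h with h | ⟨x, y, k, h, hk⟩
  · exact .inl (by rwa [abs_sub_comm])
  · refine .inr ⟨y, x, k, h.symm, ?_⟩
    rw [abs_sub_comm β, abs_sub_comm (a x)]
    linarith

theorem trans (hline : ∀ x y, Reach s d w A |a x - a y| x y) (h : LineReach s d w a A ℓ α β)
    (h' : LineReach s d w a A ℓ' β γ) : LineReach s d w a A (ℓ + ℓ') α γ := by
  rcases h with h | ⟨x, y, k, h, hk⟩ <;> rcases h' with h' | ⟨x', y', k', h', hk'⟩
  · exact .inl ((abs_sub_le _ β _).trans (add_le_add h h'))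
  · exact .inr ⟨x', y', k', h', by linarith [abs_sub_le α β (a x')]⟩
  · exact .inr ⟨x, y, k, h, by linarith [abs_sub_le (a y) β γ]⟩
  · exact .inr ⟨x, y', k + |a y - a x'| + k', (h.trans (hline y x')).trans h',
      by linarith [abs_sub_le (a y) β (a x')]⟩

theorem reach (hline : ∀ x y, Reach s d w A |a x - a y| x y) {x y : V}
    (h : LineReach s d w a A ℓ (a x) (a y)) : Reach s d w A ℓ x y := by
  rcases h with h | ⟨x', y', k, h, hk⟩
  · exact (hline x y).mono_len h
  · exact (((hline x x').trans h).trans (hline y' y)).mono_len hk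

theorem edge {e : E} (he : e ∈ A) : LineReach s d w a A (w e) (a (s e)) (a (d e)) :=
  .inr ⟨s e, d e, w e, Reach.edge he, by simp⟩

/-- A walk in a contracted multigraph whose nodes are short pieces of the line lifts to the line. -/
theorem of_blocks {B : Type*} (bl : V → B) (I : B → Set ℝ) {ρ ω : ℝ} (hω : 0 ≤ ω)
    (hI : ∀ X, ∀ α ∈ I X, ∀ β ∈ I X, |α - β| ≤ ρ) (ha : ∀ x, a x ∈ I (bl x))
    (hline : ∀ x y, Reach s d w A |a x - a y| x y) {F : Set E} (hFA : F ⊆ A)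
    (hF : ∀ e ∈ F, w e ≤ ω) {X Y : B} (hXY : Reach (bl ∘ s) (bl ∘ d) (fun _ => 1) F ℓ X Y)
    (hα : α ∈ I X) (hβ : β ∈ I Y) : LineReach s d w a A (ℓ * (ω + ρ) + ρ) α β := by
  have hρ : 0 ≤ ρ := (abs_nonneg _).trans (hI X α hα α hα)
  induction hXY generalizing α with
  | refl h0 => exact .inl ((hI _ α hα β hβ).trans (by nlinarith))
  | @fwd ℓ₀ ℓ₁ e q he _ hl ih =>
    have h1 : LineReach s d w a A ρ α (a (s e)) := .inl (hI _ _ hα _ (ha _))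
    refine ((h1.trans hline (edge (hFA he))).trans hline (ih (ha _) hβ)).mono_len ?_
    nlinarith [hF e he, mul_nonneg (sub_nonneg.2 hl) (add_nonneg hω hρ)]
  | @bwd ℓ₀ ℓ₁ e q he _ hl ih =>
    have h1 : LineReach s d w a A ρ α (a (d e)) := .inl (hI _ _ hα _ (ha _))
    refine ((h1.trans hline (edge (hFA he)).symm).trans hline (ih (ha _) hβ)).mono_len ?_
    nlinarith [hF e he, mul_nonneg (sub_nonneg.2 hl) (add_nonneg hω hρ)]

end LineReach

/-- One scale of the entropy argument: processing the edges `F` of weight at most `ω`, none of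
which can be bypassed at length `T`, enlarges the sets `S u` reachable from the positions `u`, at
the cost of a larger radius. The positions are grouped into blocks of diameter at most `ρ`. -/
theorem exists_entropy_step {V E Q B O : Type*} {s d : E → V} {w : E → ℝ} {a : V → ℝ}
    [Fintype Q] [Fintype B] [Fintype O] [DecidableEq E] {A : Set E}
    (hline : ∀ x y, Reach s d w A |a x - a y| x y)
    (φ : Q ≃ B × O) (χ : Q → ℝ) (bl : V → B) (I : B → Set ℝ) {ρ ω r T : ℝ} {h : ℕ} (hh : 1 ≤ h)
    (hω : 0 ≤ ω) (hωρ : ω ≤ ρ) (hr : 0 ≤ r)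
    (hI : ∀ X, ∀ α ∈ I X, ∀ β ∈ I X, |α - β| ≤ ρ) (ha : ∀ x, a x ∈ I (bl x))
    (hχ : ∀ u, χ u ∈ I (φ u).1) (hB : Fintype.card B ≤ (2 * h) ^ h)
    (S : Q → Finset Q) (hS : ∀ u, (S u).Nonempty)
    (hSr : ∀ u, ∀ z ∈ S u, LineReach s d w a A r (χ u) (χ z))
    (F : Finset E) (hFω : ∀ e ∈ F, w e ≤ ω) (hT : 2 * r + 18 * h * ρ ≤ T)
    (hF : ∀ e ∈ F, ¬ Reach s d w (A ∪ (F \ {e})) T (s e) (d e)) :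
    ∃ S' : Q → Finset Q, (∀ u, (S' u).Nonempty) ∧
      (∀ u, ∀ z ∈ S' u, LineReach s d w a (A ∪ F) (r + 9 * h * ρ) (χ u) (χ z)) ∧
      ∑ u, Real.log (S u).card + Fintype.card O * (F.card / 4) ≤ ∑ u, Real.log (S' u).card := by
  classical
  have hρ : 0 ≤ ρ := hω.trans hωρ
  have hh' : (1 : ℝ) ≤ h := by exact_mod_cast hh
  have hhop : 4 * (h : ℝ) * (ω + ρ) + ρ ≤ 9 * h * ρ := by nlinarith [mul_nonneg hρ hρ]
  have hlineX : ∀ X : Set E, ∀ x y, Reach s d w (A ∪ X) |a x - a y| x y := fun X x y =>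
    (hline x y).mono_set Set.subset_union_left
  have lift : ∀ G : Set E, G ⊆ F → ∀ X Y, Reach (bl ∘ s) (bl ∘ d) (fun _ => 1) G (4 * h) X Y →
      ∀ α ∈ I X, ∀ β ∈ I Y, LineReach s d w a (A ∪ G) (9 * h * ρ) α β :=
    fun G hG X Y hXY α hα β hβ => (LineReach.of_blocks bl I hω hI ha (hlineX G)
      Set.subset_union_right (fun e he => hFω e (hG he)) hXY hα hβ).mono_len hhop
  have hhρ : 0 ≤ h * ρ := by positivity
  obtain ⟨cl, hself, hcl, hreach, hcard⟩ := exists_clustering (s := bl ∘ s) (d := bl ∘ d) h hh hB F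
    (fun e he hre => hF e he ((lift _ Set.sdiff_subset _ _ hre _ (ha _) _ (ha _)).mono_len
      (by linarith) |>.reach (hlineX _)))
  let pcl : Q → Finset Q := fun u =>
    Finset.univ.filter fun v => (φ v).2 = (φ u).2 ∧ (φ v).1 ∈ cl (φ u).1
  have hmem : ∀ u v, v ∈ pcl u ↔ (φ v).2 = (φ u).2 ∧ (φ v).1 ∈ cl (φ u).1 := by
    intro u v; simp [pcl]
  have hpself : ∀ u, u ∈ pcl u := fun u => (hmem u u).2 ⟨rfl, hself _⟩
  have hpcl : ∀ u, ∀ v ∈ pcl u, pcl v = pcl u := by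
    intro u v hv
    rw [hmem] at hv
    ext z
    rw [hmem, hmem, hv.1, hcl _ _ hv.2]
  have hpcard : ∀ u, (pcl u).card = (cl (φ u).1).card := by
    intro u
    refine Finset.card_bij (fun v _ => (φ v).1) (fun v hv => ((hmem u v).1 hv).2) ?_ ?_
    · intro v hv v' hv' hvv
      exact φ.injective (Prod.ext hvv (((hmem u v).1 hv).1.trans ((hmem u v').1 hv').1.symm))
    · intro X hX
      exact ⟨φ.symm (X, (φ u).2), (hmem _ _).2 (by simpa using hX), by simp⟩
  have hdisj : ∀ u, ∀ x ∈ pcl u, ∀ y ∈ pcl u, x ≠ y → Disjoint (S x) (S y) := by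
    intro u x hx y hy hxy
    rw [Finset.disjoint_left]
    intro z hzx hzy
    rw [hmem] at hx hy
    have hne : (φ x).1 ≠ (φ y).1 := fun he =>
      hxy (φ.injective (Prod.ext he (hx.1.trans hy.1.symm)))
    have hyx : (φ y).1 ∈ cl (φ x).1 := by rw [hcl _ _ hx.2]; exact hy.2
    have hlow := (hSr x z hzx).trans hline (hSr y z hzy).symm
    obtain ⟨e, he, hcut⟩ := (hreach _ _ hyx).exists_cut (fun _ => le_rfl) hne
    have hlow' : LineReach s d w a (A ∪ (F \ {e} : Set E)) (r + r) (χ x) (χ y) :=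
      hlow.mono_set Set.subset_union_left
    refine hF e he (LineReach.reach (hlineX _) ?_)
    rcases hcut with ⟨h1, h2⟩ | ⟨h1, h2⟩
    · have g1 := lift _ Set.sdiff_subset _ _ h1 _ (hχ x) _ (ha _)
      have g2 := lift _ Set.sdiff_subset _ _ h2 _ (ha _) _ (hχ y)
      exact ((g1.symm.trans (hlineX _) hlow').trans (hlineX _) g2.symm).mono_len (by linarith)
    · have g1 := lift _ Set.sdiff_subset _ _ h1 _ (hχ x) _ (ha _)
      have g2 := lift _ Set.sdiff_subset _ _ h2 _ (ha _) _ (hχ y)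
      exact ((g2.trans (hlineX _) hlow'.symm).trans (hlineX _) g1).mono_len (by linarith)
  refine ⟨fun u => (pcl u).biUnion S, ?_, ?_, ?_⟩
  · intro u
    obtain ⟨z, hz⟩ := hS u
    exact ⟨z, Finset.mem_biUnion.2 ⟨u, hpself u, hz⟩⟩
  · intro u z hz
    obtain ⟨v, hv, hz⟩ := Finset.mem_biUnion.1 hz
    have g1 := lift _ subset_rfl _ _ (hreach _ _ ((hmem u v).1 hv).2) _ (hχ u) _ (hχ v)
    exact (g1.trans (hlineX _) ((hSr v z hz).mono_set Set.subset_union_left)).mono_len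
      (by linarith)
  · have hlog := sum_log_add_sum_log_card_le pcl hpself hpcl (fun u => ((S u).card : ℝ))
      (fun u => by exact_mod_cast (hS u).card_pos)
    have hbi : ∀ u, (((pcl u).biUnion S).card : ℝ) = ∑ v ∈ pcl u, ((S v).card : ℝ) := by
      intro u
      rw [Finset.card_biUnion (hdisj u)]
      push_cast
      rfl
    have hsum : ∑ u, Real.log (pcl u).card = Fintype.card O * ∑ X, Real.log (cl X).card := by
      simp_rw [hpcard]
      rw [Equiv.sum_comp φ (fun p => Real.log (cl p.1).card), Fintype.sum_prod_type]
      simp [Finset.mul_sum]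
    simp_rw [hbi]
    rw [hsum] at hlog
    have : (Fintype.card O : ℝ) * (F.card / 4) ≤
        Fintype.card O * ∑ X, Real.log (cl X).card := by
      gcongr
      linarith
    linarith

/-- Among the edges `G` there is a subfamily `F` none of whose members can be bypassed at
length `D`, but which yields bypasses of length `D + ω` for all of `G`. -/
theorem exists_unbypassed {V E : Type*} {s d : E → V} {w : E → ℝ} [DecidableEq E]
    (hw : ∀ e, 0 ≤ w e) (A : Set E) (G : Finset E) {D ω : ℝ} (hD : 0 ≤ D)
    (hG : ∀ e ∈ G, w e ≤ ω) :
    ∃ F ⊆ G, (∀ e ∈ F, ¬ Reach s d w (A ∪ (F \ {e})) D (s e) (d e)) ∧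
      ∀ f ∈ G, Reach s d w (A ∪ F) (D + ω) (s f) (d f) := by
  classical
  let C : Finset (Finset E) := G.powerset.filter fun F : Finset E =>
    ∀ e ∈ F, ¬ Reach s d w (A ∪ ((F : Set E) \ {e})) D (s e) (d e)
  obtain ⟨F, hFC, hmax⟩ := C.exists_max_image Finset.card ⟨∅, by simp [C]⟩
  obtain ⟨hFG, hF⟩ := Finset.mem_filter.1 hFC
  rw [Finset.mem_powerset] at hFG
  refine ⟨F, hFG, hF, fun f hf => ?_⟩
  have hf0 := (hw f).trans (hG f hf)
  by_cases hfF : f ∈ F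
  · exact (Reach.edge (.inr hfF)).mono_len (by linarith [hG f hf])
  have hnot : insert f F ∉ C := fun hc => by
    have := hmax _ hc
    rw [Finset.card_insert_of_notMem hfF] at this
    omega
  simp only [C, Finset.mem_filter, Finset.mem_powerset, Finset.insert_subset_iff, hf, hFG,
    true_and, not_forall, not_not] at hnot
  obtain ⟨e, he, hre⟩ := hnot
  rcases Finset.mem_insert.1 he with rfl | heF
  · refine (hre.mono_set (Set.union_subset_union_right _ ?_)).mono_len (by linarith)
    rw [Finset.coe_insert]
    exact fun x hx => hx.1.resolve_left hx.2
  · have hsub : (A ∪ ((insert f F : Finset E) \ {e}) : Set E) \ {f} ⊆ A ∪ (F \ {e}) := by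
      rintro x ⟨hx | hx, hxf⟩
      · exact .inl hx
      · rw [Finset.coe_insert] at hx
        exact .inr ⟨hx.1.resolve_left hxf, hx.2⟩
    have hsub' : (A ∪ (F \ {e}) : Set E) ⊆ A ∪ F :=
      Set.union_subset_union_right _ Set.sdiff_subset
    have heω := hG e (hFG heF)
    have hfw := hw f
    have he' : e ∈ (A ∪ F : Set E) := .inr heF
    rcases hre.split hw f with h | ⟨ℓ₁, ℓ₂, hl, ⟨h1, h2⟩ | ⟨h1, h2⟩⟩
    · exact absurd (h.mono_set hsub) (hF e heF)
    · exact ((((h1.mono_set (hsub.trans hsub')).symm.trans (Reach.edge he')).trans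
        (h2.mono_set (hsub.trans hsub')).symm)).mono_len (by linarith)
    · exact ((((h2.mono_set (hsub.trans hsub')).trans (Reach.edge_symm he')).trans
        (h1.mono_set (hsub.trans hsub')))).mono_len (by linarith)

/-- The hierarchical construction. The nodes are laid out on a line of length `2 ^ K * Λ * δ / 2`
whose moves are realised by the edges `A₀`. -/
theorem exists_light_hierarchy {V E : Type*} {s d : E → V} {w : E → ℝ} [DecidableEq E]
    (hw : ∀ e, 0 ≤ w e) {a : V → ℝ} {A₀ : Set E} (hline : ∀ x y, Reach s d w A₀ |a x - a y| x y)
    (G : Finset E) {δ : ℝ} (hδ : 0 < δ) {Λ K h : ℕ} (hΛ : 1 ≤ Λ) (hh : 1 ≤ h)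
    (hK : 2 ^ K ≤ (2 * h) ^ h) (ha0 : ∀ x, 0 ≤ a x) (ha : ∀ x, a x ≤ 2 ^ K * Λ * δ / 2) :
    ∃ A ⊆ G, ∑ e ∈ A, w e ≤ G.card * δ + 4 * 2 ^ K * δ * Real.log (Λ * 2 ^ K) ∧
      ∀ f ∈ G, w f ≤ 2 ^ K * δ → Reach s d w (A₀ ∪ A) (2 * (36 * h * Λ + 1) * w f) (s f) (d f) := by
  have hΛ' : (1 : ℝ) ≤ Λ := by exact_mod_cast hΛ
  have hh' : (1 : ℝ) ≤ h := by exact_mod_cast hh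
  let χ : Fin (Λ * 2 ^ K) → ℝ := fun u => (u : ℕ) * δ
  have main : ∀ j ≤ K, ∃ A ⊆ G, ∃ S : Fin (Λ * 2 ^ K) → Finset (Fin (Λ * 2 ^ K)),
      (∀ u, (S u).Nonempty) ∧
      (∀ u, ∀ z ∈ S u, LineReach s d w a (A₀ ∪ A) (18 * h * (Λ * (2 ^ j * δ))) (χ u) (χ z)) ∧
      ∑ e ∈ A, w e ≤ G.card * δ + 4 * δ / Λ * ∑ u, Real.log (S u).card ∧
      ∀ f ∈ G, w f ≤ 2 ^ j * δ →
        Reach s d w (A₀ ∪ A) (2 * (36 * h * Λ + 1) * w f) (s f) (d f) := by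
    intro j
    induction j with
    | zero =>
      intro _
      refine ⟨G.filter fun e => w e ≤ δ, Finset.filter_subset _ _, fun u => {u}, by simp,
        ?_, ?_, ?_⟩
      · intro u z hz
        rw [Finset.mem_singleton] at hz
        exact .inl (by rw [hz, sub_self, abs_zero]; positivity)
      · simp only [Finset.card_singleton, Nat.cast_one, Real.log_one, Finset.sum_const_zero,
          mul_zero, add_zero]
        calc ∑ e ∈ G with w e ≤ δ, w e ≤ (G.filter fun e => w e ≤ δ).card • δ :=
              Finset.sum_le_card_nsmul _ _ _ fun e he => (Finset.mem_filter.1 he).2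
          _ ≤ G.card * δ := by
              rw [nsmul_eq_mul]
              gcongr
              exact Finset.filter_subset _ _
      · intro f hf hfδ
        have hfA : f ∈ (A₀ ∪ (G.filter fun e => w e ≤ δ : Finset E) : Set E) :=
          .inr (Finset.mem_coe.2 (Finset.mem_filter.2 ⟨hf, by simpa using hfδ⟩))
        refine (Reach.edge hfA).mono_len ?_
        have : 0 ≤ (h : ℝ) * Λ := by positivity
        nlinarith [hw f, mul_nonneg this (hw f)]
    | succ j ih =>
      intro hj
      obtain ⟨A, hAG, S, hS, hSr, hsum, hreach⟩ := ih (by omega)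
      set ω : ℝ := 2 ^ (j + 1) * δ with hω
      have hω0 : 0 < ω := by positivity
      set ρ : ℝ := Λ * ω with hρ
      have hρ0 : 0 < ρ := by positivity
      have hlineA : ∀ X : Set E, ∀ x y, Reach s d w (A₀ ∪ X) |a x - a y| x y := fun X x y =>
        (hline x y).mono_set Set.subset_union_left
      obtain ⟨F, hFG, hF, hF'⟩ := exists_unbypassed (s := s) (d := d) hw (A₀ ∪ A)
        (G.filter fun e => w e ≤ ω) (D := 36 * h * ρ) (ω := ω) (by positivity)
        (fun e he => (Finset.mem_filter.1 he).2)
      have hN : Λ * 2 ^ K = 2 ^ (K - (j + 1)) * (Λ * 2 ^ (j + 1)) := by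
        rw [mul_left_comm, ← pow_add, Nat.sub_add_cancel hj]
      have hNR : (2 : ℝ) ^ K = 2 ^ (K - (j + 1)) * 2 ^ (j + 1) := by
        rw [← pow_add, Nat.sub_add_cancel hj]
      let φ : Fin (Λ * 2 ^ K) ≃ Fin (2 ^ (K - (j + 1))) × Fin (Λ * 2 ^ (j + 1)) :=
        (finCongr hN).trans finProdFinEquiv.symm
      have hφ : ∀ u : Fin (Λ * 2 ^ K), (u : ℕ) = (φ u).2 + Λ * 2 ^ (j + 1) * (φ u).1 := by
        intro u
        have h1 : finProdFinEquiv (φ u) = finCongr hN u :=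
          finProdFinEquiv.apply_symm_apply _
        have h2 := congrArg Fin.val h1
        simpa [finProdFinEquiv] using h2.symm
      have hbl : ∀ x, ⌊a x / ρ⌋₊ < 2 ^ (K - (j + 1)) := by
        intro x
        rw [Nat.floor_lt (div_nonneg (ha0 x) hρ0.le), div_lt_iff₀ hρ0]
        push_cast
        have h1 := ha x
        have h2 : (2 : ℝ) ^ K * Λ * δ = 2 ^ (K - (j + 1)) * ρ := by
          rw [hNR, hρ, hω]; ring
        have h3 : 0 < (2 : ℝ) ^ (K - (j + 1)) * ρ := by positivity
        linarith
      obtain ⟨S', hS', hSr', hent⟩ := exists_entropy_step (ρ := ρ) (ω := ω)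
        (r := 18 * h * (Λ * (2 ^ j * δ))) (T := 36 * h * ρ) (hlineA A) φ χ
        (fun x => ⟨⌊a x / ρ⌋₊, hbl x⟩)
        (fun X => Set.Icc ((X : ℕ) * ρ) (((X : ℕ) + 1) * ρ)) hh hω0.le
        (by nlinarith) (by positivity)
        (fun X α hα β hβ => abs_sub_le_iff.2
          ⟨by linarith [hα.1, hα.2, hβ.1, hβ.2], by linarith [hα.1, hα.2, hβ.1, hβ.2]⟩)
        (fun x => ⟨(le_div_iff₀ hρ0).1 (Nat.floor_le (div_nonneg (ha0 x) hρ0.le)),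
          ((div_lt_iff₀ hρ0).1 (Nat.lt_floor_add_one _)).le⟩)
        (fun u => by
          have h1 : ((u : ℕ) : ℝ) = ((φ u).2 : ℕ) + Λ * 2 ^ (j + 1) * ((φ u).1 : ℕ) := by
            exact_mod_cast hφ u
          have h2 : (((φ u).2 : ℕ) : ℝ) ≤ Λ * 2 ^ (j + 1) := by exact_mod_cast (φ u).2.2.le
          have h3 : (0 : ℝ) ≤ ((φ u).2 : ℕ) := by positivity
          have h4 : ρ = Λ * 2 ^ (j + 1) * δ := by rw [hρ, hω]; ring
          refine ⟨?_, ?_⟩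
          · simp only [χ, h1, h4]
            nlinarith
          · simp only [χ, h1, h4]
            nlinarith)
        (by
          rw [Fintype.card_fin]
          exact (Nat.pow_le_pow_right (by norm_num) (Nat.sub_le _ _)).trans hK)
        S hS hSr F (fun e he => (Finset.mem_filter.1 (hFG he)).2)
        (by rw [hρ, hω, pow_succ]; linarith) hF
      have hset : (A₀ ∪ (A ∪ F : Finset E) : Set E) = A₀ ∪ A ∪ F := by
        rw [Finset.coe_union, Set.union_assoc]
      refine ⟨A ∪ F, Finset.union_subset hAG (hFG.trans (Finset.filter_subset _ _)), S', hS',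
        ?_, ?_, ?_⟩
      · intro u z hz
        rw [hset]
        refine (hSr' u z hz).mono_len ?_
        rw [hρ, hω, pow_succ]
        linarith
      · have h1 : ∑ e ∈ F, w e ≤ F.card * ω := by
          rw [← nsmul_eq_mul]
          exact Finset.sum_le_card_nsmul _ _ _ fun e he => (Finset.mem_filter.1 (hFG he)).2
        have h2 : ∑ e ∈ A ∪ F, w e ≤ ∑ e ∈ A, w e + ∑ e ∈ F, w e := by
          rw [← Finset.sum_union_inter]
          linarith [Finset.sum_nonneg fun e (_ : e ∈ A ∩ F) => hw e]
        rw [Fintype.card_fin] at hent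
        have h3 := mul_le_mul_of_nonneg_left hent (by positivity : 0 ≤ 4 * δ / Λ)
        have h4 : 4 * δ / Λ * (((Λ * 2 ^ (j + 1) : ℕ) : ℝ) * (F.card / 4)) = F.card * ω := by
          push_cast
          rw [hω]
          field_simp
        linarith [h3, h4, mul_add (4 * δ / Λ) (∑ u, Real.log (S u).card)
          (((Λ * 2 ^ (j + 1) : ℕ) : ℝ) * (F.card / 4))]
      · intro f hf hfω
        rw [hset]
        by_cases hsmall : w f ≤ 2 ^ j * δ
        · exact (hreach f hf hsmall).mono_set Set.subset_union_left
        · refine (hF' f (Finset.mem_filter.2 ⟨hf, hfω⟩)).mono_len ?_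
          have h1 : ω ≤ 2 * w f := by
            rw [hω, pow_succ]
            linarith
          have h2 : 0 ≤ 36 * (h : ℝ) * Λ + 1 := by positivity
          rw [hρ]
          nlinarith [mul_le_mul_of_nonneg_left h1 h2]
  obtain ⟨A, hAG, S, hS, -, hsum, hreach⟩ := main K le_rfl
  refine ⟨A, hAG, hsum.trans ?_, hreach⟩
  have h1 : ∑ u, Real.log (S u).card ≤ Λ * 2 ^ K * Real.log (Λ * 2 ^ K) := by
    have : ∀ u ∈ Finset.univ, Real.log (S u).card ≤ Real.log (Λ * 2 ^ K) := by
      intro u _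
      refine Real.log_le_log (by exact_mod_cast (hS u).card_pos) ?_
      have := Finset.card_le_univ (S u)
      rw [Fintype.card_fin] at this
      exact_mod_cast this
    have h2 := Finset.sum_le_card_nsmul _ _ _ this
    rw [nsmul_eq_mul, Finset.card_univ, Fintype.card_fin] at h2
    exact_mod_cast h2
  have h2 := mul_le_mul_of_nonneg_left h1 (by positivity : 0 ≤ 4 * δ / Λ)
  have h3 : 4 * δ / Λ * (Λ * 2 ^ K * Real.log (Λ * 2 ^ K)) =
      4 * 2 ^ K * δ * Real.log (Λ * 2 ^ K) := by
    field_simp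
  linarith

/-- The vertices of a connected graph `T` can be laid out on a line of length twice the weight of
`T` so that distances on the line dominate distances in `T`. -/
theorem exists_layout {V : Type} [Fintype V] (T : SimpleGraph V) (hT : T.Connected)
    (w : Sym2 V → NNReal) :
    ∃ a : V → ℝ, (∀ x, 0 ≤ a x ∧ a x ≤ 2 * totalWeight T w) ∧
      ∀ x y, Reach Prod.fst Prod.snd (fun e : V × V => (w s(e.1, e.2) : ℝ)) {e | T.Adj e.1 e.2}
        |a x - a y| x y := by
  classical
  have main : ∀ k, 1 ≤ k → k ≤ Fintype.card V → ∃ (U : Finset V) (F : Finset (Sym2 V)) (a : V → ℝ),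
      U.card = k ∧ (∀ e ∈ F, e ∈ T.edgeSet ∧ ∀ x ∈ e, x ∈ U) ∧
      (∀ x ∈ U, 0 ≤ a x ∧ a x ≤ 2 * ∑ e ∈ F, (w e : ℝ)) ∧
      ∀ x ∈ U, ∀ y ∈ U, Reach Prod.fst Prod.snd (fun e : V × V => (w s(e.1, e.2) : ℝ))
        {e | T.Adj e.1 e.2} |a x - a y| x y := by
    intro k hk
    induction k, hk using Nat.le_induction with
    | base =>
      intro _
      obtain ⟨v⟩ := hT.nonempty
      refine ⟨{v}, ∅, fun _ => 0, by simp, by simp, by simp, ?_⟩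
      intro x hx y hy
      rw [Finset.mem_singleton.1 hx, Finset.mem_singleton.1 hy]
      exact .refl (by simp)
    | succ k hk ih =>
      intro hkV
      obtain ⟨U, F, a, hU, hF, ha, hre⟩ := ih (by omega)
      obtain ⟨x₀, hx₀⟩ : U.Nonempty := Finset.card_pos.1 (by omega)
      obtain ⟨y₀, hy₀⟩ : ∃ y, y ∉ U := by
        by_contra! hc
        rw [Finset.eq_univ_iff_forall.2 hc, Finset.card_univ] at hU
        omega
      obtain ⟨p⟩ := hT.preconnected x₀ y₀
      obtain ⟨dd, -, hp, hq⟩ := p.exists_boundary_dart (U : Set V) hx₀ hy₀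
      obtain ⟨⟨p, q⟩, hpq⟩ := dd
      simp only [Finset.mem_coe] at hp hq
      obtain ⟨c, hc⟩ : ∃ c : ℝ, c = w s(p, q) := ⟨_, rfl⟩
      have hc0 : 0 ≤ c := hc ▸ (w s(p, q)).2
      have hnF : s(p, q) ∉ F := fun hm => hq ((hF _ hm).2 q (Sym2.mem_mk_right p q))
      let a' : V → ℝ := fun x => if x = q then a p + c else if a x ≤ a p then a x else a x + 2 * c
      have ha'q : a' q = a p + c := by simp [a']
      have ha'U : ∀ x ∈ U, a' x = if a x ≤ a p then a x else a x + 2 * c := by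
        intro x hx
        have : x ≠ q := fun h => hq (h ▸ hx)
        simp [a', this]
      have hedge : Reach Prod.fst Prod.snd (fun e : V × V => (w s(e.1, e.2) : ℝ))
          {e | T.Adj e.1 e.2} c p q := hc ▸
        Reach.edge (s := Prod.fst) (d := Prod.snd) (w := fun e : V × V => (w s(e.1, e.2) : ℝ))
          (e := (p, q)) hpq
      have hqU : ∀ x ∈ U, Reach Prod.fst Prod.snd (fun e : V × V => (w s(e.1, e.2) : ℝ))
          {e | T.Adj e.1 e.2} |a' x - a' q| x q := by
        intro x hx
        refine ((hre x hx p hp).trans hedge).mono_len ?_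
        rw [ha'q, ha'U x hx]
        split_ifs with h
        · rw [abs_of_nonpos (by linarith), abs_of_nonpos (by linarith)]
          linarith
        · rw [abs_of_nonneg (by linarith), abs_of_nonneg (by linarith)]
          linarith
      have hUU : ∀ x ∈ U, ∀ y ∈ U, |a x - a y| ≤ |a' x - a' y| := by
        intro x hx y hy
        rw [ha'U x hx, ha'U y hy]
        split_ifs with h h' h'
        · exact le_rfl
        · rw [abs_of_nonpos (by linarith), abs_of_nonpos (by linarith)]
          linarith
        · rw [abs_of_nonneg (by linarith), abs_of_nonneg (by linarith)]
          linarith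
        · exact le_of_eq (by congr 1; ring)
      refine ⟨insert q U, insert s(p, q) F, a', ?_, ?_, ?_, ?_⟩
      · rw [Finset.card_insert_of_notMem hq, hU]
      · intro e he
        rcases Finset.mem_insert.1 he with rfl | he
        · refine ⟨hpq, fun x hx => ?_⟩
          rcases Sym2.mem_iff.1 hx with rfl | rfl
          · exact Finset.mem_insert_of_mem hp
          · exact Finset.mem_insert_self _ _
        · exact ⟨(hF e he).1, fun x hx => Finset.mem_insert_of_mem ((hF e he).2 x hx)⟩
      · intro x hx
        rw [Finset.sum_insert hnF, ← hc]
        rcases Finset.mem_insert.1 hx with rfl | hx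
        · have := ha p hp
          rw [ha'q]
          constructor <;> linarith
        · have := ha x hx
          rw [ha'U x hx]
          split_ifs <;> constructor <;> linarith
      · intro x hx y hy
        rcases Finset.mem_insert.1 hx with rfl | hxU <;>
          rcases Finset.mem_insert.1 hy with rfl | hyU
        · exact .refl (abs_nonneg _)
        · rw [abs_sub_comm]
          exact (hqU y hyU).symm
        · exact hqU x hxU
        · exact (hre x hxU y hyU).mono_len (hUU x hxU y hyU)
  have := hT.nonempty
  obtain ⟨U, F, a, hU, hF, ha, hre⟩ := main _ Fintype.card_pos le_rfl
  have hUu : ∀ x, x ∈ U := fun x => by rw [(Finset.card_eq_iff_eq_univ U).1 hU]; simp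
  refine ⟨a, fun x => ⟨(ha x (hUu x)).1, (ha x (hUu x)).2.trans ?_⟩,
    fun x y => hre x (hUu x) y (hUu y)⟩
  unfold totalWeight
  gcongr
  exact fun e he => by simpa using (hF e he).1

section WeightedDistance

variable {V : Type} {G H : SimpleGraph V} {w : Sym2 V → NNReal}

theorem wdist_self_eq_zero (x : V) : wdist H w x x = 0 :=
  le_antisymm ((iInf_le _ Walk.nil).trans (by simp [walkWeight])) zero_le

theorem wdist_le_of_adj {x y : V} (h : H.Adj x y) : wdist H w x y ≤ w s(x, y) :=
  (iInf_le _ (Walk.cons h Walk.nil)).trans (by simp [walkWeight])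

theorem wdist_triangle (x y z : V) : wdist H w x z ≤ wdist H w x y + wdist H w y z := by
  unfold wdist
  rw [ENNReal.iInf_add]
  refine le_iInf fun p => ?_
  rw [ENNReal.add_iInf]
  exact le_iInf fun q => (iInf_le _ (p.append q)).trans (by simp [walkWeight])

theorem Reach.wdist_le {A : Set (V × V)} (hA : ∀ e ∈ A, H.Adj e.1 e.2) {ℓ : ℝ} {x y : V}
    (h : Reach Prod.fst Prod.snd (fun e : V × V => (w s(e.1, e.2) : ℝ)) A ℓ x y) :
    wdist H w x y ≤ ENNReal.ofReal ℓ := by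
  have step : ∀ {x y z : V} {ℓ ℓ' : ℝ}, H.Adj x y → wdist H w y z ≤ ENNReal.ofReal ℓ → 0 ≤ ℓ →
      w s(x, y) + ℓ ≤ ℓ' → wdist H w x z ≤ ENNReal.ofReal ℓ' := by
    intro x y z ℓ ℓ' hxy hyz h0 hl
    calc wdist H w x z ≤ wdist H w x y + wdist H w y z := wdist_triangle _ _ _
      _ ≤ w s(x, y) + ENNReal.ofReal ℓ := add_le_add (wdist_le_of_adj hxy) hyz
      _ = ENNReal.ofReal (w s(x, y) + ℓ) := by
        rw [ENNReal.ofReal_add (NNReal.coe_nonneg _) h0, ENNReal.ofReal_coe_nnreal]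
      _ ≤ ENNReal.ofReal ℓ' := ENNReal.ofReal_le_ofReal hl
  have hw : ∀ e : V × V, (0 : ℝ) ≤ w s(e.1, e.2) := fun e => (w s(e.1, e.2)).2
  induction h with
  | refl h0 => simp [wdist_self_eq_zero]
  | fwd he h hl ih => exact step (hA _ he) ih (h.nonneg hw) hl
  | @bwd _ _ e _ he h hl ih =>
    exact step (hA _ he).symm ih (h.nonneg hw) (by rwa [Sym2.eq_swap])

/-- The spanner condition only has to be checked on the edges of the graph. -/
theorem isTSpanner_of_forall_adj {t : ℝ} (ht : 0 < t)
    (h : ∀ x y, G.Adj x y → wdist H w x y ≤ ENNReal.ofReal t * w s(x, y)) :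
    IsTSpanner G H w t := by
  have main : ∀ {x y : V} (p : G.Walk x y), wdist H w x y ≤ ENNReal.ofReal t * walkWeight w p := by
    intro x y p
    induction p with
    | nil => simp [wdist_self_eq_zero]
    | @cons x y z hxy p ih =>
      calc wdist H w x z ≤ wdist H w x y + wdist H w y z := wdist_triangle _ _ _
        _ ≤ ENNReal.ofReal t * w s(x, y) + ENNReal.ofReal t * walkWeight w p :=
          add_le_add (h x y hxy) ih
        _ = ENNReal.ofReal t * walkWeight w (Walk.cons hxy p) := by simp [walkWeight, mul_add]
  intro x y
  conv_rhs => rw [wdist]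
  rw [ENNReal.mul_iInf_of_ne (by simpa using ht) ENNReal.ofReal_ne_top]
  exact le_iInf fun p => main p

end WeightedDistance

theorem exists_isTree_totalWeight_eq_mstWeight {V : Type} [Fintype V] {G : SimpleGraph V}
    (hG : G.Connected) (w : Sym2 V → NNReal) :
    ∃ T ≤ G, T.IsTree ∧ totalWeight T w = mstWeight G w := by
  have hfin : {x | ∃ T : SimpleGraph V, T ≤ G ∧ T.IsTree ∧ x = totalWeight T w}.Finite :=
    (Set.finite_range fun T : SimpleGraph V => totalWeight T w).subset
      fun x ⟨T, _, _, hx⟩ => ⟨T, hx.symm⟩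
  obtain ⟨T₀, hT₀, hT₀'⟩ := hG.exists_isTree_le
  obtain ⟨T, hTG, hT, hx⟩ := Set.Nonempty.csInf_mem (by exact ⟨_, T₀, hT₀, hT₀', rfl⟩) hfin
  exact ⟨T, hTG, hT, hx.symm⟩

theorem totalWeight_pos {V : Type} [Fintype V] [Nontrivial V] {T : SimpleGraph V}
    (hT : T.Connected) {w : Sym2 V → NNReal} (hw : ∀ e ∈ T.edgeSet, 0 < w e) :
    0 < totalWeight T w := by
  obtain ⟨x, y, hxy⟩ := exists_pair_ne V
  obtain ⟨p⟩ := hT.preconnected x y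
  obtain ⟨e, -, -, -⟩ := p.exists_boundary_dart {x} rfl hxy.symm
  exact Finset.sum_pos (fun e he => by simpa using hw e (by simpa using he))
    ⟨e.edge, by simp⟩

/-- A choice of parameters for `exists_light_spanner` on `n` vertices. -/
theorem exists_hierarchy_parameters {n : ℕ} (hn : 16 ≤ n) :
    ∃ Λ K h : ℕ, 1 ≤ Λ ∧ 1 ≤ h ∧ n * n ≤ 2 ^ K ∧ 2 ^ K ≤ (2 * h) ^ h ∧
      0 < Real.logb 2 (Real.logb 2 n) ∧ 1 ≤ Real.logb 2 n ∧
      Real.logb 2 (Real.logb 2 n) ≤ Λ ∧ Real.logb 2 (Real.logb 2 n) ≤ 1.5 * Real.logb 2 n ∧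
      (h * Λ : ℝ) ≤ 10 * Real.logb 2 n ∧
      Real.log (Λ * 2 ^ K) ≤ 5 * Real.logb 2 n := by
  have hn' : (16 : ℝ) ≤ n := by exact_mod_cast hn
  set l := Real.logb 2 n with hl
  set m := Real.logb 2 l with hm
  have h2 := Real.log_two_gt_d9
  have h2' := Real.log_two_lt_d9
  have hl4 : 4 ≤ l := by
    rw [hl, Real.le_logb_iff_rpow_le (by norm_num) (by linarith)]
    norm_num
    exact hn
  have hm2 : 2 ≤ m := by
    rw [hm, Real.le_logb_iff_rpow_le (by norm_num) (by linarith)]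
    norm_num
    exact hl4
  have hmlog : m * Real.log 2 = Real.log l := by
    rw [hm, Real.logb, div_mul_cancel₀ _ (by linarith)]
  have hml : m ≤ 1.5 * l := by nlinarith [Real.log_le_sub_one_of_pos (by linarith : 0 < l)]
  have hs0 : 0 < √l := Real.sqrt_pos.2 (by linarith)
  have hss : √l * √l = l := Real.mul_self_sqrt (by linarith)
  have hslog : Real.log l = 2 * Real.log √l := by rw [Real.log_sqrt (by linarith)]; ring
  have hms : m ≤ 10 * √l := by nlinarith [Real.log_le_sub_one_of_pos hs0]
  have hΛ1 := Nat.le_ceil m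
  have hΛ2 := Nat.ceil_lt_add_one (by linarith : 0 ≤ m)
  have hh1 := Nat.le_ceil (5 * l / m)
  have hh2 := Nat.ceil_lt_add_one (by positivity : 0 ≤ 5 * l / m)
  have hhm : 5 * l ≤ ⌈5 * l / m⌉₊ * m := (div_le_iff₀ (by linarith)).1 hh1
  have hhs : √l ≤ 2 * ⌈5 * l / m⌉₊ := by nlinarith
  have hhp : (0 : ℝ) < ⌈5 * l / m⌉₊ := by linarith
  have hKl : (Nat.clog 2 (n * n) : ℝ) ≤ 2 * l + 1 := by
    have h1 : (Nat.clog 2 (n * n) - 1 : ℕ) < 2 * l := by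
      have h3 := Nat.pow_pred_clog_lt_self (b := 2) (by norm_num) (by nlinarith : 1 < n * n)
      have h4 : ((2 : ℝ) ^ (Nat.clog 2 (n * n) - 1)) < n * n := by exact_mod_cast h3
      have h5 := Real.log_lt_log (by positivity) h4
      rw [Real.log_pow, Real.log_mul (by linarith) (by linarith)] at h5
      have h6 : l * Real.log 2 = Real.log n := by
        rw [hl, Real.logb, div_mul_cancel₀ _ (by linarith)]
      nlinarith
    have h3 : (Nat.clog 2 (n * n) : ℝ) ≤ (Nat.clog 2 (n * n) - 1 : ℕ) + 1 := by
      exact_mod_cast (by omega)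
    linarith
  have hΛp : (0 : ℝ) < ⌈m⌉₊ := by linarith
  refine ⟨⌈m⌉₊, Nat.clog 2 (n * n), ⌈5 * l / m⌉₊, by exact_mod_cast hΛp, by exact_mod_cast hhp,
    Nat.le_pow_clog (by norm_num) _, ?_, by linarith, by linarith, hΛ1, hml, ?_, ?_⟩
  · have h1 : ((2 : ℝ) ^ Nat.clog 2 (n * n)) ≤ (2 * ⌈5 * l / m⌉₊) ^ ⌈5 * l / m⌉₊ := by
      refine le_trans ?_ (pow_le_pow_left₀ hs0.le hhs _)
      rw [← Real.log_le_log_iff (by positivity) (by positivity), Real.log_pow, Real.log_pow]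
      nlinarith
    exact_mod_cast h1
  · have h1 : 5 * l / m * m = 5 * l := div_mul_cancel₀ _ (by linarith)
    have h3 : (⌈5 * l / m⌉₊ : ℝ) * ⌈m⌉₊ ≤ (5 * l / m + 1) * (1.5 * m) :=
      mul_le_mul hh2.le (by linarith) hΛp.le (by linarith)
    linarith
  · rw [Real.log_mul hΛp.ne' (by positivity), Real.log_pow]
    have := Real.log_le_sub_one_of_pos hΛp
    have h3 : (Nat.clog 2 (n * n) : ℝ) * Real.log 2 ≤ Nat.clog 2 (n * n) * 1 := by
      gcongr
      linarith
    linarith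

/-- A light spanner of `G` containing the spanning subgraph `T`, for suitable parameters. -/
theorem exists_light_spanner {V : Type} [Fintype V] {G T : SimpleGraph V} {w : Sym2 V → NNReal}
    (hTG : T ≤ G) (hT : T.Connected) (hW : 0 < totalWeight T w) {Λ K h : ℕ} (hΛ : 1 ≤ Λ)
    (hh : 1 ≤ h) (hcard : Fintype.card V * Fintype.card V ≤ 2 ^ K) (hK : 2 ^ K ≤ (2 * h) ^ h) :
    ∃ H ≤ G, IsTSpanner G H w (2 * (36 * h * Λ + 1)) ∧
      totalWeight H w ≤ totalWeight T w +
        (4 * totalWeight T w / Λ + 16 * totalWeight T w / Λ * Real.log (Λ * 2 ^ K)) := by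
  classical
  set W := totalWeight T w with hWdef
  have hΛ' : (1 : ℝ) ≤ Λ := by exact_mod_cast hΛ
  have hh' : (1 : ℝ) ≤ h := by exact_mod_cast hh
  obtain ⟨a, ha, hline⟩ := exists_layout T hT w
  set δ : ℝ := 4 * W / (Λ * 2 ^ K) with hδ
  have hKδ : 2 ^ K * δ = 4 * W / Λ := by rw [hδ]; field_simp
  obtain ⟨A, hAG, hAw, hA⟩ := exists_light_hierarchy (w := fun e : V × V => (w s(e.1, e.2) : ℝ))
    (fun _ => NNReal.coe_nonneg _) hline
    (Finset.univ.filter fun e : V × V => G.Adj e.1 e.2) (δ := δ) (by positivity) hΛ hh hK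
    (fun x => (ha x).1) (fun x => (ha x).2.trans (by
      rw [mul_right_comm, hKδ]
      field_simp
      linarith))
  have hAG' : ∀ e ∈ A, G.Adj e.1 e.2 := fun e he => (Finset.mem_filter.1 (hAG he)).2
  let H : SimpleGraph V :=
    fromEdgeSet (T.edgeSet ∪ (A.image fun e => s(e.1, e.2) : Finset (Sym2 V)))
  have hHA : ∀ e ∈ ({e | T.Adj e.1 e.2} ∪ A : Set (V × V)), H.Adj e.1 e.2 := by
    rintro ⟨x, y⟩ (he | he)
    · exact (fromEdgeSet_adj _).2 ⟨.inl he, T.ne_of_adj he⟩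
    · exact (fromEdgeSet_adj _).2
        ⟨.inr (Finset.mem_coe.2 (Finset.mem_image_of_mem _ he)), G.ne_of_adj (hAG' _ he)⟩
  refine ⟨H, ?_, ?_, ?_⟩
  · intro x y hxy
    rcases ((fromEdgeSet_adj _).1 hxy).1 with h1 | h1
    · exact hTG h1
    · obtain ⟨e, he, hxy⟩ := Finset.mem_image.1 (Finset.mem_coe.1 h1)
      rw [← mem_edgeSet, ← hxy]
      exact hAG' e he
  · refine isTSpanner_of_forall_adj (by positivity) fun x y hxy => ?_
    have hreach : Reach Prod.fst Prod.snd (fun e : V × V => (w s(e.1, e.2) : ℝ))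
        ({e | T.Adj e.1 e.2} ∪ A) (2 * (36 * h * Λ + 1) * w s(x, y)) x y := by
      by_cases hxw : w s(x, y) ≤ 2 ^ K * δ
      · exact hA (x, y) (by simpa using hxy) hxw
      · refine ((hline x y).mono_set Set.subset_union_left).mono_len ?_
        have h1 : |a x - a y| ≤ 2 * W := abs_sub_le_iff.2
          ⟨by linarith [(ha x).2, (ha y).1], by linarith [(ha y).2, (ha x).1]⟩
        rw [hKδ, not_le, div_lt_iff₀ (by linarith)] at hxw
        have h2 : (0 : ℝ) ≤ w s(x, y) := (w s(x, y)).2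
        have h3 : (Λ : ℝ) ≤ h * Λ := le_mul_of_one_le_left (by linarith) hh'
        nlinarith [mul_le_mul_of_nonneg_left h3 h2, mul_nonneg h2 (by linarith : (0 : ℝ) ≤ Λ)]
    refine (hreach.wdist_le hHA).trans_eq ?_
    rw [ENNReal.ofReal_mul (by positivity), ENNReal.ofReal_coe_nnreal]
  · have h1 : totalWeight H w ≤ W + ∑ e ∈ A, (w s(e.1, e.2) : ℝ) := by
      have hnn : ∀ e : Sym2 V, (0 : ℝ) ≤ w e := fun e => (w e).2
      calc totalWeight H w
          ≤ ∑ e ∈ T.edgeSet.toFinite.toFinset ∪ A.image fun e => s(e.1, e.2), (w e : ℝ) := by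
            refine Finset.sum_le_sum_of_subset_of_nonneg (fun e he => ?_) fun e _ _ => hnn e
            have h2 : e ∈ H.edgeSet := by simpa using he
            rw [edgeSet_fromEdgeSet] at h2
            rcases h2.1 with h3 | h3
            · exact Finset.mem_union_left _ (by simpa using h3)
            · exact Finset.mem_union_right _ (Finset.mem_coe.1 h3)
        _ ≤ W + ∑ e ∈ A.image fun e => s(e.1, e.2), (w e : ℝ) := by
            rw [hWdef, totalWeight, ← Finset.sum_union_inter]
            linarith [Finset.sum_nonneg fun e (_ : e ∈ T.edgeSet.toFinite.toFinset ∩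
              A.image fun e => s(e.1, e.2)) => hnn e]
        _ ≤ W + ∑ e ∈ A, (w s(e.1, e.2) : ℝ) := by
            gcongr
            exact Finset.sum_image_le_of_nonneg fun e _ => hnn _
    have h2 : ((Finset.univ.filter fun e : V × V => G.Adj e.1 e.2).card : ℝ) ≤ 2 ^ K := by
      have := (Finset.card_le_univ (Finset.univ.filter fun e : V × V => G.Adj e.1 e.2)).trans
        (Fintype.card_prod V V ▸ hcard)
      exact_mod_cast this
    have h3 := mul_le_mul_of_nonneg_right h2 (by positivity : 0 ≤ δ)
    rw [mul_assoc 4, hKδ] at hAw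
    rw [hKδ] at h3
    have h4 : 4 * (4 * W / Λ) = 16 * W / Λ := by ring
    rw [h4] at hAw
    linarith

/-- There is a universal constant `C > 0` such that every connected weighted graph `G` on
`n ≥ 16` vertices admits a subgraph `H` that is a `(C·log n)`-spanner of `G` with
`w(H) ≤ C · (log n / log log n) · w(MST(G))`. -/
theorem spanner_logn_stretch_sublog_lightness :
    ∃ C : ℝ, 0 < C ∧
      ∀ (V : Type) [Fintype V] (G : SimpleGraph V) (w : Sym2 V → NNReal),
        16 ≤ Fintype.card V → G.Connected → (∀ e ∈ G.edgeSet, 0 < w e) →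
        ∃ H : SimpleGraph V, H ≤ G ∧
          IsTSpanner G H w (C * Real.logb 2 (Fintype.card V)) ∧
          totalWeight H w ≤
            C * (Real.logb 2 (Fintype.card V) /
                Real.logb 2 (Real.logb 2 (Fintype.card V))) * mstWeight G w := by
  refine ⟨1000, by norm_num, fun V _ G w hn hG hw => ?_⟩
  have : Nontrivial V := Fintype.one_lt_card_iff_nontrivial.1 (by omega)
  obtain ⟨T, hTG, hT, hTw⟩ := exists_isTree_totalWeight_eq_mstWeight hG w
  obtain ⟨Λ, K, h, hΛ, hh, hcard, hK, hm0, hl1, hmΛ, hml, hhΛ, hlog⟩ :=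
    exists_hierarchy_parameters hn
  have hW := totalWeight_pos hT.connected fun e he => hw e (edgeSet_mono hTG he)
  obtain ⟨H, hHG, hspan, hHw⟩ := exists_light_spanner hTG hT.connected hW hΛ hh hcard hK
  refine ⟨H, hHG, fun x y => (hspan x y).trans ?_, hHw.trans ?_⟩
  · have : 2 * (36 * h * Λ + 1) ≤ 1000 * Real.logb 2 (Fintype.card V) := by linarith
    gcongr
  · rw [← hTw]
    set W := totalWeight T w
    set l := Real.logb 2 (Fintype.card V)
    set m := Real.logb 2 l
    have h1 : 1 ≤ 1.5 * (l / m) := by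
      rw [← mul_div_assoc, le_div_iff₀ hm0]
      linarith
    have h2 : 4 * W / Λ ≤ 4 * W * (l / m) := by
      rw [mul_div_assoc, mul_assoc, ← mul_div_assoc]
      rw [div_le_iff₀ (by linarith)]
      have : 1 ≤ l / m * Λ := by
        rw [div_mul_eq_mul_div, le_div_iff₀ hm0]
        nlinarith
      nlinarith
    have h3 : 16 * W / Λ * Real.log (Λ * 2 ^ K) ≤ 80 * W * (l / m) := by
      calc 16 * W / Λ * Real.log (Λ * 2 ^ K) ≤ 16 * W / Λ * (5 * l) := by gcongr
        _ ≤ 16 * W / m * (5 * l) := by gcongr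
        _ = 80 * W * (l / m) := by ring
    nlinarith
end
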